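/- arXiv:2503.23648 — 3 statements merged into one kernel-verified Lean document; each statement's English description precedes it below -/
import Mathlib

section
/- For every integer N ≥ 2, the number of integers u with 0 < u < N for which there exist an integer t with 0 ≤ t < u and gcd(t,u) = 1, a natural number ℓ ≤ (log₂ N)/2, and exponents a₁, …, a_ℓ ∈ {1, 2} such that the integer column vector (u, t)ᵀ equals A^{a₁}·D·A^{a₂}·D·⋯·A^{a_ℓ}·D applied to (1, 0)ᵀ, is at least N^{1/4}/2 − 1. -/
open Matrix

/-- The matrix `A = [[1,1],[0,1]]` over the integers. -/
def matA : Matrix (Fin 2) (Fin 2) ℤ := !![1, 1; 0, 1]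

/-- The matrix `D = [[1,0],[1,1]]` over the integers. -/
def matD : Matrix (Fin 2) (Fin 2) ℤ := !![1, 0; 1, 1]

/-- The exponent in `{1, 2}` encoded by a Boolean. -/
def digitOf (b : Bool) : ℕ := if b then 2 else 1

/-- The vector `(u, t)` obtained by applying `A^{a₁} D ⋯ A^{a_ℓ} D` to `(1, 0)`, where the word
`a₁ ⋯ a_ℓ` is encoded by a list of Booleans. -/
def wordVec : List Bool → ℕ × ℕ
  | [] => (1, 0)
  | b :: l => (digitOf b * ((wordVec l).1 + (wordVec l).2) + (wordVec l).1,
      (wordVec l).1 + (wordVec l).2)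

lemma digitOf_eq (b : Bool) : digitOf b = 1 ∨ digitOf b = 2 := by
  cases b <;> simp [digitOf]

lemma wordVec_snd_lt_fst (l : List Bool) : (wordVec l).2 < (wordVec l).1 := by
  induction l with
  | nil => simp [wordVec]
  | cons b l ih =>
    rcases digitOf_eq b with h | h <;> simp only [wordVec, h] <;> omega

lemma wordVec_coprime (l : List Bool) : Nat.gcd (wordVec l).2 (wordVec l).1 = 1 := by
  induction l with
  | nil => simp [wordVec]
  | cons b l ih => simpa [wordVec, Nat.gcd_comm] using ih

lemma wordVec_add_le (l : List Bool) : (wordVec l).1 + (wordVec l).2 ≤ 4 ^ l.length := by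
  induction l with
  | nil => simp [wordVec]
  | cons b l ih =>
    rw [List.length_cons, pow_succ]
    rcases digitOf_eq b with h | h <;> simp only [wordVec, h] <;> omega

lemma wordVec_fst_lt {N : ℕ} (hN : 2 ≤ N) (l : List Bool) (hl : 4 ^ l.length ≤ N) :
    (wordVec l).1 < N := by
  cases l with
  | nil => exact hN
  | cons b l =>
    have h1 := wordVec_add_le (b :: l)
    have h2 := wordVec_snd_lt_fst l
    have h3 : (wordVec (b :: l)).2 = (wordVec l).1 + (wordVec l).2 := rfl
    omega

lemma wordVec_injective_of_length {l m : List Bool} (hlen : l.length = m.length)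
    (h : wordVec l = wordVec m) : l = m := by
  induction l generalizing m with
  | nil => exact (List.length_eq_zero_iff.mp hlen.symm).symm
  | cons b l ih =>
    cases m with
    | nil => simp at hlen
    | cons c m =>
      have hl := wordVec_snd_lt_fst l
      have hm := wordVec_snd_lt_fst m
      simp only [wordVec, Prod.mk.injEq] at h
      obtain ⟨h1, h2⟩ := h
      have hbc : b = c ∧ (wordVec l).1 = (wordVec m).1 := by
        cases b <;> cases c <;> simp [digitOf] at h1 ⊢ <;> omega
      obtain ⟨rfl, h3⟩ := hbc
      rw [ih (by simpa using hlen) (Prod.ext h3 (by omega))]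

lemma prod_mulVec_eq_wordVec (l : List Bool) :
    (l.map fun b => matA ^ digitOf b * matD).prod *ᵥ ![1, 0] =
      ![((wordVec l).1 : ℤ), ((wordVec l).2 : ℤ)] := by
  induction l with
  | nil => simp [wordVec]
  | cons b l ih =>
    rw [List.map_cons, List.prod_cons, ← Matrix.mulVec_mulVec, ih]
    ext i
    cases b <;> fin_cases i <;>
      simp [wordVec, digitOf, matA, matD, pow_two, Matrix.mulVec, dotProduct, Fin.sum_univ_two] <;>
      ring

/-- If the first coordinates of the vectors of all words of length at most `L + 1` lie in a finite
set `U`, then `U` has at least `2 ^ (L / 2)` elements: a word is determined by its first letter,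
its own first coordinate and the first coordinate of its tail. -/
lemma two_pow_le_card_sq {U : Finset ℕ} {L : ℕ}
    (hU : ∀ l : List Bool, l.length ≤ L + 1 → (wordVec l).1 ∈ U) :
    2 ^ L ≤ U.card ^ 2 := by
  let F : Bool × List.Vector Bool L → Bool × U × U := fun p =>
    (p.1, ⟨(wordVec (p.1 :: p.2.1)).1, hU _ (by simp)⟩, ⟨(wordVec p.2.1).1, hU _ (by simp)⟩)
  have hF : Function.Injective F := by
    rintro ⟨b, l⟩ ⟨c, m⟩ h
    simp only [F, Prod.mk.injEq, Subtype.mk.injEq, wordVec] at h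
    obtain ⟨rfl, h1, h2⟩ := h
    have h3 : (wordVec l.1).2 = (wordVec m.1).2 := by
      cases b <;> simp [digitOf] at h1 <;> omega
    exact congrArg _ (Subtype.ext
      (wordVec_injective_of_length (l.2.trans m.2.symm) (Prod.ext h2 h3)))
  have hcard := Fintype.card_le_of_injective F hF
  simp only [Fintype.card_prod, Fintype.card_bool, card_vector, Fintype.card_coe] at hcard
  nlinarith

/-- For every `N ≥ 2`, at least `N^{1/4}/2 - 1` values `0 < u < N` admit a coprime `t < u`,
an `ℓ ≤ (log₂ N)/2` and exponents `a₁, …, a_ℓ ∈ {1,2}` with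
`(u,t)ᵀ = A^{a₁} D ⋯ A^{a_ℓ} D (1,0)ᵀ`. -/
theorem weak_zaremba (N : ℕ) (hN : 2 ≤ N) :
    (N : ℝ) ^ ((1 : ℝ) / 4) / 2 - 1 ≤
      (Set.ncard {u : ℕ | 0 < u ∧ u < N ∧ ∃ t : ℕ, t < u ∧ Nat.gcd t u = 1 ∧
        ∃ ℓ : ℕ, (ℓ : ℝ) ≤ Real.logb 2 N / 2 ∧
          ∃ a : Fin ℓ → ℕ, (∀ j, a j = 1 ∨ a j = 2) ∧
            (List.ofFn fun j => matA ^ (a j) * matD).prod *ᵥ ![1, 0] =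
              ![(u : ℤ), (t : ℤ)]} : ℝ) := by
  classical
  set S := {u : ℕ | 0 < u ∧ u < N ∧ ∃ t : ℕ, t < u ∧ Nat.gcd t u = 1 ∧
        ∃ ℓ : ℕ, (ℓ : ℝ) ≤ Real.logb 2 N / 2 ∧
          ∃ a : Fin ℓ → ℕ, (∀ j, a j = 1 ∨ a j = 2) ∧
            (List.ofFn fun j => matA ^ (a j) * matD).prod *ᵥ ![1, 0] =
              ![(u : ℤ), (t : ℤ)]}
  have hfin : S.Finite := (Set.finite_lt_nat N).subset fun u hu => hu.2.1
  have hmem : ∀ l : List Bool, 4 ^ l.length ≤ N → (wordVec l).1 ∈ S := by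
    intro l hl
    have hlt := wordVec_snd_lt_fst l
    refine ⟨by omega, wordVec_fst_lt hN l hl, (wordVec l).2, hlt, wordVec_coprime l,
      l.length, ?_, fun j => digitOf (l.get j), fun j => digitOf_eq _, ?_⟩
    · rw [le_div_iff₀ two_pos, Real.le_logb_iff_rpow_le one_lt_two (by positivity), mul_comm,
        Real.rpow_mul two_pos.le, Real.rpow_natCast]
      norm_num
      exact_mod_cast hl
    · rw [← prod_mulVec_eq_wordVec l]
      congr 2
      conv_rhs => rw [← List.ofFn_get l, List.map_ofFn]
      rfl
  have hupper : N < 4 ^ (Nat.log 4 N + 1) := Nat.lt_pow_succ_log_self (by norm_num) N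
  have hbound : N ≤ (2 * S.ncard) ^ 4 := by
    rcases hL : Nat.log 4 N with _ | L
    · have hpos : 0 < S.ncard :=
        (Set.ncard_pos hfin).mpr ⟨_, hmem [] (by simp; omega)⟩
      rw [hL] at hupper
      calc N ≤ (2 * 1) ^ 4 := by omega
        _ ≤ (2 * S.ncard) ^ 4 := by gcongr; exact hpos
    · have hcard := two_pow_le_card_sq (U := hfin.toFinset) (L := L) fun l hl =>
        hfin.mem_toFinset.mpr (hmem l ((Nat.pow_le_pow_right (by norm_num) (hl.trans hL.ge)).trans
          (Nat.pow_log_le_self 4 (by omega))))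
      rw [← Set.ncard_eq_toFinset_card S hfin] at hcard
      rw [hL] at hupper
      calc N ≤ 16 * (2 ^ L) ^ 2 := by
            rw [← pow_mul, mul_comm L, pow_mul]; rw [pow_succ, pow_succ] at hupper; norm_num; omega
        _ ≤ 16 * (S.ncard ^ 2) ^ 2 := by gcongr
        _ = (2 * S.ncard) ^ 4 := by ring
  have hroot : (N : ℝ) ^ ((1 : ℝ) / 4) ≤ 2 * S.ncard := by
    calc (N : ℝ) ^ ((1 : ℝ) / 4) ≤ ((2 * S.ncard : ℝ) ^ 4) ^ ((1 : ℝ) / 4) := by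
          gcongr
          exact_mod_cast hbound
      _ = 2 * S.ncard := by
          rw [← Real.rpow_natCast, ← Real.rpow_mul (by positivity)]
          norm_num
  linarith
end

section
/- There exists a constant C > 0 such that for every sufficiently large integer N and every integer u with 0 ≤ u < N, there exist a natural number ℓ ≤ C·log N, exponents a₁, …, a_ℓ ∈ {1, 2}, and coprime positive integers q and p such that the integer column vector (q, p)ᵀ equals A^{a₁}·D·A^{a₂}·D·⋯·A^{a_ℓ}·D applied to (1, 0)ᵀ, the residue of q is a unit in ℤ/Nℤ, and p ≡ u·q (mod N). -/
open Matrix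

open scoped MatrixGroups

/-- A weak form of the divisor bound `τ(n) ≪ n ^ (1/20)`. -/
theorem card_divisors_pow_le : ∃ C : ℕ, 0 < C ∧ ∀ n : ℕ, n ≠ 0 → n.divisors.card ^ 20 ≤ C * n := by
  obtain ⟨K, hK1, hK⟩ : ∃ K : ℕ, 1 ≤ K ∧ ∀ e : ℕ, (e + 1) ^ 20 ≤ K * 2 ^ e := by
    have h1 : Filter.Tendsto (fun n : ℕ => ((n : ℝ) ^ 20 / (2 : ℝ) ^ n)) Filter.atTop (nhds 0) :=
      tendsto_pow_const_div_const_pow_of_one_lt 20 (by norm_num)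
    obtain ⟨B, hB⟩ := h1.bddAbove_range
    obtain ⟨K, hK⟩ := exists_nat_ge (max B 1 * 2)
    refine ⟨K, ?_, fun e => ?_⟩
    · have : (1 : ℝ) ≤ K := by linarith [le_max_right B 1]
      exact_mod_cast this
    · have h2 := hB (Set.mem_range_self (e + 1))
      beta_reduce at h2
      rw [div_le_iff₀ (by positivity)] at h2
      have h3 : ((e + 1 : ℕ) : ℝ) ^ 20 ≤ K * 2 ^ e := by
        have h5 : (0 : ℝ) ≤ 2 ^ e := by positivity
        calc ((e + 1 : ℕ) : ℝ) ^ 20 ≤ B * 2 ^ (e + 1) := h2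
          _ ≤ (max B 1) * 2 ^ (e + 1) := by gcongr; exact le_max_left _ _
          _ = (max B 1 * 2) * 2 ^ e := by ring
          _ ≤ K * 2 ^ e := by gcongr
      exact_mod_cast h3
  refine ⟨K ^ (2 ^ 20), by positivity, fun n hn => ?_⟩
  have key : ∀ p ∈ n.primeFactors, (n.factorization p + 1) ^ 20 ≤
      (if p < 2 ^ 20 then K else 1) * p ^ n.factorization p := by
    intro p hp
    have hp2 := (Nat.prime_of_mem_primeFactors hp).two_le
    split_ifs with h
    · exact (hK _).trans (by gcongr)
    · push Not at h
      rw [one_mul]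
      calc (n.factorization p + 1) ^ 20 ≤ (2 ^ n.factorization p) ^ 20 := by
            gcongr; exact Nat.lt_two_pow_self
        _ = (2 ^ 20) ^ n.factorization p := by rw [← pow_mul, ← pow_mul, mul_comm]
        _ ≤ _ := by gcongr
  rw [Nat.card_divisors hn, ← Finset.prod_pow]
  refine (Finset.prod_le_prod' key).trans ?_
  rw [Finset.prod_mul_distrib]
  have h2 : ∏ p ∈ n.primeFactors, p ^ n.factorization p = n :=
    Nat.prod_factorization_pow_eq_self hn
  rw [h2]
  gcongr
  rw [Finset.prod_ite, Finset.prod_const, Finset.prod_const_one, mul_one]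
  refine Nat.pow_le_pow_right hK1 ?_
  calc _ ≤ (Finset.range (2 ^ 20)).card := by
        refine Finset.card_le_card fun p hp => ?_
        simp only [Finset.mem_filter] at hp
        exact Finset.mem_range.2 hp.2
    _ = _ := Finset.card_range _

theorem sl_mul_apply {R : Type*} [CommRing R] (g h : SL(2, R)) (i j : Fin 2) :
    (g * h) i j = g i 0 * h 0 j + g i 1 * h 1 j := by
  have := congrFun (congrFun (Matrix.SpecialLinearGroup.coe_mul g h) i) j
  rwa [Matrix.mul_apply, Fin.sum_univ_two] at this

/-- The determinant of two integer vectors. -/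
def cross (r r' : ℤ × ℤ) : ℤ := r.1 * r'.2 - r.2 * r'.1

theorem exists_smul_of_cross_eq_zero {r w : ℤ × ℤ} (hr : IsCoprime r.1 r.2)
    (h : cross r w = 0) : ∃ k : ℤ, w = k • r := by
  obtain ⟨s, t, hst⟩ := hr
  unfold cross at h
  refine ⟨s * w.1 + t * w.2, Prod.ext ?_ ?_⟩
  · simp only [Prod.smul_fst, smul_eq_mul]
    linear_combination (-w.1) * hst - t * h
  · simp only [Prod.smul_snd, smul_eq_mul]
    linear_combination (-w.2) * hst + s * h

/-- A seminorm on `ℤ²` whose unit ball is finite and has covolume controlled by `Δ`. -/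
structure LatticeNorm (F : ℤ × ℤ → ℝ) (Δ : ℝ) : Prop where
  nonneg : ∀ r, 0 ≤ F r
  sub_le : ∀ r r', F (r - r') ≤ F r + F r'
  smul : ∀ (k : ℤ) r, F (k • r) = |(k : ℝ)| * F r
  cross_le : ∀ r r', |(cross r r' : ℝ)| ≤ Δ * F r * F r'
  finite : {r | F r ≤ 1}.Finite

namespace LatticeNorm

variable {F : ℤ × ℤ → ℝ} {Δ : ℝ}

theorem card_Icc_floor_le {y : ℝ} (hy : 0 ≤ y) :
    ((Finset.Icc (-⌊y⌋) ⌊y⌋).card : ℝ) ≤ 2 * y + 1 := by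
  have h0 : 0 ≤ ⌊y⌋ := Int.floor_nonneg.2 hy
  rw [Int.card_Icc]
  have : (((⌊y⌋ + 1 - -⌊y⌋).toNat : ℤ) : ℝ) = 2 * (⌊y⌋ : ℝ) + 1 := by
    rw [Int.toNat_of_nonneg (by omega)]; push_cast; ring
  have h2 := Int.floor_le y
  rw [← Int.cast_natCast (R := ℝ), this]
  linarith

theorem mem_Icc_floor {y : ℝ} {k : ℤ} (h : |(k : ℝ)| ≤ y) : k ∈ Finset.Icc (-⌊y⌋) ⌊y⌋ := by
  rw [Finset.mem_Icc]
  have h1 := abs_le.1 h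
  have h2 : -k ≤ ⌊y⌋ := Int.le_floor.2 (by push_cast; linarith)
  exact ⟨by omega, Int.le_floor.2 h1.2⟩

/-- The unit ball has `O(Δ)` points once it contains a basis. -/
theorem card_le (hF : LatticeNorm F Δ) {r₁ r₂ : ℤ × ℤ} (h1 : F r₁ ≤ 1) (h2 : F r₂ ≤ 1)
    (h12 : cross r₁ r₂ = 1) : (hF.finite.toFinset.card : ℝ) ≤ 15 * Δ := by
  classical
  set E := hF.finite.toFinset with hE
  have memE : ∀ r, r ∈ E ↔ F r ≤ 1 := fun r => by simp [hE]
  have hr1 : r₁ ≠ 0 := by rintro rfl; simp [cross] at h12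
  obtain ⟨r₀, hr₀, hmin⟩ := Finset.exists_min_image (E.filter (· ≠ 0)) F
    ⟨r₁, by simp [memE, h1, hr1]⟩
  simp only [Finset.mem_filter, memE] at hr₀ hmin
  obtain ⟨hr₀1, hr₀0⟩ := hr₀
  set β := F r₀ with hβ
  have hdet : ∃ r', F r' ≤ 1 ∧ cross r₀ r' ≠ 0 := by
    by_contra! hcon
    have e1 := hcon r₁ h1
    have e2 := hcon r₂ h2
    apply hr₀0
    unfold cross at *
    refine Prod.ext ?_ ?_
    · simp only [Prod.fst_zero]
      linear_combination (-r₀.1) * h12 - r₂.1 * e1 + r₁.1 * e2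
    · simp only [Prod.snd_zero]
      linear_combination (-r₀.2) * h12 - r₂.2 * e1 + r₁.2 * e2
  have hΔβ : 1 ≤ Δ * β := by
    obtain ⟨r', hr', hne⟩ := hdet
    have e1 : (1 : ℝ) ≤ |(cross r₀ r' : ℝ)| := by
      exact_mod_cast Int.one_le_abs hne
    have e2 := hF.cross_le r₀ r'
    have e3 : 0 ≤ Δ * β := by
      by_contra! hneg
      nlinarith [hF.nonneg r']
    nlinarith [hF.nonneg r']
  have hβ0 : 0 < β := by
    rcases (hF.nonneg r₀).lt_or_eq with h | h
    · exact h
    · rw [hβ, ← h] at hΔβ; norm_num at hΔβ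
  have hcop : IsCoprime r₀.1 r₀.2 := by
    rw [Int.isCoprime_iff_gcd_eq_one]
    set g := Int.gcd r₀.1 r₀.2 with hg
    have hg0 : g ≠ 0 := by
      intro h0
      rw [hg, Int.gcd_eq_zero_iff] at h0
      exact hr₀0 (Prod.ext h0.1 h0.2)
    obtain ⟨a, ha⟩ : (g : ℤ) ∣ r₀.1 := Int.gcd_dvd_left ..
    obtain ⟨b, hb⟩ : (g : ℤ) ∣ r₀.2 := Int.gcd_dvd_right ..
    have hab : r₀ = (g : ℤ) • (a, b) := Prod.ext (by simpa using ha) (by simpa using hb)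
    have hab0 : (a, b) ≠ (0 : ℤ × ℤ) := by
      intro h; rw [h, smul_zero] at hab; exact hr₀0 hab
    have e1 := hF.smul g (a, b)
    rw [← hab, ← hβ, Int.cast_natCast, Nat.abs_cast] at e1
    by_contra hne
    have hg2 : (2 : ℝ) ≤ g := by exact_mod_cast (by omega : 2 ≤ g)
    have h3 : F (a, b) ≤ β := by nlinarith [hF.nonneg (a, b)]
    have h4 := hmin (a, b) ⟨h3.trans hr₀1, hab0⟩
    nlinarith
  have hfib : ∀ j ∈ Finset.Icc (-⌊Δ * β⌋) ⌊Δ * β⌋,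
      ((E.filter fun r => cross r₀ r = j).card : ℝ) ≤ 5 / β := by
    intro j _
    rcases (E.filter fun r => cross r₀ r = j).eq_empty_or_nonempty with h | ⟨r', hr'⟩
    · rw [h]; simp; positivity
    simp only [Finset.mem_filter, memE] at hr'
    have : (E.filter fun r => cross r₀ r = j) ⊆
        (Finset.Icc (-⌊2 / β⌋) ⌊2 / β⌋).image fun k : ℤ => r' + k • r₀ := by
      intro r hr
      simp only [Finset.mem_filter, memE] at hr
      obtain ⟨k, hk⟩ := exists_smul_of_cross_eq_zero (w := r - r') hcop (by
        have a1 := hr.2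
        have a2 := hr'.2
        simp only [cross, Prod.fst_sub, Prod.snd_sub] at *
        linear_combination a1 - a2)
      refine Finset.mem_image.2 ⟨k, mem_Icc_floor ?_, ?_⟩
      · have := hF.sub_le r r'
        rw [hk, hF.smul, ← hβ] at this
        rw [le_div_iff₀ hβ0]
        linarith [hr.1, hr'.1]
      · rw [← hk]; abel
    have h2 := (Finset.card_le_card this).trans Finset.card_image_le
    have h3 : ((Finset.Icc (-⌊2 / β⌋) ⌊2 / β⌋).card : ℝ) ≤ 2 * (2 / β) + 1 :=
      card_Icc_floor_le (by positivity)
    have h4 : 1 ≤ 1 / β := by rw [le_div_iff₀ hβ0]; linarith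
    calc ((E.filter fun r => cross r₀ r = j).card : ℝ) ≤ _ := by exact_mod_cast h2
      _ ≤ 2 * (2 / β) + 1 := h3
      _ ≤ 2 * (2 / β) + 1 / β := by linarith
      _ = 5 / β := by ring
  have hmaps : ∀ r ∈ E, cross r₀ r ∈ Finset.Icc (-⌊Δ * β⌋) ⌊Δ * β⌋ := by
    intro r hr
    rw [memE] at hr
    refine mem_Icc_floor ((hF.cross_le r₀ r).trans ?_)
    rw [← hβ]
    nlinarith [hF.nonneg r]
  rw [Finset.card_eq_sum_card_fiberwise (f := cross r₀) (t := Finset.Icc (-⌊Δ * β⌋) ⌊Δ * β⌋) hmaps]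
  push_cast
  calc _ ≤ ∑ _j ∈ Finset.Icc (-⌊Δ * β⌋) ⌊Δ * β⌋, 5 / β := Finset.sum_le_sum hfib
    _ = ((Finset.Icc (-⌊Δ * β⌋) ⌊Δ * β⌋).card : ℝ) * (5 / β) := by simp
    _ ≤ (2 * (Δ * β) + 1) * (5 / β) := by
        gcongr; exact card_Icc_floor_le (by linarith)
    _ ≤ (3 * (Δ * β)) * (5 / β) := by gcongr; linarith
    _ = 15 * Δ := by field_simp; ring

/-- The rows of an integral matrix. -/
def row (h : SL(2, ℤ)) (i : Fin 2) : ℤ × ℤ := (h i 0, h i 1)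

theorem cross_row (h : SL(2, ℤ)) : cross (row h 0) (row h 1) = 1 := by
  have := h.det_coe
  rw [det_fin_two] at this
  simpa [cross, row] using this

theorem isCoprime_row (h : SL(2, ℤ)) :
    IsCoprime (row h 0).1 (row h 0).2 :=
  ⟨h 1 1, -h 1 0, by have := cross_row h; simp only [cross, row] at *; linarith⟩

/-- Matrices of determinant one whose rows lie in the unit ball. -/
theorem card_matrices_le (hF : LatticeNorm F Δ) (S : Finset (SL(2, ℤ)))
    (hS : ∀ h ∈ S, ∀ i, F (row h i) ≤ 1) (hΔ : 0 ≤ Δ) : (S.card : ℝ) ≤ 150 * Δ := by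
  classical
  rcases S.eq_empty_or_nonempty with rfl | ⟨h₀, hh₀⟩
  · simp; positivity
  have hE := hF.card_le (hS _ hh₀ 0) (hS _ hh₀ 1) (cross_row h₀)
  set E := hF.finite.toFinset with hEdef
  have memE : ∀ r, r ∈ E ↔ F r ≤ 1 := fun r => by simp [hEdef]
  have main : ∀ S' : Finset (SL(2, ℤ)), (∀ h ∈ S', ∀ i, F (row h i) ≤ 1) →
      (∀ h ∈ S', F (row h 1) ≤ F (row h 0)) → S'.card ≤ 5 * E.card := by
    intro S' h1 h2
    refine Finset.card_le_mul_card_image_of_maps_to (f := fun h => row h 0)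
      (fun h hh => (memE _).2 (h1 h hh 0)) 5 fun r _ => ?_
    rcases (S'.filter fun h => row h 0 = r).eq_empty_or_nonempty with h | ⟨h', hh'⟩
    · rw [h]; simp
    simp only [Finset.mem_filter] at hh'
    have inj : Set.InjOn (fun h : SL(2, ℤ) => row h 1)
        (S'.filter fun h => row h 0 = r : Finset _) := by
      intro a ha b hb hab
      simp only [Finset.coe_filter, Set.mem_ofPred_eq] at ha hb
      have e := ha.2.trans hb.2.symm
      simp only [row, Prod.mk.injEq] at e hab
      ext i j
      fin_cases i <;> fin_cases j <;> simp [e, hab]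
    rw [← Finset.card_image_of_injOn inj]
    have : ((S'.filter fun h => row h 0 = r).image fun h => row h 1) ⊆
        (Finset.Icc (-2 : ℤ) 2).image fun k : ℤ => row h' 1 + k • r := by
      intro w hw
      simp only [Finset.mem_image, Finset.mem_filter] at hw
      obtain ⟨h, ⟨hS', hr⟩, rfl⟩ := hw
      obtain ⟨k, hk⟩ := exists_smul_of_cross_eq_zero (w := row h 1 - row h' 1) (isCoprime_row h) (by
        have a1 := cross_row h
        have a2 := cross_row h'
        rw [hh'.2, ← hr] at a2
        simp only [cross, Prod.fst_sub, Prod.snd_sub] at *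
        linear_combination a1 - a2)
      have b1 := hF.sub_le (row h 1) (row h' 1)
      rw [hk, hF.smul] at b1
      have b2 := h2 h hS'
      have b3 := h2 h' hh'.1
      have b4 : F (row h' 0) = F (row h 0) := by rw [hh'.2, hr]
      have pos : 0 < F (row h 0) := by
        rcases (hF.nonneg (row h 0)).lt_or_eq with hp | hp
        · exact hp
        · have := hF.cross_le (row h 0) (row h 1)
          rw [cross_row, ← hp] at this
          norm_num at this
      have b5 : |(k : ℝ)| ≤ 2 := by
        by_contra! hlt
        nlinarith
      have b6 := abs_le.1 b5
      refine Finset.mem_image.2 ⟨k, Finset.mem_Icc.2 ⟨by exact_mod_cast b6.1,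
        by exact_mod_cast b6.2⟩, ?_⟩
      rw [← hr, ← hk]; abel
    exact (Finset.card_le_card this).trans (Finset.card_image_le.trans (by simp))
  have c1 := main (S.filter fun h => F (row h 1) ≤ F (row h 0))
    (fun h hh => hS h (Finset.mem_filter.1 hh).1) (fun h hh => (Finset.mem_filter.1 hh).2)
  have hneg : ∀ r, F (-r) = F r := fun r => by
    have := hF.smul (-1) r
    simpa using this
  have r0 : ∀ h : SL(2, ℤ), row (ModularGroup.S * h) 0 = -row h 1 := by
    intro h
    simp [row, sl_mul_apply, ModularGroup.coe_S]
  have r1 : ∀ h : SL(2, ℤ), row (ModularGroup.S * h) 1 = row h 0 := by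
    intro h
    simp [row, sl_mul_apply, ModularGroup.coe_S]
  have c2 := main ((S.filter fun h => ¬ F (row h 1) ≤ F (row h 0)).image (ModularGroup.S * ·))
    (by
      intro h hh
      simp only [Finset.mem_image, Finset.mem_filter] at hh
      obtain ⟨a, ⟨ha, -⟩, rfl⟩ := hh
      intro i
      fin_cases i
      · simp only [Fin.zero_eta, r0, hneg]; exact hS a ha 1
      · simp only [Fin.mk_one, r1]; exact hS a ha 0)
    (by
      intro h hh
      simp only [Finset.mem_image, Finset.mem_filter] at hh
      obtain ⟨a, ⟨-, ha⟩, rfl⟩ := hh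
      rw [r0, r1, hneg]
      exact (not_le.1 ha).le)
  rw [Finset.card_image_of_injective _ (mul_right_injective _)] at c2
  have c3 := Finset.card_filter_add_card_filter_not (s := S) (fun h => F (row h 1) ≤ F (row h 0))
  have c4 : S.card ≤ 10 * E.card := by omega
  have c5 : (S.card : ℝ) ≤ 10 * E.card := by exact_mod_cast c4
  linarith

end LatticeNorm

/-- The sup norm of an integer vector. -/
noncomputable def vecNorm (x : ℤ × ℤ) : ℝ := max |(x.1 : ℝ)| |(x.2 : ℝ)|

/-- The columns of an integral matrix. -/
def colVec (g : SL(2, ℤ)) (j : Fin 2) : ℤ × ℤ := (g 0 j, g 1 j)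

/-- The linear action of `SL(2, ℤ)` on integer vectors. -/
def act (h : SL(2, ℤ)) (x : ℤ × ℤ) : ℤ × ℤ :=
  (h 0 0 * x.1 + h 0 1 * x.2, h 1 0 * x.1 + h 1 1 * x.2)

/-- The largest absolute value of an entry. -/
noncomputable def matNorm (g : SL(2, ℤ)) : ℝ := max (vecNorm (colVec g 0)) (vecNorm (colVec g 1))

theorem colVec_mul (h g : SL(2, ℤ)) (j : Fin 2) : colVec (h * g) j = act h (colVec g j) := by
  simp [colVec, act, sl_mul_apply]

theorem vecNorm_nonneg (x : ℤ × ℤ) : 0 ≤ vecNorm x := le_max_of_le_left (abs_nonneg _)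

theorem vecNorm_pos {x : ℤ × ℤ} (hx : x ≠ 0) : 0 < vecNorm x := by
  by_contra! h
  have h1 := max_le_iff.1 h
  have h2 := abs_nonpos_iff.1 h1.1
  have h3 := abs_nonpos_iff.1 h1.2
  exact hx (Prod.ext (by exact_mod_cast h2) (by exact_mod_cast h3))

theorem abs_entry_le (g : SL(2, ℤ)) (i j : Fin 2) : |(g i j : ℝ)| ≤ matNorm g := by
  fin_cases i <;> fin_cases j <;> simp [matNorm, vecNorm, colVec]

theorem matNorm_le_iff {g : SL(2, ℤ)} {X : ℝ} : matNorm g ≤ X ↔ ∀ i j, |(g i j : ℝ)| ≤ X := by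
  simp only [matNorm, vecNorm, colVec, max_le_iff, Fin.forall_fin_two]
  tauto

theorem colVec_ne_zero (g : SL(2, ℤ)) (j : Fin 2) : colVec g j ≠ 0 := by
  intro h
  have h1 : g 0 j = 0 := congrArg Prod.fst h
  have h2 : g 1 j = 0 := congrArg Prod.snd h
  have := g.det_coe
  rw [det_fin_two] at this
  fin_cases j <;> simp_all

theorem one_le_matNorm (g : SL(2, ℤ)) : 1 ≤ matNorm g := by
  have h := colVec_ne_zero g 0
  by_contra! hlt
  refine h (Prod.ext ?_ ?_)
  · have := (abs_entry_le g 0 0).trans_lt hlt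
    exact Int.abs_lt_one_iff.1 (by exact_mod_cast this)
  · have := (abs_entry_le g 1 0).trans_lt hlt
    exact Int.abs_lt_one_iff.1 (by exact_mod_cast this)

theorem matNorm_one : matNorm 1 = 1 := by
  simp [matNorm, vecNorm, colVec]

theorem matNorm_pos (g : SL(2, ℤ)) : 0 < matNorm g := zero_lt_one.trans_le (one_le_matNorm g)

theorem matNorm_mul_le (g h : SL(2, ℤ)) : matNorm (g * h) ≤ 2 * matNorm g * matNorm h := by
  rw [matNorm_le_iff]
  intro i j
  rw [sl_mul_apply]
  push_cast
  have := matNorm_pos g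
  calc _ ≤ |(g i 0 : ℝ) * h 0 j| + |(g i 1 : ℝ) * h 1 j| := abs_add_le _ _
    _ = |(g i 0 : ℝ)| * |(h 0 j : ℝ)| + |(g i 1 : ℝ)| * |(h 1 j : ℝ)| := by rw [abs_mul, abs_mul]
    _ ≤ matNorm g * matNorm h + matNorm g * matNorm h := by
        gcongr <;> exact abs_entry_le _ _ _
    _ = _ := by ring

theorem matNorm_inv (g : SL(2, ℤ)) : matNorm g⁻¹ = matNorm g := by
  have key : ∀ h : SL(2, ℤ), matNorm h⁻¹ ≤ matNorm h := by
    intro h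
    have e : ∀ i j, (h⁻¹) i j = (Matrix.adjugate (h : Matrix (Fin 2) (Fin 2) ℤ)) i j :=
      fun i j => congrFun (congrFun (Matrix.SpecialLinearGroup.coe_inv h) i) j
    rw [matNorm_le_iff]
    intro i j
    rw [e, Matrix.adjugate_fin_two]
    fin_cases i <;> fin_cases j <;> simp [abs_entry_le]
  refine le_antisymm (key g) ?_
  simpa using key g⁻¹

theorem finite_matNorm_le (X : ℝ) : {g : SL(2, ℤ) | matNorm g ≤ X}.Finite := by
  have h1 : (Set.pi Set.univ fun _ : Fin 2 => Set.pi Set.univ fun _ : Fin 2 =>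
      Set.Icc (-⌊X⌋) ⌊X⌋).Finite :=
    Set.Finite.pi fun _ => Set.Finite.pi fun _ => Set.finite_Icc _ _
  refine Set.Finite.of_finite_image (f := fun g : SL(2, ℤ) => (g : Matrix (Fin 2) (Fin 2) ℤ))
    (h1.subset ?_) (fun a _ b _ h => Subtype.ext h)
  rintro _ ⟨g, hg, rfl⟩ i - j -
  exact Finset.mem_Icc.1 (LatticeNorm.mem_Icc_floor ((abs_entry_le g i j).trans hg))

/-- The finite set of elements of norm at most `X`. -/
noncomputable def ball (X : ℝ) : Finset SL(2, ℤ) := (finite_matNorm_le X).toFinset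

@[simp] theorem mem_ball {X : ℝ} {g : SL(2, ℤ)} : g ∈ ball X ↔ matNorm g ≤ X := by
  simp [ball]

theorem inv_mem_ball {X : ℝ} {g : SL(2, ℤ)} : g⁻¹ ∈ ball X ↔ g ∈ ball X := by
  simp [matNorm_inv]

theorem vecNorm_mul_cross_le (x r r' : ℤ × ℤ) :
    vecNorm x * |(cross r r' : ℝ)| ≤ |((r.1 * x.1 + r.2 * x.2 : ℤ) : ℝ)| * vecNorm r' +
      |((r'.1 * x.1 + r'.2 * x.2 : ℤ) : ℝ)| * vecNorm r := by
  have key : ∀ a b c d e : ℝ, ∀ u v : ℝ, a = c * d - e * b → |d| ≤ u → |b| ≤ v →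
      |a| ≤ |c| * u + |e| * v := by
    rintro a b c d e u v rfl h1 h2
    calc |c * d - e * b| ≤ |c * d| + |e * b| := abs_sub _ _
      _ = |c| * |d| + |e| * |b| := by rw [abs_mul, abs_mul]
      _ ≤ _ := by gcongr
  rcases max_choice |(x.1 : ℝ)| |(x.2 : ℝ)| with h | h
  · rw [vecNorm, h, ← abs_mul]
    refine key _ (r.2 : ℝ) _ (r'.2 : ℝ) _ _ _ ?_ (le_max_right _ _) (le_max_right _ _)
    simp only [cross]; push_cast; ring
  · rw [vecNorm, h, ← abs_mul]
    refine key _ (-r.1 : ℝ) _ (-r'.1 : ℝ) _ _ _ ?_ ?_ ?_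
    · simp only [cross]; push_cast; ring
    · rw [abs_neg]; exact le_max_left _ _
    · rw [abs_neg]; exact le_max_left _ _

theorem latticeNorm_strip {x : ℤ × ℤ} (hx : x ≠ 0) {R s : ℝ} (hR : 0 < R) (hs : 0 < s) :
    LatticeNorm (fun r => max (vecNorm r / R) (|((r.1 * x.1 + r.2 * x.2 : ℤ) : ℝ)| / s))
      (2 * s * R / vecNorm x) where
  nonneg r := le_max_of_le_left (div_nonneg (vecNorm_nonneg r) hR.le)
  sub_le r r' := by
    refine max_le ?_ ?_
    · refine le_trans ?_ (add_le_add (le_max_left _ _) (le_max_left _ _))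
      rw [← add_div]
      gcongr
      refine max_le ?_ ?_
      · refine le_trans ?_ (add_le_add (le_max_left _ _) (le_max_left _ _))
        simpa using abs_sub (r.1 : ℝ) r'.1
      · refine le_trans ?_ (add_le_add (le_max_right _ _) (le_max_right _ _))
        simpa using abs_sub (r.2 : ℝ) r'.2
    · refine le_trans ?_ (add_le_add (le_max_right _ _) (le_max_right _ _))
      rw [← add_div]
      gcongr
      refine le_trans (le_of_eq ?_) (abs_sub _ _)
      congr 1
      simp only [Prod.fst_sub, Prod.snd_sub]
      push_cast; ring
  smul k r := by
    rw [mul_max_of_nonneg _ _ (abs_nonneg _)]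
    congr 1
    · rw [← mul_div_assoc]
      congr 1
      simp only [vecNorm, Prod.smul_fst, Prod.smul_snd, smul_eq_mul, Int.cast_mul, abs_mul]
      rw [mul_max_of_nonneg _ _ (abs_nonneg _)]
    · rw [← mul_div_assoc, ← abs_mul]
      congr 2
      simp only [Prod.smul_fst, Prod.smul_snd, smul_eq_mul]
      push_cast; ring
  cross_le r r' := by
    have ht := vecNorm_pos hx
    have key := vecNorm_mul_cross_le x r r'
    set F := fun r : ℤ × ℤ => max (vecNorm r / R) (|((r.1 * x.1 + r.2 * x.2 : ℤ) : ℝ)| / s) with hF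
    have b1 : ∀ r, vecNorm r ≤ R * F r := fun r => by
      rw [mul_comm R, ← div_le_iff₀ hR]; exact le_max_left _ _
    have b2 : ∀ r : ℤ × ℤ, |((r.1 * x.1 + r.2 * x.2 : ℤ) : ℝ)| ≤ s * F r := fun r => by
      rw [mul_comm s, ← div_le_iff₀ hs]; exact le_max_right _ _
    have F0 : ∀ r, 0 ≤ F r := fun r => le_max_of_le_left (div_nonneg (vecNorm_nonneg r) hR.le)
    have : vecNorm x * |(cross r r' : ℝ)| ≤ s * F r * (R * F r') + s * F r' * (R * F r) := by
      refine key.trans ?_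
      have := F0 r
      have := F0 r'
      gcongr
      · exact vecNorm_nonneg _
      · exact b2 r
      · exact b1 r'
      · exact vecNorm_nonneg _
      · exact b2 r'
      · exact b1 r
    change _ ≤ 2 * s * R / vecNorm x * F r * F r'
    rw [div_mul_eq_mul_div, div_mul_eq_mul_div, le_div_iff₀ ht]
    linarith
  finite := by
    refine ((Set.finite_Icc (-⌊R⌋) ⌊R⌋).prod (Set.finite_Icc (-⌊R⌋) ⌊R⌋)).subset ?_
    intro r hr
    have h1 : vecNorm r ≤ R := by
      have := (le_max_left _ _).trans (show _ ≤ (1 : ℝ) from hr)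
      rwa [div_le_one hR] at this
    exact ⟨Finset.mem_Icc.1 (LatticeNorm.mem_Icc_floor ((le_max_left _ _).trans h1)),
      Finset.mem_Icc.1 (LatticeNorm.mem_Icc_floor ((le_max_right _ _).trans h1))⟩

theorem vecNorm_row_le {h : SL(2, ℤ)} {X : ℝ} (hh : h ∈ ball X) (i : Fin 2) :
    vecNorm (LatticeNorm.row h i) ≤ X := by
  rw [mem_ball] at hh
  exact max_le ((abs_entry_le _ _ _).trans hh) ((abs_entry_le _ _ _).trans hh)

theorem card_ball_act_le {x : ℤ × ℤ} (hx : x ≠ 0) {R s : ℝ} (hR : 0 < R) (hs : 0 < s) :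
    (((ball R).filter fun h => vecNorm (act h x) ≤ s).card : ℝ) ≤ 300 * s * R / vecNorm x := by
  have ht := vecNorm_pos hx
  refine ((latticeNorm_strip hx hR hs).card_matrices_le _ ?_ (by positivity)).trans
    (le_of_eq (by ring))
  intro h hh i
  rw [Finset.mem_filter] at hh
  refine max_le ((div_le_one hR).2 (vecNorm_row_le hh.1 i)) ((div_le_one hs).2 ?_)
  have := max_le_iff.1 hh.2
  fin_cases i
  · exact this.1
  · exact this.2

theorem vecNorm_le_vecNorm_act {x : ℤ × ℤ} {R : ℝ} {h : SL(2, ℤ)} (hh : h ∈ ball R) :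
    vecNorm x ≤ 2 * R * vecNorm (act h x) := by
  have key := vecNorm_mul_cross_le x (LatticeNorm.row h 0) (LatticeNorm.row h 1)
  rw [LatticeNorm.cross_row] at key
  simp only [Int.cast_one, abs_one, mul_one] at key
  have h0 := vecNorm_row_le hh 0
  have h1 := vecNorm_row_le hh 1
  have hR : 0 ≤ R := (vecNorm_nonneg _).trans h0
  calc vecNorm x ≤ _ := key
    _ ≤ vecNorm (act h x) * R + vecNorm (act h x) * R := by
        refine add_le_add (mul_le_mul (le_max_left _ _) h1 (vecNorm_nonneg _) (vecNorm_nonneg _))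
          (mul_le_mul (le_max_right _ _) h0 (vecNorm_nonneg _) (vecNorm_nonneg _))
    _ = _ := by ring

theorem vecNorm_act_le {x : ℤ × ℤ} {R : ℝ} {h : SL(2, ℤ)} (hh : h ∈ ball R) :
    vecNorm (act h x) ≤ 2 * R * vecNorm x := by
  rw [mem_ball] at hh
  have key : ∀ i, |((h i 0 * x.1 + h i 1 * x.2 : ℤ) : ℝ)| ≤ 2 * R * vecNorm x := by
    intro i
    push_cast
    have a0 := (abs_entry_le h i 0).trans hh
    have a1 := (abs_entry_le h i 1).trans hh
    have hR : 0 ≤ R := (abs_nonneg _).trans a0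
    calc _ ≤ |(h i 0 : ℝ) * x.1| + |(h i 1 : ℝ) * x.2| := abs_add_le _ _
      _ = |(h i 0 : ℝ)| * |(x.1 : ℝ)| + |(h i 1 : ℝ)| * |(x.2 : ℝ)| := by rw [abs_mul, abs_mul]
      _ ≤ R * vecNorm x + R * vecNorm x := by
        gcongr
        · exact le_max_left _ _
        · exact le_max_right _ _
      _ = _ := by ring
  exact max_le (key 0) (key 1)

theorem one_div_le_sum_dyadic {s₀ y : ℝ} (hs : 0 < s₀) (hy : s₀ ≤ y) (K : ℕ) (hK : y ≤ 2 ^ K * s₀) :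
    1 / y ≤ 2 * ∑ k ∈ Finset.range (K + 1), if y ≤ 2 ^ k * s₀ then 1 / (2 ^ k * s₀) else 0 := by
  classical
  have hex : ∃ k, y ≤ 2 ^ k * s₀ := ⟨K, hK⟩
  set k := Nat.find hex with hk
  have hk1 := Nat.find_spec hex
  rw [← hk] at hk1
  have hkK : k ≤ K := Nat.find_min' hex hK
  have hk2 : 2 ^ k * s₀ ≤ 2 * y := by
    rcases Nat.eq_zero_or_pos k with h | h
    · rw [h]; linarith
    · have := Nat.find_min hex (m := k - 1) (by omega)
      have e : (2 : ℝ) ^ k = 2 * 2 ^ (k - 1) := by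
        rw [← pow_succ']; congr 1; omega
      rw [e]
      push Not at this
      linarith
  have h1 : 1 / (2 ^ k * s₀) ≤
      ∑ k ∈ Finset.range (K + 1), if y ≤ 2 ^ k * s₀ then 1 / (2 ^ k * s₀) else 0 := by
    have := Finset.single_le_sum
      (f := fun k => if y ≤ 2 ^ k * s₀ then 1 / (2 ^ k * s₀) else (0 : ℝ))
      (fun i _ => by split_ifs <;> positivity) (Finset.mem_range.2 (by omega : k < K + 1))
    simpa [hk1] using this
  have hy0 : 0 < y := hs.trans_le hy
  calc 1 / y = 2 * (1 / (2 * y)) := by field_simp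
    _ ≤ 2 * (1 / (2 ^ k * s₀)) := by gcongr
    _ ≤ _ := by gcongr

theorem sum_ball_one_div_vecNorm_le {x : ℤ × ℤ} (hx : x ≠ 0) (r : ℕ) :
    ∑ h ∈ ball (2 ^ r), 1 / vecNorm (act h x) ≤ 600 * (2 * r + 3) * 2 ^ r / vecNorm x := by
  have ht := vecNorm_pos hx
  have hR : (0 : ℝ) < 2 ^ r := by positivity
  set s₀ := vecNorm x / (2 * 2 ^ r) with hs₀
  have hs : 0 < s₀ := by positivity
  calc ∑ h ∈ ball (2 ^ r), 1 / vecNorm (act h x)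
      ≤ ∑ h ∈ ball (2 ^ r), 2 * ∑ k ∈ Finset.range (2 * r + 2 + 1),
        if vecNorm (act h x) ≤ 2 ^ k * s₀ then 1 / (2 ^ k * s₀) else 0 := by
        refine Finset.sum_le_sum fun h hh => one_div_le_sum_dyadic hs ?_ _ ?_
        · rw [hs₀, div_le_iff₀ (by positivity), mul_comm]
          exact vecNorm_le_vecNorm_act hh
        · refine (vecNorm_act_le hh).trans (le_of_eq ?_)
          rw [hs₀]
          field_simp
          ring
    _ = 2 * ∑ k ∈ Finset.range (2 * r + 2 + 1),
        ((ball (2 ^ r)).filter fun h => vecNorm (act h x) ≤ 2 ^ k * s₀).card *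
          (1 / (2 ^ k * s₀)) := by
        rw [← Finset.mul_sum, Finset.sum_comm]
        congr 1
        refine Finset.sum_congr rfl fun k _ => ?_
        rw [← Finset.sum_filter]; simp
    _ ≤ 2 * ∑ k ∈ Finset.range (2 * r + 2 + 1),
        (300 * (2 ^ k * s₀) * 2 ^ r / vecNorm x) * (1 / (2 ^ k * s₀)) := by
        gcongr with k hk
        exact card_ball_act_le hx hR (by positivity)
    _ = 2 * ∑ k ∈ Finset.range (2 * r + 2 + 1), (300 * 2 ^ r / vecNorm x) := by
        congr 1
        refine Finset.sum_congr rfl fun k _ => ?_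
        field_simp
    _ = _ := by
        rw [Finset.sum_const, Finset.card_range, nsmul_eq_mul]
        push_cast; ring

/-- The function `1 / matNorm` is almost an eigenfunction of the sum over a ball. -/
theorem sum_ball_one_div_matNorm_le (g : SL(2, ℤ)) (r : ℕ) :
    ∑ h ∈ ball (2 ^ r), 1 / matNorm (h⁻¹ * g) ≤ 600 * (2 * r + 3) * 2 ^ r / matNorm g := by
  have h0 : ∑ h ∈ ball (2 ^ r), 1 / matNorm (h⁻¹ * g) = ∑ h ∈ ball (2 ^ r), 1 / matNorm (h * g) :=
    Finset.sum_nbij' (·⁻¹) (·⁻¹) (fun h hh => inv_mem_ball.2 hh) (fun h hh => inv_mem_ball.2 hh)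
      (by simp) (by simp) (by simp)
  rw [h0]
  obtain ⟨j, hj, hj2⟩ : ∃ j, matNorm g = vecNorm (colVec g j) ∧
      ∀ h : SL(2, ℤ), vecNorm (colVec h j) ≤ matNorm h := by
    rcases max_choice (vecNorm (colVec g 0)) (vecNorm (colVec g 1)) with h | h
    · exact ⟨0, h, fun h => le_max_left _ _⟩
    · exact ⟨1, h, fun h => le_max_right _ _⟩
  rw [hj]
  refine le_trans (Finset.sum_le_sum fun h _ => ?_)
    (sum_ball_one_div_vecNorm_le (colVec_ne_zero g j) r)
  rw [← colVec_mul]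
  exact one_div_le_one_div_of_le (vecNorm_pos (colVec_ne_zero _ _)) (hj2 _)

theorem sum_one_div_sq_le {n : ℕ} (hn : 2 ≤ n) :
    ∑ d ∈ Finset.Icc 2 n, (1 : ℝ) / d ^ 2 ≤ 3 / 4 - 1 / n := by
  induction n, hn using Nat.le_induction with
  | base => norm_num
  | succ n hn ih =>
    rw [Finset.sum_Icc_succ_top (by omega)]
    have h0 : (0 : ℝ) < n := by positivity
    have : (1 : ℝ) / (n + 1 : ℕ) ^ 2 ≤ 1 / n - 1 / (n + 1 : ℕ) := by
      push_cast
      rw [div_sub_div _ _ (by positivity) (by positivity), div_le_div_iff₀ (by positivity)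
        (by positivity)]
      nlinarith
    linarith

theorem card_filter_coprime_ge (n : ℕ) :
    (n : ℝ) ^ 2 / 4 ≤ (((Finset.Icc 1 n) ×ˢ (Finset.Icc 1 n)).filter
      fun p : ℕ × ℕ => p.1.Coprime p.2).card := by
  classical
  set S := (Finset.Icc 1 n) ×ˢ (Finset.Icc 1 n) with hS
  have hcard : S.card = n ^ 2 := by simp [hS, sq]
  have h1 := Finset.card_filter_add_card_filter_not (s := S) (fun p : ℕ × ℕ => p.1.Coprime p.2)
  have h2 : S.filter (fun p => ¬ p.1.Coprime p.2) ⊆ (Finset.Icc 2 n).biUnion fun d =>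
      ((Finset.Icc 1 n).filter (d ∣ ·)) ×ˢ ((Finset.Icc 1 n).filter (d ∣ ·)) := by
    rintro ⟨a, b⟩ h
    simp only [hS, Finset.mem_filter, Finset.mem_product, Finset.mem_Icc] at h
    simp only [Finset.mem_biUnion, Finset.mem_filter, Finset.mem_product, Finset.mem_Icc]
    have hg : 0 < a.gcd b := Nat.gcd_pos_of_pos_left _ (by omega)
    have hne : a.gcd b ≠ 1 := h.2
    have hle := Nat.le_of_dvd (by omega) (Nat.gcd_dvd_left a b)
    exact ⟨a.gcd b, by omega, ⟨h.1.1, Nat.gcd_dvd_left _ _⟩, h.1.2, Nat.gcd_dvd_right _ _⟩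
  have h3 : ((S.filter (fun p => ¬ p.1.Coprime p.2)).card : ℝ) ≤
      ∑ d ∈ Finset.Icc 2 n, (n : ℝ) ^ 2 * (1 / d ^ 2) := by
    calc ((S.filter (fun p => ¬ p.1.Coprime p.2)).card : ℝ) ≤ _ :=
          Nat.cast_le.2 ((Finset.card_le_card h2).trans Finset.card_biUnion_le)
      _ ≤ _ := by
        push_cast
        refine Finset.sum_le_sum fun d hd => ?_
        rw [Finset.card_product]
        have : ((Finset.Icc 1 n).filter (d ∣ ·)).card = n / d := by
          rw [← Nat.Ioc_filter_dvd_card_eq_div]; rfl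
        rw [this]
        have := Nat.cast_div_le (α := ℝ) (m := n) (n := d)
        push_cast
        calc _ ≤ ((n : ℝ) / d) * (n / d) := by gcongr
          _ = _ := by ring
  rw [← Finset.mul_sum] at h3
  have h4 : ((S.filter (fun p => p.1.Coprime p.2)).card : ℝ) +
      (S.filter (fun p => ¬ p.1.Coprime p.2)).card = n ^ 2 := by
    rw [← Nat.cast_add, h1, hcard]; push_cast; ring
  have h5 : ∑ d ∈ Finset.Icc 2 n, (1 : ℝ) / d ^ 2 ≤ 3 / 4 := by
    rcases le_or_gt 2 n with h | h
    · have := sum_one_div_sq_le h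
      have : (0 : ℝ) ≤ 1 / n := by positivity
      linarith
    · rw [Finset.Icc_eq_empty (by omega)]; norm_num
  have := mul_le_mul_of_nonneg_left h5 (sq_nonneg (n : ℝ))
  linarith

/-- The matrix with given entries. -/
def slMk {R : Type*} [CommRing R] (a b c d : R) (h : a * d - b * c = 1) : SL(2, R) :=
  ⟨!![a, b; c, d], by rw [det_fin_two_of]; exact h⟩

theorem exists_mem_ball_colVec {n a c : ℕ} (ha : 1 ≤ a) (hc : 1 ≤ c) (han : a ≤ n) (hcn : c ≤ n)
    (h : a.Coprime c) : ∃ g ∈ ball n, colVec g 0 = ((a : ℤ), (c : ℤ)) := by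
  obtain ⟨x, y, hxy⟩ := Nat.isCoprime_iff_coprime.2 h
  have hc0 : (0 : ℤ) < c := by exact_mod_cast hc
  set d := x % (c : ℤ) with hd
  have hd0 : 0 ≤ d := Int.emod_nonneg _ hc0.ne'
  have hd1 : d < c := Int.emod_lt_of_pos _ hc0
  set b := -(y + (x / c) * a) with hb
  have hdet : a * d - b * c = 1 := by
    have := Int.emod_add_mul_ediv x c
    rw [← hd] at this
    rw [hb]
    linear_combination hxy + (a : ℤ) * this
  have hb1 : -1 ≤ b := by nlinarith
  have hb2 : b ≤ a := by nlinarith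
  refine ⟨slMk _ _ _ _ hdet, ?_, rfl⟩
  have key : ∀ t : ℤ, -n ≤ t → t ≤ n → |(t : ℝ)| ≤ n := fun t h1 h2 =>
    abs_le.2 ⟨by exact_mod_cast h1, by exact_mod_cast h2⟩
  rw [mem_ball, matNorm_le_iff, Fin.forall_fin_two, Fin.forall_fin_two, Fin.forall_fin_two]
  refine ⟨⟨key a ?_ ?_, key b ?_ ?_⟩, key c ?_ ?_, key d ?_ ?_⟩ <;> omega

/-- The number of elements of norm at most `n` is at least quadratic in `n`. -/
theorem sq_div_four_le_card_ball (n : ℕ) : (n : ℝ) ^ 2 / 4 ≤ (ball n).card := by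
  classical
  refine (card_filter_coprime_ge n).trans (Nat.cast_le.2 ?_)
  refine Finset.card_le_card_of_surjOn
    (fun g => ((g 0 0).toNat, (g 1 0).toNat)) ?_
  rintro ⟨a, c⟩ h
  simp only [Finset.coe_filter, Finset.mem_product, Finset.mem_Icc, Set.mem_ofPred_eq] at h
  obtain ⟨g, hg, hgc⟩ := exists_mem_ball_colVec h.1.1.1 h.1.2.1 h.1.1.2 h.1.2.2 h.2
  refine ⟨g, hg, ?_⟩
  have h1 : g 0 0 = a := congrArg Prod.fst hgc
  have h2 : g 1 0 = c := congrArg Prod.snd hgc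
  simp [h1, h2]

section WalkSum

variable {G : Type*} [Group G] (B : Finset G)

/-- The sum of `F` over all products of `m` elements of `B`. -/
def walkSum : ℕ → (G → ℝ) → ℝ
  | 0, F => F 1
  | m + 1, F => ∑ h ∈ B, walkSum m fun γ => F (h * γ)

theorem walkSum_mono (m : ℕ) {F F' : G → ℝ} (h : ∀ γ, F γ ≤ F' γ) :
    walkSum B m F ≤ walkSum B m F' := by
  induction m generalizing F F' with
  | zero => exact h 1
  | succ m ih => exact Finset.sum_le_sum fun g _ => ih fun γ => h _

theorem walkSum_sum {ι : Type*} (s : Finset ι) (m : ℕ) (F : ι → G → ℝ) :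
    walkSum B m (fun γ => ∑ i ∈ s, F i γ) = ∑ i ∈ s, walkSum B m (F i) := by
  induction m generalizing F with
  | zero => rfl
  | succ m ih =>
    simp only [walkSum]
    rw [Finset.sum_comm]
    exact Finset.sum_congr rfl fun g _ => ih _

theorem walkSum_mul (m : ℕ) (F : G → ℝ) (c : ℝ) :
    walkSum B m (fun γ => F γ * c) = walkSum B m F * c := by
  induction m generalizing F with
  | zero => rfl
  | succ m ih =>
    simp only [walkSum, Finset.sum_mul]
    exact Finset.sum_congr rfl fun g _ => ih _

theorem walkSum_add_index (m n : ℕ) (F : G → ℝ) :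
    walkSum B (m + n) F = walkSum B m fun γ => walkSum B n fun γ' => F (γ * γ') := by
  induction m generalizing F with
  | zero => simp [walkSum]
  | succ m ih =>
    rw [Nat.add_right_comm]
    simp only [walkSum, ih, mul_assoc]

variable {B} in
theorem walkSum_inv (hB : ∀ g, g⁻¹ ∈ B ↔ g ∈ B) (m : ℕ) (F : G → ℝ) :
    walkSum B m (fun γ => F γ⁻¹) = walkSum B m F := by
  induction m generalizing F with
  | zero => simp [walkSum]
  | succ m ih =>
    have h1 : walkSum B (m + 1) F = ∑ h ∈ B, walkSum B m fun γ => F (γ * h) := by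
      rw [walkSum_add_index, ← walkSum_sum]
      simp [walkSum]
    rw [h1]
    simp only [walkSum, _root_.mul_inv_rev]
    refine Finset.sum_nbij' (·⁻¹) (·⁻¹) (fun h hh => (hB h).2 hh) (fun h hh => (hB h).2 hh)
      (by simp) (by simp) fun h _ => ?_
    exact ih fun γ => F (γ * h⁻¹)

variable {B} in
/-- Cauchy–Schwarz for functions that factor through a finite quotient. -/
theorem sq_walkSum_comp_le {Q : Type*} [Group Q] [Fintype Q] [DecidableEq Q] (ι : G →* Q)
    (hB : ∀ g, g⁻¹ ∈ B ↔ g ∈ B) (m : ℕ) (φ : Q → ℝ) :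
    (walkSum B m fun γ => φ (ι γ)) ^ 2 ≤
      (∑ g, φ g ^ 2) * walkSum B (m + m) fun γ => if ι γ = 1 then 1 else 0 := by
  set w : Q → ℝ := fun g => walkSum B m fun γ => if ι γ = g then 1 else 0 with hw
  have h1 : (walkSum B m fun γ => φ (ι γ)) = ∑ g, φ g * w g := by
    simp only [hw, mul_comm (φ _), ← walkSum_mul, ← walkSum_sum]
    congr 1
    ext γ
    simp
  have h2 : ∑ g, w g ^ 2 = walkSum B (m + m) fun γ => if ι γ = 1 then 1 else 0 := by
    have h3 : ∀ g, w g ^ 2 = walkSum B m fun γ => w g * if ι γ = g then 1 else 0 := by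
      intro g
      simp only [mul_comm (w g)]
      rw [walkSum_mul, sq]
    rw [walkSum_add_index]
    simp only [h3, ← walkSum_sum]
    congr 1
    ext γ
    simp only [mul_ite, mul_one, mul_zero, Finset.sum_ite_eq, Finset.mem_univ, if_true, hw]
    rw [← walkSum_inv hB]
    congr 1
    ext γ'
    congr 1
    rw [map_mul, map_inv, inv_eq_iff_eq_inv, mul_eq_one_iff_eq_inv, eq_comm (a := ι γ),
      inv_eq_iff_eq_inv.symm]
  rw [h1, ← h2]
  exact Finset.sum_mul_sq_le_sq_mul_sq _ _ _

end WalkSum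

/-- A walk of length `m` visits an element `γ` at most `ρ ^ m / matNorm γ` times. -/
theorem walkSum_ball_le (r m : ℕ) {F : SL(2, ℤ) → ℝ} (hF : ∀ γ, 0 ≤ F γ) :
    walkSum (ball (2 ^ r)) m F ≤ (600 * (2 * r + 3) * 2 ^ r) ^ m *
      ∑ γ ∈ ball ((2 ^ (r + 1)) ^ m), F γ * (1 / matNorm γ) := by
  classical
  have hnn : ∀ γ γ', 0 ≤ F γ * (1 / matNorm γ') := fun γ γ' =>
    mul_nonneg (hF γ) (one_div_nonneg.2 (matNorm_pos γ').le)
  induction m generalizing F with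
  | zero =>
    have h1 : (1 : SL(2, ℤ)) ∈ ball ((2 ^ (r + 1)) ^ 0) := by simp [matNorm_one]
    have := Finset.single_le_sum (f := fun γ => F γ * (1 / matNorm γ)) (fun γ _ => hnn γ γ) h1
    simpa [walkSum, matNorm_one] using this
  | succ m ih =>
    set ρ : ℝ := 600 * (2 * r + 3) * 2 ^ r with hρ
    have hρ0 : 0 ≤ ρ := by positivity
    calc walkSum (ball (2 ^ r)) (m + 1) F
        ≤ ∑ h ∈ ball (2 ^ r), ρ ^ m *
          ∑ γ ∈ ball ((2 ^ (r + 1)) ^ m), F (h * γ) * (1 / matNorm γ) :=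
          Finset.sum_le_sum fun h _ => ih (fun γ => hF _) (fun γ γ' => hnn _ _)
      _ ≤ ∑ h ∈ ball (2 ^ r), ρ ^ m *
          ∑ γ ∈ ball ((2 ^ (r + 1)) ^ (m + 1)), F γ * (1 / matNorm (h⁻¹ * γ)) := by
          refine Finset.sum_le_sum fun h hh => mul_le_mul_of_nonneg_left ?_ (by positivity)
          have himg : ∑ γ ∈ ball ((2 ^ (r + 1)) ^ m), F (h * γ) * (1 / matNorm γ) =
              ∑ γ ∈ (ball ((2 ^ (r + 1)) ^ m)).image (h * ·), F γ * (1 / matNorm (h⁻¹ * γ)) := by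
            rw [Finset.sum_image (by simp)]
            simp
          rw [himg]
          refine Finset.sum_le_sum_of_subset_of_nonneg ?_ (fun γ _ _ => hnn _ _)
          intro γ hγ
          obtain ⟨γ', hγ', rfl⟩ := Finset.mem_image.1 hγ
          rw [mem_ball] at *
          calc matNorm (h * γ') ≤ 2 * matNorm h * matNorm γ' := matNorm_mul_le _ _
            _ ≤ 2 * 2 ^ r * (2 ^ (r + 1)) ^ m := by
              gcongr
              exact (matNorm_pos _).le
            _ = _ := by ring
      _ = ρ ^ m * ∑ γ ∈ ball ((2 ^ (r + 1)) ^ (m + 1)),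
          F γ * ∑ h ∈ ball (2 ^ r), 1 / matNorm (h⁻¹ * γ) := by
          rw [← Finset.mul_sum, Finset.sum_comm]
          simp only [Finset.mul_sum]
      _ ≤ ρ ^ m * ∑ γ ∈ ball ((2 ^ (r + 1)) ^ (m + 1)), F γ * (ρ / matNorm γ) := by
          refine mul_le_mul_of_nonneg_left (Finset.sum_le_sum fun γ _ => ?_) (by positivity)
          exact mul_le_mul_of_nonneg_left (sum_ball_one_div_matNorm_le γ r) (hF γ)
      _ = _ := by
          rw [pow_succ ρ, mul_assoc, Finset.mul_sum (a := ρ)]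
          congr 1
          refine Finset.sum_congr rfl fun γ _ => ?_
          ring

theorem Finset.sum_le_sum_of_injOn {α β : Type*} {s : Finset α} {t : Finset β} {F : α → ℝ}
    {G : β → ℝ} (f : α → β) (hf : Set.InjOn f s) (hst : ∀ a ∈ s, f a ∈ t)
    (hFG : ∀ a ∈ s, F a ≤ G (f a)) (hG : ∀ b ∈ t, 0 ≤ G b) : ∑ a ∈ s, F a ≤ ∑ b ∈ t, G b := by
  classical
  calc ∑ a ∈ s, F a ≤ ∑ a ∈ s, G (f a) := Finset.sum_le_sum hFG
    _ = ∑ b ∈ s.image f, G b := (Finset.sum_image hf).symm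
    _ ≤ _ := Finset.sum_le_sum_of_subset_of_nonneg
        (fun b hb => by obtain ⟨a, ha, rfl⟩ := Finset.mem_image.1 hb; exact hst a ha)
        fun b hb _ => hG b hb

theorem sum_Icc_one_div_abs_le {X : ℕ} :
    ∑ a ∈ Finset.Icc (-(X : ℤ)) X, 1 / |(a : ℝ)| ≤ 2 * (1 + Real.log X) := by
  have h1 : ∑ a ∈ Finset.Icc (-(X : ℤ)) X, 1 / |(a : ℝ)| = 2 * (harmonic X : ℝ) := by
    induction X with
    | zero => simp
    | succ X ih =>
      have e : Finset.Icc (-((X + 1 : ℕ) : ℤ)) ((X + 1 : ℕ) : ℤ) =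
          insert (-((X + 1 : ℕ) : ℤ)) (insert ((X + 1 : ℕ) : ℤ) (Finset.Icc (-(X : ℤ)) X)) := by
        ext a
        simp only [Finset.mem_Icc, Finset.mem_insert]
        omega
      rw [e, Finset.sum_insert (by simp; omega), Finset.sum_insert (by simp), ih, harmonic_succ]
      push_cast
      rw [abs_neg, abs_of_pos (by positivity)]
      ring
  rw [h1]
  exact mul_le_mul_of_nonneg_left (harmonic_le_one_add_log X) zero_le_two

theorem card_filter_dvd_sub_le {r : ℕ} (hr : 0 < r) (n : ℕ) (v : ℤ) :
    ((((Finset.Icc (-(n : ℤ)) n).filter fun x => (r : ℤ) ∣ x - v).card : ℕ) : ℝ) ≤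
      (2 * n + 1) / r + 1 := by
  have h1 : (Finset.Icc (-(n : ℤ)) n).filter (fun x => (r : ℤ) ∣ x - v) =
      (Finset.Ioc (-(n : ℤ) - 1) n).filter (fun x => x ≡ v [ZMOD r]) := by
    ext x
    simp only [Finset.mem_filter, Finset.mem_Icc, Finset.mem_Ioc, Int.modEq_iff_dvd]
    rw [dvd_sub_comm]
    refine and_congr_left fun _ => ?_
    omega
  have h2 := Int.Ioc_filter_modEq_card (-(n : ℤ) - 1) n (r := r) (by exact_mod_cast hr) v
  rw [← h1] at h2
  have hr' : (0 : ℚ) < r := by exact_mod_cast hr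
  have h3 : ((((Finset.Icc (-(n : ℤ)) n).filter fun x => (r : ℤ) ∣ x - v).card : ℤ) : ℚ) ≤
      (2 * n + 1) / r + 1 := by
    rw [h2]
    push_cast
    refine max_le ?_ (by positivity)
    have a1 := Int.floor_le (((n : ℚ) - v) / r)
    have a2 := Int.lt_floor_add_one ((-(n : ℚ) - 1 - v) / r)
    have a3 : (2 * (n : ℚ) + 1) / r = (n - v) / r - (-n - 1 - v) / r := by
      rw [← sub_div]; congr 1; ring
    push_cast at *
    linarith
  have h4 := (Rat.cast_le (K := ℝ)).2 h3
  push_cast at h4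
  exact h4

theorem sum_one_div_le_of_congr {M X : ℕ} (hM : 1 < M) (hX : M ≤ X) :
    ∑ a ∈ (Finset.Icc (-(X : ℤ)) X).filter (fun a => (M : ℤ) ∣ a - 1),
      ∑ _d ∈ (Finset.Icc (-(X : ℤ)) X).filter
        (fun d => |d| ≤ |a| ∧ ((M ^ 2 : ℕ) : ℤ) ∣ a + d - 2), 1 / |(a : ℝ)| ≤
      12 * X / M ^ 3 + 2 * (1 + Real.log X) := by
  have hM0 : (0 : ℝ) < M := by positivity
  have hX0 : (M : ℝ) ≤ X := by exact_mod_cast hX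
  have hM1 : (1 : ℝ) ≤ M := by exact_mod_cast hM.le
  have key : ∀ a ∈ (Finset.Icc (-(X : ℤ)) X).filter (fun a => (M : ℤ) ∣ a - 1),
      ∑ _d ∈ (Finset.Icc (-(X : ℤ)) X).filter
        (fun d => |d| ≤ |a| ∧ ((M ^ 2 : ℕ) : ℤ) ∣ a + d - 2), 1 / |(a : ℝ)| ≤
        3 / M ^ 2 + 1 / |(a : ℝ)| := by
    intro a ha
    rw [Finset.mem_filter] at ha
    have ha0 : a ≠ 0 := by
      rintro rfl
      have := Int.natAbs_dvd_natAbs.2 ha.2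
      simp at this
      omega
    have ha1 : (1 : ℝ) ≤ |(a : ℝ)| := by exact_mod_cast Int.one_le_abs ha0
    rw [Finset.sum_const, nsmul_eq_mul]
    have hsub : (Finset.Icc (-(X : ℤ)) X).filter
        (fun d => |d| ≤ |a| ∧ ((M ^ 2 : ℕ) : ℤ) ∣ a + d - 2) ⊆
        (Finset.Icc (-(a.natAbs : ℤ)) a.natAbs).filter
          (fun d => ((M ^ 2 : ℕ) : ℤ) ∣ d - (2 - a)) := by
      intro d hd
      rw [Finset.mem_filter] at hd ⊢
      refine ⟨?_, by convert hd.2.2 using 1; ring⟩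
      rw [Finset.mem_Icc, ← abs_le, Int.natCast_natAbs]
      exact hd.2.1
    have hcard := (Nat.cast_le (α := ℝ).2 (Finset.card_le_card hsub)).trans
      (card_filter_dvd_sub_le (by positivity) _ _)
    have hna : ((a.natAbs : ℕ) : ℝ) = |(a : ℝ)| := by
      rw [Nat.cast_natAbs]; push_cast; rfl
    rw [hna, Nat.cast_pow (α := ℝ)] at hcard
    calc _ ≤ ((2 * |(a : ℝ)| + 1) / M ^ 2 + 1) * (1 / |(a : ℝ)|) := by gcongr
      _ ≤ ((3 * |(a : ℝ)|) / M ^ 2 + 1) * (1 / |(a : ℝ)|) := by gcongr; linarith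
      _ = _ := by field_simp
  refine (Finset.sum_le_sum key).trans ?_
  rw [Finset.sum_add_distrib, Finset.sum_const, nsmul_eq_mul]
  refine add_le_add ?_ ((Finset.sum_le_sum_of_subset_of_nonneg (Finset.filter_subset _ _)
    fun _ _ _ => by positivity).trans sum_Icc_one_div_abs_le)
  calc _ ≤ ((2 * (X : ℝ) + 1) / M + 1) * (3 / M ^ 2) := by
        gcongr
        exact card_filter_dvd_sub_le (by omega) X 1
    _ ≤ ((2 * (X : ℝ) + X) / M + X / M) * (3 / M ^ 2) := by
        gcongr
        · linarith
        · rwa [le_div_iff₀ hM0, one_mul]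
    _ = _ := by field_simp; ring

/-- The elements of the principal congruence subgroup of level `M` in a ball. -/
noncomputable def congrBall (M X : ℕ) : Finset SL(2, ℤ) := by
  classical
  exact (ball X).filter fun γ => (M : ℤ) ∣ γ 0 0 - 1 ∧ (M : ℤ) ∣ γ 0 1 ∧ (M : ℤ) ∣ γ 1 0 ∧
    (M : ℤ) ∣ γ 1 1 - 1

theorem mem_congrBall {M X : ℕ} {γ : SL(2, ℤ)} : γ ∈ congrBall M X ↔ matNorm γ ≤ X ∧
    (M : ℤ) ∣ γ 0 0 - 1 ∧ (M : ℤ) ∣ γ 0 1 ∧ (M : ℤ) ∣ γ 1 0 ∧ (M : ℤ) ∣ γ 1 1 - 1 := by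
  simp [congrBall]

theorem sl_det (γ : SL(2, ℤ)) : γ 0 0 * γ 1 1 - γ 0 1 * γ 1 0 = 1 := by
  have := γ.det_coe
  rwa [det_fin_two] at this

theorem sl_ext {R : Type*} [CommRing R] {γ γ' : SL(2, R)} (h00 : γ 0 0 = γ' 0 0)
    (h01 : γ 0 1 = γ' 0 1) (h10 : γ 1 0 = γ' 1 0) (h11 : γ 1 1 = γ' 1 1) : γ = γ' := by
  ext i j
  fin_cases i <;> fin_cases j <;> assumption

theorem entry_mem_Icc {γ : SL(2, ℤ)} {X : ℕ} (h : matNorm γ ≤ X) (i j : Fin 2) :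
    γ i j ∈ Finset.Icc (-(X : ℤ)) X := by
  have := (abs_entry_le γ i j).trans h
  rw [Finset.mem_Icc, ← abs_le]
  exact_mod_cast this

theorem dvd_trace_sub_two {M : ℕ} {γ : SL(2, ℤ)} (h00 : (M : ℤ) ∣ γ 0 0 - 1)
    (h01 : (M : ℤ) ∣ γ 0 1) (h10 : (M : ℤ) ∣ γ 1 0) (h11 : (M : ℤ) ∣ γ 1 1 - 1) :
    ((M ^ 2 : ℕ) : ℤ) ∣ γ 0 0 + γ 1 1 - 2 := by
  obtain ⟨x, hx⟩ := h00
  obtain ⟨y, hy⟩ := h11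
  obtain ⟨z, hz⟩ := h01
  obtain ⟨w, hw⟩ := h10
  have hd := sl_det γ
  refine ⟨z * w - x * y, ?_⟩
  rw [eq_add_of_sub_eq hx, eq_add_of_sub_eq hy, hz, hw] at hd
  rw [eq_add_of_sub_eq hx, eq_add_of_sub_eq hy]
  push_cast
  linear_combination hd

theorem card_filter_diag_le {S : Finset SL(2, ℤ)} {a d : ℤ} (h : a * d ≠ 1)
    (hS : ∀ γ ∈ S, γ 0 0 = a ∧ γ 1 1 = d) : S.card ≤ 2 * (a * d - 1).natAbs.divisors.card := by
  classical
  have h2 : 2 * (a * d - 1).natAbs.divisors.card =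
      ((a * d - 1).natAbs.divisors ×ˢ (Finset.univ : Finset Bool)).card := by
    rw [Finset.card_product]; simp [mul_comm]
  rw [h2]
  have hbc : ∀ γ ∈ S, γ 0 1 * γ 1 0 = a * d - 1 := fun γ hγ => by
    have := sl_det γ
    rw [(hS γ hγ).1, (hS γ hγ).2] at this
    linarith
  have hne : a * d - 1 ≠ 0 := sub_ne_zero.2 h
  refine Finset.card_le_card_of_injOn (fun γ => ((γ 0 1).natAbs, decide (0 < γ 0 1))) ?_ ?_
  · intro γ hγ
    simp only [Finset.coe_product, Set.mem_prod, Finset.mem_coe, Nat.mem_divisors,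
      Finset.mem_univ, and_true]
    refine ⟨Int.natAbs_dvd_natAbs.2 ⟨_, (hbc γ hγ).symm⟩, Int.natAbs_ne_zero.2 hne⟩
  · intro γ hγ γ' hγ' he
    have e1 : (γ 0 1).natAbs = (γ' 0 1).natAbs := congrArg Prod.fst he
    have e2 : decide (0 < γ 0 1) = decide (0 < γ' 0 1) := congrArg Prod.snd he
    have h01 : γ 0 1 = γ' 0 1 := by
      rw [decide_eq_decide] at e2
      omega
    have hb0 : γ 0 1 ≠ 0 := fun h0 => hne (by rw [← hbc γ hγ, h0, zero_mul])
    refine sl_ext ((hS γ hγ).1.trans (hS γ' hγ').1.symm) h01 ?_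
      ((hS γ hγ).2.trans (hS γ' hγ').2.symm)
    refine mul_left_cancel₀ hb0 ?_
    rw [hbc γ hγ, h01, hbc γ' hγ']

theorem sum_congrBall_unipotent_le {M X : ℕ} (hM : 2 < M) :
    ∑ γ ∈ (congrBall M X).filter (fun γ => γ 0 0 * γ 1 1 = 1), 1 / matNorm γ ≤
      2 * (1 + 2 * (1 + Real.log X)) := by
  classical
  set S := (congrBall M X).filter (fun γ => γ 0 0 * γ 1 1 = 1) with hSdef
  have diag : ∀ γ ∈ S, γ 0 0 = 1 ∧ γ 1 1 = 1 ∧ γ 0 1 * γ 1 0 = 0 := by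
    intro γ hγ
    rw [hSdef, Finset.mem_filter, mem_congrBall] at hγ
    obtain ⟨⟨-, h00, -, -, h11⟩, h⟩ := hγ
    have h3 : γ 0 1 * γ 1 0 = 0 := by linarith [sl_det γ]
    rcases Int.mul_eq_one_iff_eq_one_or_neg_one.1 h with ⟨h1, h2⟩ | ⟨h1, h2⟩
    · exact ⟨h1, h2, h3⟩
    · rw [h1] at h00
      have := Int.le_of_dvd (by norm_num) ((dvd_neg).2 h00)
      omega
  set g : ℤ → ℝ := fun b => if b = 0 then 1 else 1 / |(b : ℝ)| with hg
  have hg0 : ∀ b, 0 ≤ g b := fun b => by simp only [hg]; split_ifs <;> positivity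
  have hgs : ∑ b ∈ Finset.Icc (-(X : ℤ)) X, g b ≤ 1 + 2 * (1 + Real.log X) := by
    have : ∀ b : ℤ, g b = (if b = 0 then 1 else 0) + 1 / |(b : ℝ)| := by
      intro b
      simp only [hg]
      split_ifs with h <;> simp [h]
    simp only [this, Finset.sum_add_distrib]
    refine add_le_add ?_ sum_Icc_one_div_abs_le
    simp
  have hgm : ∀ (γ : SL(2, ℤ)) i j, 1 / matNorm γ ≤ g (γ i j) := by
    intro γ i j
    simp only [hg]
    split_ifs with h
    · rw [div_le_one (matNorm_pos γ)]; exact one_le_matNorm γ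
    · exact one_div_le_one_div_of_le (by positivity) (abs_entry_le γ i j)
  have hmem : ∀ γ ∈ S, ∀ i j, γ i j ∈ Finset.Icc (-(X : ℤ)) X := by
    intro γ hγ
    rw [hSdef, Finset.mem_filter, mem_congrBall] at hγ
    exact entry_mem_Icc hγ.1.1
  have hsub : S ⊆ S.filter (fun γ => γ 1 0 = 0) ∪ S.filter (fun γ => γ 0 1 = 0) := by
    intro γ hγ
    have := mul_eq_zero.1 (diag γ hγ).2.2
    simp only [Finset.mem_union, Finset.mem_filter]
    tauto
  calc ∑ γ ∈ S, 1 / matNorm γ ≤ ∑ γ ∈ S.filter (fun γ => γ 1 0 = 0), 1 / matNorm γ +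
        ∑ γ ∈ S.filter (fun γ => γ 0 1 = 0), 1 / matNorm γ := by
        rw [← Finset.sum_union_inter]
        refine (Finset.sum_le_sum_of_subset_of_nonneg hsub fun γ _ _ => ?_).trans
          (le_add_of_nonneg_right (Finset.sum_nonneg fun γ _ => ?_)) <;>
        exact one_div_nonneg.2 (matNorm_pos γ).le
    _ ≤ ∑ b ∈ Finset.Icc (-(X : ℤ)) X, g b + ∑ b ∈ Finset.Icc (-(X : ℤ)) X, g b := by
        refine add_le_add
          (Finset.sum_le_sum_of_injOn (fun γ => γ 0 1) ?_ (fun γ hγ =>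
            hmem γ (Finset.mem_filter.1 hγ).1 _ _) (fun γ _ => hgm γ _ _) fun b _ => hg0 b)
          (Finset.sum_le_sum_of_injOn (fun γ => γ 1 0) ?_ (fun γ hγ =>
            hmem γ (Finset.mem_filter.1 hγ).1 _ _) (fun γ _ => hgm γ _ _) fun b _ => hg0 b)
        · intro γ hγ γ' hγ' h
          rw [Finset.mem_coe, Finset.mem_filter] at hγ hγ'
          have d1 := diag γ hγ.1
          have d2 := diag γ' hγ'.1
          exact sl_ext (by rw [d1.1, d2.1]) h (by rw [hγ.2, hγ'.2]) (by rw [d1.2.1, d2.2.1])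
        · intro γ hγ γ' hγ' h
          rw [Finset.mem_coe, Finset.mem_filter] at hγ hγ'
          have d1 := diag γ hγ.1
          have d2 := diag γ' hγ'.1
          exact sl_ext (by rw [d1.1, d2.1]) (by rw [hγ.2, hγ'.2]) h (by rw [d1.2.1, d2.2.1])
    _ ≤ _ := by linarith

/-- The weighted number of elements of a congruence subgroup in a ball. -/
theorem sum_congrBall_le {M X : ℕ} (hM : 2 < M) (hX : M ≤ X) {D : ℝ} (hD1 : 1 ≤ D)
    (hD : ∀ n ≠ 0, n ≤ 2 * X ^ 2 → (n.divisors.card : ℝ) ≤ D) :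
    ∑ γ ∈ congrBall M X, 1 / matNorm γ ≤ D * (48 * X / M ^ 3 + 14 * (1 + Real.log X)) := by
  classical
  set I := Finset.Icc (-(X : ℤ)) X with hI
  set T : Finset (ℤ × ℤ) := (I ×ˢ I).filter fun p => (M : ℤ) ∣ p.1 - 1 ∧ (M : ℤ) ∣ p.2 - 1 ∧
    ((M ^ 2 : ℕ) : ℤ) ∣ p.1 + p.2 - 2 with hT
  set S := (congrBall M X).filter (fun γ => ¬ γ 0 0 * γ 1 1 = 1) with hS
  set w : ℤ × ℤ → ℝ := fun p => 1 / max |(p.1 : ℝ)| |(p.2 : ℝ)| with hw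
  have hw0 : ∀ p, 0 ≤ w p := fun p => one_div_nonneg.2 (le_max_of_le_left (abs_nonneg _))
  have hX1 : (1 : ℝ) ≤ X := by exact_mod_cast (show 1 ≤ X by omega)
  have hlog : 0 ≤ Real.log X := Real.log_nonneg hX1
  set E : ℝ := 12 * X / M ^ 3 + 2 * (1 + Real.log X) with hE
  have hTw : ∑ p ∈ T, w p ≤ E + E := by
    have hsum := sum_one_div_le_of_congr (by omega : 1 < M) hX
    rw [Finset.sum_sigma'] at hsum
    have hsub : T ⊆ T.filter (fun p => |p.2| ≤ |p.1|) ∪ T.filter (fun p => |p.1| ≤ |p.2|) := by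
      intro p hp
      simp only [Finset.mem_union, Finset.mem_filter, hp, true_and]
      exact le_total _ _
    calc ∑ p ∈ T, w p ≤ ∑ p ∈ T.filter (fun p => |p.2| ≤ |p.1|), w p +
          ∑ p ∈ T.filter (fun p => |p.1| ≤ |p.2|), w p := by
          rw [← Finset.sum_union_inter]
          exact (Finset.sum_le_sum_of_subset_of_nonneg hsub fun p _ _ => hw0 p).trans
            (le_add_of_nonneg_right (Finset.sum_nonneg fun p _ => hw0 p))
      _ ≤ E + E := by
          refine add_le_add (le_trans ?_ hsum) (le_trans ?_ hsum)
          · refine Finset.sum_le_sum_of_injOn (fun p => (⟨p.1, p.2⟩ : Σ _ : ℤ, ℤ)) ?_ ?_ ?_ ?_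
            · rintro ⟨a, d⟩ - ⟨a', d'⟩ - h
              simpa using h
            · rintro ⟨a, d⟩ h
              simp only [hT, Finset.mem_filter, Finset.mem_product, Finset.mem_sigma] at h ⊢
              tauto
            · rintro ⟨a, d⟩ h
              rw [Finset.mem_filter] at h
              have : |(d : ℝ)| ≤ |(a : ℝ)| := by exact_mod_cast h.2
              simp only [hw]
              rw [max_eq_left this]
            · intros; positivity
          · refine Finset.sum_le_sum_of_injOn (fun p => (⟨p.2, p.1⟩ : Σ _ : ℤ, ℤ)) ?_ ?_ ?_ ?_
            · rintro ⟨a, d⟩ - ⟨a', d'⟩ - h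
              simp only [Sigma.mk.injEq, heq_eq_eq] at h
              rw [h.1, h.2]
            · rintro ⟨a, d⟩ h
              simp only [hT, Finset.mem_filter, Finset.mem_product, Finset.mem_sigma] at h ⊢
              rw [add_comm d a]
              tauto
            · rintro ⟨a, d⟩ h
              rw [Finset.mem_filter] at h
              have : |(a : ℝ)| ≤ |(d : ℝ)| := by exact_mod_cast h.2
              simp only [hw]
              rw [max_eq_right this]
            · intros; positivity
  have hmaps : ∀ γ ∈ S, (γ 0 0, γ 1 1) ∈ T := by
    intro γ hγ
    rw [hS, Finset.mem_filter, mem_congrBall] at hγ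
    obtain ⟨⟨h, h00, h01, h10, h11⟩, -⟩ := hγ
    rw [hT, Finset.mem_filter, Finset.mem_product]
    exact ⟨⟨entry_mem_Icc h _ _, entry_mem_Icc h _ _⟩, h00, h11,
      dvd_trace_sub_two h00 h01 h10 h11⟩
  have hSle : ∑ γ ∈ S, 1 / matNorm γ ≤ 2 * D * (E + E) := by
    calc ∑ γ ∈ S, 1 / matNorm γ ≤ ∑ γ ∈ S, w (γ 0 0, γ 1 1) := by
          refine Finset.sum_le_sum fun γ hγ => one_div_le_one_div_of_le ?_
            (max_le (abs_entry_le _ _ _) (abs_entry_le _ _ _))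
          have h1 : (M : ℤ) ∣ γ 0 0 - 1 := (Finset.mem_filter.1 (hmaps γ hγ)).2.1
          refine lt_max_of_lt_left (abs_pos.2 (Int.cast_ne_zero.2 fun h0 : γ 0 0 = 0 => ?_))
          rw [h0] at h1
          have := Int.natAbs_dvd_natAbs.2 h1
          simp at this
          omega
      _ = ∑ p ∈ T, ∑ γ ∈ S.filter (fun γ => (γ 0 0, γ 1 1) = p), w (γ 0 0, γ 1 1) :=
          (Finset.sum_fiberwise_of_maps_to hmaps _).symm
      _ ≤ ∑ p ∈ T, 2 * D * w p := by
          refine Finset.sum_le_sum fun p hp => ?_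
          have e : ∑ γ ∈ S.filter (fun γ => (γ 0 0, γ 1 1) = p), w (γ 0 0, γ 1 1) =
              (S.filter (fun γ => (γ 0 0, γ 1 1) = p)).card * w p := by
            rw [← nsmul_eq_mul, ← Finset.sum_const]
            exact Finset.sum_congr rfl fun γ hγ => by rw [(Finset.mem_filter.1 hγ).2]
          rw [e]
          refine mul_le_mul_of_nonneg_right ?_ (hw0 p)
          rcases (S.filter (fun γ => (γ 0 0, γ 1 1) = p)).eq_empty_or_nonempty with h | ⟨γ, hγ⟩
          · rw [h]; simp; linarith
          have hγ' := Finset.mem_filter.1 hγ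
          have hne : p.1 * p.2 ≠ 1 := by
            have := (Finset.mem_filter.1 hγ'.1).2
            rw [← hγ'.2]; exact this
          have hc := card_filter_diag_le (S := S.filter (fun γ => (γ 0 0, γ 1 1) = p)) hne
            fun γ hγ => by
              have := (Finset.mem_filter.1 hγ).2
              exact ⟨congrArg Prod.fst this, congrArg Prod.snd this⟩
          have hb : (p.1 * p.2 - 1).natAbs ≤ 2 * X ^ 2 := by
            simp only [hT, hI, Finset.mem_filter, Finset.mem_product, Finset.mem_Icc] at hp
            have h1 := abs_le.2 hp.1.1
            have h2 := abs_le.2 hp.1.2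
            have h3 : |p.1 * p.2| ≤ X * X := by
              rw [abs_mul]; gcongr
            have h4 := abs_le.1 h3
            have h5 : (1 : ℤ) ≤ X * X := by
              have : (1 : ℤ) ≤ X := by omega
              nlinarith
            zify
            rw [abs_le]
            constructor <;> nlinarith
          have hD' := hD _ (Int.natAbs_ne_zero.2 (sub_ne_zero.2 hne)) hb
          calc ((S.filter (fun γ => (γ 0 0, γ 1 1) = p)).card : ℝ) ≤
                ((2 * (p.1 * p.2 - 1).natAbs.divisors.card : ℕ) : ℝ) := Nat.cast_le.2 hc
            _ ≤ 2 * D := by push_cast; linarith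
      _ = 2 * D * ∑ p ∈ T, w p := by rw [Finset.mul_sum]
      _ ≤ _ := by gcongr
  have hU := sum_congrBall_unipotent_le (X := X) hM
  rw [← Finset.sum_filter_add_sum_filter_not (congrBall M X) (fun γ => γ 0 0 * γ 1 1 = 1)]
  have : 2 * (1 + 2 * (1 + Real.log X)) ≤ D * (6 * (1 + Real.log X)) := by
    nlinarith
  calc _ ≤ D * (6 * (1 + Real.log X)) + 2 * D * (E + E) := add_le_add (hU.trans this) hSle
    _ = _ := by rw [hE]; ring

section ZModLemmas

theorem ZMod.castHom_eq_zero_iff_exists {N d : ℕ} [NeZero N] (h : d ∣ N) (x : ZMod N) :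
    ZMod.castHom h (ZMod d) x = 0 ↔ ∃ y, x = d * y := by
  constructor
  · intro hx
    rw [← ZMod.natCast_zmod_val x, map_natCast, ZMod.natCast_eq_zero_iff] at hx
    obtain ⟨k, hk⟩ := hx
    exact ⟨k, by rw [← Nat.cast_mul, ← hk, ZMod.natCast_zmod_val]⟩
  · rintro ⟨y, rfl⟩
    rw [map_mul, map_natCast, ZMod.natCast_self, zero_mul]

theorem ZMod.castHom_eq_zero_iff_dvd_gcd {N d : ℕ} [NeZero N] (h : d ∣ N) (x : ZMod N) :
    ZMod.castHom h (ZMod d) x = 0 ↔ d ∣ x.val.gcd N := by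
  rw [← ZMod.natCast_zmod_val x, map_natCast, ZMod.natCast_eq_zero_iff, ZMod.natCast_zmod_val,
    Nat.dvd_gcd_iff]
  exact ⟨fun h' => ⟨h', h⟩, fun h' => h'.1⟩

theorem ZMod.val_gcd_unit_mul_natCast {N d : ℕ} [NeZero N] (hd : d ∣ N) (z : (ZMod N)ˣ) :
    ((z : ZMod N) * d).val.gcd N = d := by
  have hg : ((z : ZMod N) * d).val.gcd N ∣ N := Nat.gcd_dvd_right _ _
  refine Nat.dvd_antisymm ?_ ?_
  · have h1 := (ZMod.castHom_eq_zero_iff_dvd_gcd hg _).2 dvd_rfl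
    have h2 : (z : ZMod N) * d * (z⁻¹ : (ZMod N)ˣ) = d := by rw [mul_right_comm]; simp
    have h3 := congrArg (ZMod.castHom hg (ZMod (((z : ZMod N) * d).val.gcd N))) h2
    rw [map_mul, h1, zero_mul, map_natCast, eq_comm, ZMod.natCast_eq_zero_iff] at h3
    exact h3
  · rw [← ZMod.castHom_eq_zero_iff_dvd_gcd hd, map_mul, map_natCast, ZMod.natCast_self, mul_zero]

theorem ZMod.exists_unit_mul_gcd {N : ℕ} [NeZero N] (x : ZMod N) :
    ∃ z : (ZMod N)ˣ, x = z * (x.val.gcd N : ℕ) := by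
  obtain ⟨d, hd, u, ⟨z, rfl⟩, hx⟩ := x.eq_unit_mul_divisor
  refine ⟨z, ?_⟩
  nth_rewrite 2 [hx]
  rw [ZMod.val_gcd_unit_mul_natCast hd, hx]

theorem ZMod.val_gcd_unit_mul {N : ℕ} [NeZero N] (z : (ZMod N)ˣ) (x : ZMod N) :
    ((z : ZMod N) * x).val.gcd N = x.val.gcd N := by
  obtain ⟨u, hu⟩ := ZMod.exists_unit_mul_gcd x
  nth_rewrite 1 [hu]
  rw [← mul_assoc, ← Units.val_mul, ZMod.val_gcd_unit_mul_natCast (Nat.gcd_dvd_right _ _)]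

/-- A residue coprime to a divisor `d` of `N` is congruent to a unit modulo `d`. -/
theorem ZMod.exists_unit_add_mul {N d : ℕ} [NeZero N] (h : d ∣ N) {a : ZMod N}
    (ha : IsCoprime a d) : ∃ (z : (ZMod N)ˣ) (y : ZMod N), a = z + d * y := by
  obtain ⟨s, t, hst⟩ := ha
  set π := ZMod.castHom h (ZMod d)
  have h1 : π s * π a = 1 := by
    have := congrArg π hst
    simpa using this
  obtain ⟨z, hz⟩ := ZMod.unitsMap_surjective h (Units.mkOfMulEqOne _ _ (by rwa [mul_comm] at h1))
  have h2 : π z = π a := congrArg Units.val hz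
  obtain ⟨y, hy⟩ := (ZMod.castHom_eq_zero_iff_exists h (a - z)).1 (by
    change π _ = 0; rw [map_sub, h2, sub_self])
  exact ⟨z, y, by rw [← hy]; ring⟩

theorem card_two_mul_eq_zero_le {N : ℕ} [NeZero N] :
    (Finset.univ.filter fun t : ZMod N => 2 * t = 0).card ≤ 2 := by
  have : (Finset.univ.filter fun t : ZMod N => 2 * t = 0) ⊆ {0, ((N / 2 : ℕ) : ZMod N)} := by
    intro t ht
    have ht := (Finset.mem_filter.1 ht).2
    rw [← ZMod.natCast_zmod_val t, ← Nat.cast_two, ← Nat.cast_mul, ZMod.natCast_eq_zero_iff] at ht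
    have hlt := ZMod.val_lt t
    obtain ⟨k, hk⟩ := ht
    have hk2 : k < 2 := by
      by_contra! h
      have := Nat.mul_le_mul_left N h
      omega
    rw [Finset.mem_insert, Finset.mem_singleton]
    interval_cases k
    · left
      rw [← ZMod.val_eq_zero]; omega
    · right
      rw [← ZMod.natCast_zmod_val t]
      congr 1
      omega
  exact (Finset.card_le_card this).trans Finset.card_le_two

/-- The number of square roots of one modulo `N`. -/
theorem card_sq_eq_one_le {N : ℕ} [NeZero N] :
    (Finset.univ.filter fun z : (ZMod N)ˣ => z ^ 2 = 1).card ≤ 2 * N.divisors.card := by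
  classical
  refine Finset.card_le_mul_card_image_of_maps_to
    (f := fun z : (ZMod N)ˣ => ((z : ZMod N) - 1).val.gcd N) ?_ 2 ?_
  · intro z _
    exact Nat.mem_divisors.2 ⟨Nat.gcd_dvd_right _ _, NeZero.ne N⟩
  intro d hd
  rcases (Finset.filter (fun z : (ZMod N)ˣ => ((z : ZMod N) - 1).val.gcd N = d)
    (Finset.univ.filter fun z : (ZMod N)ˣ => z ^ 2 = 1)).eq_empty_or_nonempty with h | ⟨z₀, hz₀⟩
  · rw [h]; simp
  have props : ∀ z : (ZMod N)ˣ, z ∈ Finset.filter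
      (fun z : (ZMod N)ˣ => ((z : ZMod N) - 1).val.gcd N = d)
      (Finset.univ.filter fun z : (ZMod N)ˣ => z ^ 2 = 1) →
      (∃ c, (z : ZMod N) - 1 = d * c) ∧ ∃ c, (z : ZMod N) + 1 = (N / d : ℕ) * c := by
    intro z hz
    simp only [Finset.mem_filter, Finset.mem_univ, true_and] at hz
    have hdN : d ∣ N := hz.2 ▸ Nat.gcd_dvd_right _ _
    have hNd : N / d ∣ N := Nat.div_dvd_of_dvd hdN
    obtain ⟨u, hu⟩ := ZMod.exists_unit_mul_gcd ((z : ZMod N) - 1)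
    rw [hz.2] at hu
    refine ⟨⟨u, by rw [hu, mul_comm]⟩, ?_⟩
    have h1 : (d : ZMod N) * ((z : ZMod N) + 1) = 0 := by
      have h2 : (z : ZMod N) ^ 2 = 1 := by
        have := congrArg Units.val hz.1
        rwa [Units.val_pow_eq_pow_val, Units.val_one] at this
      have h3 : (u : ZMod N) * (d * ((z : ZMod N) + 1)) = 0 := by
        rw [← mul_assoc, ← hu]; linear_combination h2
      exact (Units.mul_right_eq_zero u).1 h3
    rw [← ZMod.castHom_eq_zero_iff_exists hNd]
    rw [← ZMod.natCast_zmod_val ((z : ZMod N) + 1), ← Nat.cast_mul, ZMod.natCast_eq_zero_iff] at h1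
    rw [← ZMod.natCast_zmod_val ((z : ZMod N) + 1), map_natCast, ZMod.natCast_eq_zero_iff]
    exact (Nat.div_dvd_iff_dvd_mul hdN (Nat.pos_of_dvd_of_pos hdN (NeZero.pos N))).2 h1
  refine (Finset.card_le_card_of_injOn (fun z : (ZMod N)ˣ => (z : ZMod N) - z₀) ?_ ?_).trans
    (card_two_mul_eq_zero_le (N := N))
  · intro z hz
    rw [Finset.mem_coe, Finset.mem_filter]
    refine ⟨Finset.mem_univ _, ?_⟩
    obtain ⟨⟨a, ha⟩, b, hb⟩ := props z hz
    obtain ⟨⟨a', ha'⟩, b', hb'⟩ := props z₀ hz₀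
    have hdN : d ∣ N := Nat.dvd_of_mem_divisors hd
    have hN : (d : ZMod N) * (N / d : ℕ) = 0 := by
      rw [← Nat.cast_mul, Nat.mul_div_cancel' hdN, ZMod.natCast_self]
    have e1 : (z : ZMod N) - z₀ = d * (a - a') := by linear_combination ha - ha'
    have e2 : (z : ZMod N) - z₀ = (N / d : ℕ) * (b - b') := by linear_combination hb - hb'
    have e3 : (2 : ZMod N) = (N / d : ℕ) * b - d * a := by linear_combination hb - ha
    calc (2 : ZMod N) * (z - z₀) = (N / d : ℕ) * b * (z - z₀) - d * a * (z - z₀) := by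
          rw [e3]; ring
      _ = (N / d : ℕ) * b * (d * (a - a')) - d * a * ((N / d : ℕ) * (b - b')) := by
          rw [← e1, ← e2]
      _ = 0 := by linear_combination (b * (a - a') - a * (b - b')) * hN
  · intro z _ z' _ h
    exact Units.ext (sub_left_injective h)

end ZModLemmas

section PrimitiveVectors

variable {R : Type*} [CommRing R]

/-- The determinant of two plane vectors. -/
def vdet (v w : Fin 2 → R) : R := v 0 * w 1 - v 1 * w 0

/-- A plane vector with coprime coordinates. -/
def IsPrim (v : Fin 2 → R) : Prop := IsCoprime (v 0) (v 1)

theorem vdet_mulVec (g : Matrix (Fin 2) (Fin 2) R) (v w : Fin 2 → R) :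
    vdet (g *ᵥ v) (g *ᵥ w) = g.det * vdet v w := by
  simp only [vdet, Matrix.mulVec, dotProduct, Fin.sum_univ_two, det_fin_two]
  ring

theorem IsPrim.smul {v : Fin 2 → R} (hv : IsPrim v) (z : Rˣ) : IsPrim ((z : R) • v) := by
  obtain ⟨s, t, h⟩ := hv
  refine ⟨s * (z⁻¹ : Rˣ), t * (z⁻¹ : Rˣ), ?_⟩
  simp only [Pi.smul_apply, smul_eq_mul]
  linear_combination (s * v 0 + t * v 1) * (z.inv_mul) + h

theorem isPrim_e : IsPrim (![1, 0] : Fin 2 → R) := ⟨1, 0, by simp⟩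

theorem IsPrim.exists_sl {v : Fin 2 → R} (hv : IsPrim v) :
    ∃ g : SL(2, R), (g : Matrix (Fin 2) (Fin 2) R) *ᵥ ![1, 0] = v := by
  obtain ⟨s, t, h⟩ := hv
  refine ⟨slMk (v 0) (-t) (v 1) s (by linear_combination h), ?_⟩
  ext i
  fin_cases i <;> simp [slMk, Matrix.mulVec, dotProduct, Fin.sum_univ_two]

theorem isPrim_mulVec (g : GL (Fin 2) R) {v : Fin 2 → R} (hv : IsPrim v) :
    IsPrim ((g : Matrix (Fin 2) (Fin 2) R) *ᵥ v) := by
  obtain ⟨s, t, h⟩ := hv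
  have h1 : ![s, t] ⬝ᵥ v = 1 := by simpa [dotProduct, Fin.sum_univ_two] using h
  set u := ![s, t] ᵥ* ((g⁻¹ : GL (Fin 2) R) : Matrix (Fin 2) (Fin 2) R)
  have h2 : u ⬝ᵥ ((g : Matrix (Fin 2) (Fin 2) R) *ᵥ v) = 1 := by
    rw [Matrix.dotProduct_mulVec, Matrix.vecMul_vecMul, ← Units.val_mul, inv_mul_cancel,
      Units.val_one, Matrix.vecMul_one, h1]
  exact ⟨u 0, u 1, by simpa [dotProduct, Fin.sum_univ_two] using h2⟩

/-- The permutation of plane vectors defined by an invertible matrix. -/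
def glEquiv (g : GL (Fin 2) R) : (Fin 2 → R) ≃ (Fin 2 → R) where
  toFun v := (g : Matrix (Fin 2) (Fin 2) R) *ᵥ v
  invFun v := ((g⁻¹ : GL (Fin 2) R) : Matrix (Fin 2) (Fin 2) R) *ᵥ v
  left_inv v := by
    change _ *ᵥ (_ *ᵥ v) = v
    rw [Matrix.mulVec_mulVec, ← Units.val_mul, inv_mul_cancel, Units.val_one, Matrix.one_mulVec]
  right_inv v := by
    change _ *ᵥ (_ *ᵥ v) = v
    rw [Matrix.mulVec_mulVec, ← Units.val_mul, mul_inv_cancel, Units.val_one, Matrix.one_mulVec]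

theorem glEquiv_apply (g : GL (Fin 2) R) (v : Fin 2 → R) :
    glEquiv g v = (g : Matrix (Fin 2) (Fin 2) R) *ᵥ v := rfl

theorem glEquiv_mul (g h : GL (Fin 2) R) (v : Fin 2 → R) :
    glEquiv (g * h) v = glEquiv g (glEquiv h v) := by
  rw [glEquiv_apply, glEquiv_apply, glEquiv_apply, Matrix.mulVec_mulVec, Units.val_mul]

theorem glEquiv_smul (g : GL (Fin 2) R) (z : R) (v : Fin 2 → R) :
    glEquiv g (z • v) = z • glEquiv g v := by
  rw [glEquiv_apply, glEquiv_apply, Matrix.mulVec_smul]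

theorem isPrim_glEquiv {g : GL (Fin 2) R} {v : Fin 2 → R} : IsPrim (glEquiv g v) ↔ IsPrim v :=
  ⟨fun h => by
    have := isPrim_mulVec g⁻¹ h
    rwa [glEquiv_apply, Matrix.mulVec_mulVec, ← Units.val_mul, inv_mul_cancel, Units.val_one,
      Matrix.one_mulVec] at this, isPrim_mulVec g⟩

theorem vdet_glEquiv (g : GL (Fin 2) R) (v w : Fin 2 → R) :
    vdet (glEquiv g v) (glEquiv g w) = Matrix.GeneralLinearGroup.det g * vdet v w :=
  vdet_mulVec _ _ _

theorem IsPrim.exists_unit_smul {v w : Fin 2 → R} (hv : IsPrim v) (hw : IsPrim w)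
    (h : vdet v w = 0) : ∃ z : Rˣ, w = (z : R) • v := by
  obtain ⟨s, t, hst⟩ := hv
  obtain ⟨s', t', hst'⟩ := hw
  unfold vdet at h
  set z := s * w 0 + t * w 1 with hz
  have h0 : z * v 0 = w 0 := by rw [hz]; linear_combination w 0 * hst + t * h
  have h1 : z * v 1 = w 1 := by rw [hz]; linear_combination w 1 * hst - s * h
  have hu : z * (s' * v 0 + t' * v 1) = 1 := by linear_combination hst' + s' * h0 + t' * h1
  refine ⟨Units.mkOfMulEqOne _ _ hu, ?_⟩
  ext i
  fin_cases i
  · exact h0.symm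
  · exact h1.symm

theorem IsPrim.smul_injective {v : Fin 2 → R} (hv : IsPrim v) {z z' : R} (h : z • v = z' • v) :
    z = z' := by
  obtain ⟨s, t, hst⟩ := hv
  have h0 : z * v 0 = z' * v 0 := congrFun h 0
  have h1 : z * v 1 = z' * v 1 := congrFun h 1
  linear_combination (z' - z) * hst + s * h0 + t * h1

theorem vdet_smul_self (z : R) (v : Fin 2 → R) : vdet v (z • v) = 0 := by
  simp only [vdet, Pi.smul_apply, smul_eq_mul]; ring

theorem IsPrim.map {S : Type*} [CommRing S] (φ : R →+* S) {v : Fin 2 → R} (hv : IsPrim v) :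
    IsPrim (fun i => φ (v i)) := IsCoprime.map hv φ

theorem vdet_map {S : Type*} [CommRing S] (φ : R →+* S) (v w : Fin 2 → R) :
    vdet (fun i => φ (v i)) (fun i => φ (w i)) = φ (vdet v w) := by
  simp [vdet]

end PrimitiveVectors

section Orthogonality

variable {N : ℕ}

/-- A function on primitive vectors modulo `N`, extended by zero and invariant under scaling. -/
structure IsProjFun (f : (Fin 2 → ZMod N) → ℝ) : Prop where
  eq_zero : ∀ v, ¬ IsPrim v → f v = 0
  smul : ∀ (z : (ZMod N)ˣ) v, f ((z : ZMod N) • v) = f v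

/-- Reduction of vectors. -/
def vred {M : ℕ} (h : M ∣ N) (v : Fin 2 → ZMod N) : Fin 2 → ZMod M :=
  fun i => ZMod.castHom h (ZMod M) (v i)

theorem vred_self (v : Fin 2 → ZMod N) : vred dvd_rfl v = v := by
  ext i; simp [vred]

/-- The orbit invariant of a pair of vectors. -/
def vgcd (v w : Fin 2 → ZMod N) : ℕ := (vdet v w).val.gcd N

theorem vgcd_dvd (v w : Fin 2 → ZMod N) : vgcd v w ∣ N := Nat.gcd_dvd_right _ _

variable [NeZero N] {f : (Fin 2 → ZMod N) → ℝ}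

/-- The sum of `f` over the fibres of reduction. -/
def pushforward {M : ℕ} (h : M ∣ N) (f : (Fin 2 → ZMod N) → ℝ) (v : Fin 2 → ZMod M) : ℝ :=
  ∑ w, if vred h w = v then f w else 0

/-- A function all of whose proper pushforwards vanish. -/
def IsNewFun (f : (Fin 2 → ZMod N) → ℝ) : Prop :=
  ∀ M (h : M ∣ N), M < N → ∀ v, pushforward h f v = 0

theorem sum_ite_castHom_vdet (hf : IsProjFun f) {e : ℕ} [NeZero e] (h : e ∣ N)
    {v : Fin 2 → ZMod N} (hv : IsPrim v) :
    (∑ w, if ZMod.castHom h (ZMod e) (vdet v w) = 0 then f w else 0) =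
      ∑ z : (ZMod e)ˣ, pushforward h f ((z : ZMod e) • vred h v) := by
  classical
  simp only [pushforward]
  rw [Finset.sum_comm]
  refine Finset.sum_congr rfl fun w _ => ?_
  by_cases hw : IsPrim w
  swap
  · simp [hf.eq_zero w hw]
  have hv' : IsPrim (vred h v) := hv.map _
  have hw' : IsPrim (vred h w) := hw.map _
  rw [← vdet_map]
  change (if vdet (vred h v) (vred h w) = 0 then f w else 0) = _
  split_ifs with h0
  · obtain ⟨z, hz⟩ := hv'.exists_unit_smul hw' h0
    rw [Finset.sum_eq_single z]
    · rw [if_pos hz]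
    · intro z' _ hne
      rw [if_neg]
      intro h'
      exact hne (Units.ext (hv'.smul_injective (h'.symm.trans hz)))
    · simp
  · rw [Finset.sum_eq_zero]
    intro z _
    rw [if_neg]
    intro h'
    rw [h', vdet_smul_self] at h0
    exact h0 rfl

theorem vgcd_glEquiv (g : GL (Fin 2) (ZMod N)) (v w : Fin 2 → ZMod N) :
    vgcd (glEquiv g v) (glEquiv g w) = vgcd v w := by
  rw [vgcd, vdet_glEquiv, ZMod.val_gcd_unit_mul, vgcd]

theorem sum_ite_dvd_vgcd (hf : IsProjFun f) (hnew : IsNewFun f) {e : ℕ} (h : e ∣ N) :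
    (∑ v, ∑ w, if e ∣ vgcd v w then f v * f w else 0) =
      if e = N then N.totient * ∑ v, f v ^ 2 else 0 := by
  have : NeZero e := ⟨fun h0 => NeZero.ne N (by simpa [h0] using h)⟩
  have key : ∀ v, (∑ w, if e ∣ vgcd v w then f v * f w else 0) =
      f v * ∑ z : (ZMod e)ˣ, pushforward h f ((z : ZMod e) • vred h v) := by
    intro v
    by_cases hv : IsPrim v
    · rw [← sum_ite_castHom_vdet hf h hv, Finset.mul_sum]
      refine Finset.sum_congr rfl fun w _ => ?_
      simp only [vgcd, ← ZMod.castHom_eq_zero_iff_dvd_gcd h, mul_ite, mul_zero]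
    · simp [hf.eq_zero v hv]
  simp only [key]
  split_ifs with he
  · subst he
    rw [Finset.mul_sum]
    refine Finset.sum_congr rfl fun v _ => ?_
    have : ∀ z : (ZMod e)ˣ, pushforward h f ((z : ZMod e) • vred h v) = f v := by
      intro z
      simp only [pushforward, vred_self]
      simp [hf.smul]
    simp only [this, Finset.sum_const, Finset.card_univ, ZMod.card_units_eq_totient, nsmul_eq_mul]
    ring
  · have hlt : e < N := lt_of_le_of_ne (Nat.le_of_dvd (NeZero.pos N) h) he
    simp [hnew e h hlt]

theorem sum_divisors_ite_div_eq {n d : ℕ} (hn : n ∣ N) (hd : d ∣ N) (x : ℝ) :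
    (∑ i ∈ n.divisors, if d = N / i then x else 0) = if N / n ∣ d then x else 0 := by
  have hN := NeZero.pos N
  have hn0 := Nat.pos_of_dvd_of_pos hn hN
  have hd0 := Nat.pos_of_dvd_of_pos hd hN
  have h1 : ∀ i ∈ n.divisors, (if d = N / i then x else 0) = if N / d = i then x else 0 := by
    intro i hi
    have hi' := (Nat.dvd_of_mem_divisors hi).trans hn
    refine if_congr ⟨?_, ?_⟩ rfl rfl
    · rintro rfl; exact Nat.div_div_self hi' hN.ne'
    · rintro rfl; exact (Nat.div_div_self hd hN.ne').symm
  rw [Finset.sum_congr rfl h1, Finset.sum_ite_eq]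
  refine if_congr ?_ rfl rfl
  rw [Nat.mem_divisors, Nat.div_dvd_iff_dvd_mul hd hd0, Nat.div_dvd_iff_dvd_mul hn hn0, mul_comm]
  exact and_iff_left hn0.ne'

/-- Correlations of a new function along one orbit. -/
def orbitSum (f : (Fin 2 → ZMod N) → ℝ) (d : ℕ) : ℝ :=
  ∑ v, ∑ w, if vgcd v w = d then f v * f w else 0

theorem abs_orbitSum_le (hf : IsProjFun f) (hnew : IsNewFun f) {d : ℕ} (hd : d ∣ N) :
    |orbitSum f d| ≤ N.totient * ∑ v, f v ^ 2 := by
  have hN := NeZero.pos N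
  set c : ℝ := N.totient * ∑ v, f v ^ 2 with hc
  have hc0 : 0 ≤ c := mul_nonneg (Nat.cast_nonneg _) (Finset.sum_nonneg fun v _ => sq_nonneg _)
  have h1 := (ArithmeticFunction.sum_eq_iff_sum_mul_moebius_eq_on
    (f := fun i => orbitSum f (N / i)) (g := fun n => if N / n = N then c else 0) {n | n ∣ N}
    (fun m n hmn hn => hmn.trans hn)).1 (by
      intro n hn hnN
      change n ∣ N at hnN
      rw [← sum_ite_dvd_vgcd hf hnew (Nat.div_dvd_of_dvd hnN)]
      simp only [orbitSum]
      rw [Finset.sum_comm]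
      refine Finset.sum_congr rfl fun v _ => ?_
      rw [Finset.sum_comm]
      exact Finset.sum_congr rfl fun w _ => sum_divisors_ite_div_eq hnN (vgcd_dvd v w) _)
  have hd0 := Nat.pos_of_dvd_of_pos hd hN
  have hq : 0 < N / d := Nat.div_pos (Nat.le_of_dvd hN hd) hd0
  have h2 := h1 (N / d) hq (Nat.div_dvd_of_dvd hd)
  rw [Nat.div_div_self hd hN.ne', Finset.sum_eq_single (N / d, 1)] at h2
  · rw [← h2, Nat.div_one, if_pos rfl, abs_mul, abs_of_nonneg hc0]
    refine mul_le_of_le_one_left hc0 ?_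
    exact_mod_cast ArithmeticFunction.abs_moebius_le_one
  · rintro ⟨a, b⟩ hab hne
    rw [Nat.mem_divisorsAntidiagonal] at hab
    have hb : b ≠ 1 := by
      rintro rfl
      exact hne (by rw [← hab.1, mul_one])
    have hb0 : b ≠ 0 := by rintro rfl; simp at hab; omega
    rw [if_neg, mul_zero]
    exact (Nat.div_lt_self hN (by omega)).ne
  · intro h
    exact absurd (Nat.mem_divisorsAntidiagonal.2 ⟨mul_one _, hq.ne'⟩) h

end Orthogonality

section Correlations

variable {N : ℕ}

/-- A scalar multiple of a unimodular matrix. -/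
def slScale (p : SL(2, ZMod N) × (ZMod N)ˣ) : GL (Fin 2) (ZMod N) :=
  Matrix.SpecialLinearGroup.toGL p.1 * Units.map (Matrix.scalar (Fin 2)).toMonoidHom p.2

theorem slScale_apply (p : SL(2, ZMod N) × (ZMod N)ˣ) (i j : Fin 2) :
    slScale p i j = p.1 i j * p.2 := by
  have h : (slScale p : Matrix (Fin 2) (Fin 2) (ZMod N)) =
      (p.1 : Matrix (Fin 2) (Fin 2) (ZMod N)) * Matrix.scalar (Fin 2) (p.2 : ZMod N) := rfl
  rw [h]
  simp [Matrix.scalar_apply]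

variable [NeZero N] {f : (Fin 2 → ZMod N) → ℝ}

theorem exists_glEquiv_eq {v w : Fin 2 → ZMod N} (hv : IsPrim v) (hw : IsPrim w) :
    ∃ (g : GL (Fin 2) (ZMod N)) (z : (ZMod N)ˣ),
      glEquiv g ![1, 0] = (z : ZMod N) • v ∧ glEquiv g ![1, (vgcd v w : ZMod N)] = w := by
  obtain ⟨g₀, hg₀⟩ := hv.exists_sl
  set k : GL (Fin 2) (ZMod N) := Matrix.SpecialLinearGroup.toGL g₀
  have hk : glEquiv k ![1, 0] = v := hg₀
  obtain ⟨w', rfl⟩ := (glEquiv k).surjective w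
  have hw' : IsPrim w' := isPrim_glEquiv.1 hw
  set d := vgcd v (glEquiv k w') with hd
  have hd' : d = (w' 1).val.gcd N := by
    rw [hd, ← hk, vgcd_glEquiv, vgcd]
    simp [vdet]
  obtain ⟨z, hz⟩ := ZMod.exists_unit_mul_gcd (w' 1)
  rw [← hd'] at hz
  have hcop : IsCoprime (w' 0) (d : ZMod N) := by
    obtain ⟨s, t, h⟩ := hw'
    exact ⟨s, t * z, by linear_combination h - t * hz⟩
  obtain ⟨z₁, y₁, h₁⟩ := ZMod.exists_unit_add_mul (hd' ▸ Nat.gcd_dvd_right _ _ : d ∣ N) hcop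
  have hdet : IsUnit (!![(z₁ : ZMod N), y₁; 0, z]).det := by
    rw [Matrix.det_fin_two_of, mul_zero, sub_zero]
    exact (z₁ * z).isUnit
  refine ⟨k * Matrix.nonsingInvUnit _ hdet, z₁, ?_, ?_⟩
  · have : glEquiv (Matrix.nonsingInvUnit _ hdet) ![1, 0] = (z₁ : ZMod N) • ![1, 0] := by
      rw [glEquiv_apply]
      ext i
      fin_cases i <;> simp [Matrix.nonsingInvUnit]
    rw [glEquiv_mul, this, glEquiv_smul, hk]
  · have : glEquiv (Matrix.nonsingInvUnit _ hdet) ![1, (d : ZMod N)] = w' := by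
      rw [glEquiv_apply]
      ext i
      fin_cases i
      · simp [Matrix.nonsingInvUnit, h₁, mul_comm]
      · simpa [Matrix.nonsingInvUnit, mul_comm] using hz.symm
    rw [glEquiv_mul, this]

/-- Correlation of the values of `f` at two vectors over the general linear group. -/
def glCorr (f : (Fin 2 → ZMod N) → ℝ) (v w : Fin 2 → ZMod N) : ℝ :=
  ∑ g : GL (Fin 2) (ZMod N), f (glEquiv g v) * f (glEquiv g w)

theorem glCorr_eq (hf : IsProjFun f) {v w : Fin 2 → ZMod N} (hv : IsPrim v) (hw : IsPrim w) :
    glCorr f v w = glCorr f ![1, 0] ![1, (vgcd v w : ZMod N)] := by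
  obtain ⟨g, z, h1, h2⟩ := exists_glEquiv_eq hv hw
  refine Fintype.sum_equiv (Equiv.mulRight g) _ _ fun k => ?_
  rw [Equiv.coe_mulRight, glEquiv_mul, glEquiv_mul, h1, h2, glEquiv_smul, hf.smul]

open Classical in
/-- The primitive vectors. -/
noncomputable def primSet (N : ℕ) [NeZero N] : Finset (Fin 2 → ZMod N) := Finset.univ.filter IsPrim

theorem mem_primSet {v : Fin 2 → ZMod N} : v ∈ primSet N ↔ IsPrim v := by simp [primSet]

open Classical in
/-- An orbit of the general linear group, with scaling, on pairs of primitive vectors. -/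
noncomputable def orbitSet (N : ℕ) [NeZero N] (d : ℕ) :
    Finset ((Fin 2 → ZMod N) × (Fin 2 → ZMod N)) :=
  Finset.univ.filter fun p => IsPrim p.1 ∧ IsPrim p.2 ∧ vgcd p.1 p.2 = d

theorem mem_orbitSet {d : ℕ} {p : (Fin 2 → ZMod N) × (Fin 2 → ZMod N)} :
    p ∈ orbitSet N d ↔ IsPrim p.1 ∧ IsPrim p.2 ∧ vgcd p.1 p.2 = d := by simp [orbitSet]

theorem card_primSet_mul_le {d : ℕ} (hd : d ∣ N) :
    (primSet N).card * N.totient ≤ (orbitSet N d).card := by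
  classical
  have hex : ∀ v : Fin 2 → ZMod N, ∃ g : GL (Fin 2) (ZMod N), IsPrim v → glEquiv g ![1, 0] = v := by
    intro v
    by_cases hv : IsPrim v
    · obtain ⟨g₀, hg₀⟩ := hv.exists_sl
      exact ⟨Matrix.SpecialLinearGroup.toGL g₀, fun _ => hg₀⟩
    · exact ⟨1, fun h => absurd h hv⟩
  choose g hg using hex
  rw [← ZMod.card_units_eq_totient, ← Finset.card_univ, ← Finset.card_product]
  have hp : IsPrim ![1, (d : ZMod N)] := ⟨1, 0, by simp⟩
  refine Finset.card_le_card_of_injOn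
    (fun p => (p.1, (p.2 : ZMod N) • glEquiv (g p.1) ![1, (d : ZMod N)])) ?_ ?_
  · rintro ⟨v, z⟩ h
    simp only [Finset.coe_product, Set.mem_prod, Finset.mem_coe, mem_primSet] at h
    rw [Finset.mem_coe, mem_orbitSet]
    refine ⟨h.1, (isPrim_glEquiv.2 hp).smul z, ?_⟩
    dsimp only
    nth_rewrite 1 [← hg v h.1]
    rw [← glEquiv_smul, vgcd_glEquiv, vgcd]
    rw [show vdet ![1, 0] ((z : ZMod N) • ![1, (d : ZMod N)]) = z * d by simp [vdet]]
    exact ZMod.val_gcd_unit_mul_natCast hd z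
  · rintro ⟨v, z⟩ h ⟨v', z'⟩ h' heq
    simp only [Prod.mk.injEq] at heq
    obtain ⟨rfl, heq⟩ := heq
    rw [Units.ext ((isPrim_glEquiv.2 hp).smul_injective heq)]

theorem card_gl_le : Fintype.card (GL (Fin 2) (ZMod N)) ≤ N * ((primSet N).card * N.totient) := by
  classical
  have hex : ∀ v : Fin 2 → ZMod N, ∃ s t : ZMod N, IsPrim v → s * v 0 + t * v 1 = 1 := by
    intro v
    by_cases hv : IsPrim v
    · obtain ⟨s, t, h⟩ := hv
      exact ⟨s, t, fun _ => h⟩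
    · exact ⟨1, 1, fun h => absurd h hv⟩
  choose s t hst using hex
  rw [← ZMod.card_units_eq_totient]
  have hN : N = (Finset.univ : Finset (ZMod N)).card := by rw [Finset.card_univ, ZMod.card]
  refine le_of_le_of_eq (b := ((Finset.univ : Finset (ZMod N)) ×ˢ primSet N ×ˢ
    (Finset.univ : Finset (ZMod N)ˣ)).card) ?_ (by
      rw [Finset.card_product, Finset.card_product, ← hN, Finset.card_univ])
  rw [← Finset.card_univ]
  set c : GL (Fin 2) (ZMod N) → (Fin 2 → ZMod N) := fun g => glEquiv g ![1, 0] with hc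
  have hcp : ∀ g, IsPrim (c g) := fun g => isPrim_glEquiv.2 isPrim_e
  have hc0 : ∀ g : GL (Fin 2) (ZMod N), ∀ i, c g i = g i 0 := by
    intro g i
    fin_cases i <;> simp [hc, glEquiv_apply]
  refine Finset.card_le_card_of_injOn (fun g => (s (c g) * g 0 1 + t (c g) * g 1 1, c g,
    Matrix.GeneralLinearGroup.det g)) ?_ ?_
  · intro g _
    simp [mem_primSet, hcp g]
  · intro g _ g' _ h
    simp only [Prod.mk.injEq] at h
    obtain ⟨h1, h2, h3⟩ := h
    have e : s (c g) * c g 0 + t (c g) * c g 1 = 1 := hst _ (hcp g)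
    rw [← h2] at h1
    have d1 : g 0 0 * g 1 1 - g 0 1 * g 1 0 = g' 0 0 * g' 1 1 - g' 0 1 * g' 1 0 := by
      have := congrArg Units.val h3
      simpa [Matrix.det_fin_two] using this
    have q0 : g 0 0 = g' 0 0 := by rw [← hc0, ← hc0, h2]
    have q1 : g 1 0 = g' 1 0 := by rw [← hc0, ← hc0, h2]
    rw [hc0, hc0] at e
    rw [← q0, ← q1] at d1
    ext i j
    fin_cases i <;> fin_cases j
    · exact q0
    · change g 0 1 = g' 0 1
      linear_combination (g' 0 1 - g 0 1) * e + g 0 0 * h1 - t (c g) * d1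
    · exact q1
    · change g 1 1 = g' 1 1
      linear_combination (g' 1 1 - g 1 1) * e + g 1 0 * h1 + s (c g) * d1

theorem card_orbitSet_mul (hf : IsProjFun f) (d : ℕ) :
    (orbitSet N d).card * glCorr f ![1, 0] ![1, (d : ZMod N)] =
      Fintype.card (GL (Fin 2) (ZMod N)) * orbitSum f d := by
  classical
  have h1 : ∀ p ∈ orbitSet N d, glCorr f p.1 p.2 = glCorr f ![1, 0] ![1, (d : ZMod N)] := by
    intro p hp
    rw [mem_orbitSet] at hp
    rw [glCorr_eq hf hp.1 hp.2.1, hp.2.2]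
  have h2 : orbitSum f d = ∑ p ∈ orbitSet N d, f p.1 * f p.2 := by
    rw [orbitSum, ← Fintype.sum_prod_type' (f := fun v w => if vgcd v w = d then f v * f w else 0),
      orbitSet, Finset.sum_filter]
    refine Finset.sum_congr rfl fun p _ => ?_
    by_cases hp1 : IsPrim p.1
    · by_cases hp2 : IsPrim p.2
      · simp [hp1, hp2]
      · simp [hf.eq_zero _ hp2]
    · simp [hf.eq_zero _ hp1]
  have h3 : ∀ g : GL (Fin 2) (ZMod N),
      ∑ p ∈ orbitSet N d, f (glEquiv g p.1) * f (glEquiv g p.2) = orbitSum f d := by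
    intro g
    rw [h2]
    refine Finset.sum_equiv ((glEquiv g).prodCongr (glEquiv g)) ?_ fun p _ => rfl
    intro p
    simp [mem_orbitSet, isPrim_glEquiv, vgcd_glEquiv]
  rw [← nsmul_eq_mul, ← Finset.sum_const, ← Finset.sum_congr rfl h1]
  simp only [glCorr]
  rw [Finset.sum_comm, Finset.sum_congr rfl fun g _ => h3 g]
  simp

/-- The autocorrelation of `f` under an invertible matrix. -/
def autoCorr (f : (Fin 2 → ZMod N) → ℝ) (g : GL (Fin 2) (ZMod N)) : ℝ :=
  ∑ v, f (glEquiv g v) * f v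

theorem glCorr_mul_orbitSum_le (hf : IsProjFun f) (hnew : IsNewFun f) {d : ℕ} (hd : d ∣ N) :
    glCorr f ![1, 0] ![1, (d : ZMod N)] * orbitSum f d ≤
      N * (N.totient * ∑ v, f v ^ 2) ^ 2 := by
  have h1 := card_orbitSet_mul hf d
  have h2 : (Fintype.card (GL (Fin 2) (ZMod N)) : ℝ) ≤ N * (orbitSet N d).card := by
    exact_mod_cast card_gl_le.trans (Nat.mul_le_mul_left _ (card_primSet_mul_le hd))
  have h3 : (0 : ℝ) < Fintype.card (GL (Fin 2) (ZMod N)) := by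
    exact_mod_cast Fintype.card_pos
  have h4 : (0 : ℝ) < (orbitSet N d).card := by
    by_contra! h
    nlinarith [NeZero.pos N, (Nat.cast_nonneg N : (0 : ℝ) ≤ N)]
  have h5 : orbitSum f d ^ 2 ≤ (N.totient * ∑ v, f v ^ 2) ^ 2 :=
    sq_le_sq' (abs_le.1 (abs_orbitSum_le hf hnew hd)).1 (abs_le.1 (abs_orbitSum_le hf hnew hd)).2
  refine le_of_mul_le_mul_left ?_ h4
  calc (orbitSet N d).card * (glCorr f ![1, 0] ![1, (d : ZMod N)] * orbitSum f d)
      = Fintype.card (GL (Fin 2) (ZMod N)) * orbitSum f d ^ 2 := by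
        rw [← mul_assoc, h1]; ring
    _ ≤ (N * (orbitSet N d).card) * (N.totient * ∑ v, f v ^ 2) ^ 2 :=
        mul_le_mul h2 h5 (sq_nonneg _) (by positivity)
    _ = _ := by ring

theorem sum_autoCorr_sq_le (hf : IsProjFun f) (hnew : IsNewFun f) :
    ∑ g, autoCorr f g ^ 2 ≤
      N.divisors.card * (N * (N.totient * ∑ v, f v ^ 2) ^ 2) := by
  have h1 : ∑ g, autoCorr f g ^ 2 = ∑ v, ∑ w, glCorr f v w * (f v * f w) := by
    have : ∀ g, autoCorr f g ^ 2 =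
        ∑ v, ∑ w, f (glEquiv g v) * f (glEquiv g w) * (f v * f w) := by
      intro g
      rw [autoCorr, sq, Finset.sum_mul_sum]
      exact Finset.sum_congr rfl fun v _ => Finset.sum_congr rfl fun w _ => by ring
    simp only [this, glCorr, Finset.sum_mul]
    rw [Finset.sum_comm]
    exact Finset.sum_congr rfl fun v _ => Finset.sum_comm
  have h2 : ∀ v w, glCorr f v w * (f v * f w) =
      ∑ d ∈ N.divisors, glCorr f ![1, 0] ![1, (d : ZMod N)] *
        (if vgcd v w = d then f v * f w else 0) := by
    intro v w
    have : ∀ d : ℕ, glCorr f ![1, 0] ![1, (d : ZMod N)] * (if vgcd v w = d then f v * f w else 0) =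
      if vgcd v w = d then glCorr f ![1, 0] ![1, (d : ZMod N)] * (f v * f w) else 0 := by
      intro d; rw [mul_ite, mul_zero]
    rw [Finset.sum_congr rfl fun d _ => this d, Finset.sum_ite_eq,
      if_pos (Nat.mem_divisors.2 ⟨vgcd_dvd v w, NeZero.ne N⟩)]
    by_cases hv : IsPrim v
    · by_cases hw : IsPrim w
      · rw [glCorr_eq hf hv hw]
      · simp [hf.eq_zero w hw]
    · simp [hf.eq_zero v hv]
  have h3 : ∑ g, autoCorr f g ^ 2 =
      ∑ d ∈ N.divisors, glCorr f ![1, 0] ![1, (d : ZMod N)] * orbitSum f d := by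
    rw [h1]
    simp only [h2, orbitSum, Finset.mul_sum]
    rw [Finset.sum_comm (s := N.divisors)]
    exact Finset.sum_congr rfl fun v _ => Finset.sum_comm
  rw [h3, ← nsmul_eq_mul, ← Finset.sum_const]
  exact Finset.sum_le_sum fun d hd =>
    glCorr_mul_orbitSum_le hf hnew (Nat.dvd_of_mem_divisors hd)

theorem autoCorr_slScale (hf : IsProjFun f) (p : SL(2, ZMod N) × (ZMod N)ˣ) :
    autoCorr f (slScale p) = autoCorr f (Matrix.SpecialLinearGroup.toGL p.1) := by
  refine Finset.sum_congr rfl fun v _ => ?_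
  have : glEquiv (slScale p) v =
      (p.2 : ZMod N) • glEquiv (Matrix.SpecialLinearGroup.toGL p.1) v := by
    ext i
    simp only [glEquiv_apply, Matrix.mulVec, dotProduct, Fin.sum_univ_two, slScale_apply,
      Pi.smul_apply, smul_eq_mul]
    change _ = _ * (p.1 i 0 * v 0 + p.1 i 1 * v 1)
    ring
  rw [this, hf.smul]

theorem card_slScale_fibre_le (g : GL (Fin 2) (ZMod N)) :
    (Finset.univ.filter fun p => slScale p = g).card ≤ 2 * N.divisors.card := by
  classical
  rcases (Finset.univ.filter fun p => slScale p = g).eq_empty_or_nonempty with h | ⟨p₀, hp₀⟩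
  · simp [h]
  refine (Finset.card_le_card_of_injOn (fun p => p.2 * p₀.2⁻¹) ?_ ?_).trans
    (card_sq_eq_one_le (N := N))
  · intro p hp
    simp only [Finset.coe_filter, Finset.mem_univ, true_and, Set.mem_ofPred_eq] at hp
    simp only [Finset.mem_filter, Finset.mem_univ, true_and] at hp₀
    have hsq : ∀ q : SL(2, ZMod N) × (ZMod N)ˣ, slScale q = g →
        (q.2 : ZMod N) ^ 2 = (g : Matrix (Fin 2) (Fin 2) (ZMod N)).det := by
      intro q hq
      rw [← hq, Matrix.det_fin_two, slScale_apply, slScale_apply, slScale_apply, slScale_apply]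
      have h : q.1 0 0 * q.1 1 1 - q.1 0 1 * q.1 1 0 = 1 := by
        have := q.1.det_coe
        rwa [det_fin_two] at this
      linear_combination -(q.2 : ZMod N) ^ 2 * h
    have : p.2 ^ 2 = p₀.2 ^ 2 := Units.ext (by push_cast; rw [hsq p hp, hsq p₀ hp₀])
    simp [mul_pow, this]
  · intro p hp q hq h
    simp only [Finset.coe_filter, Finset.mem_univ, true_and, Set.mem_ofPred_eq] at hp hq
    have h2 : p.2 = q.2 := mul_right_cancel h
    refine Prod.ext (Matrix.SpecialLinearGroup.ext _ _ fun i j => ?_) h2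
    have := slScale_apply p i j
    rw [hp, ← hq, slScale_apply, h2] at this
    exact (q.2.isUnit.mul_left_injective this).symm

theorem sum_sl_autoCorr_sq_le (hf : IsProjFun f) (hnew : IsNewFun f) :
    ∑ g : SL(2, ZMod N), autoCorr f (Matrix.SpecialLinearGroup.toGL g) ^ 2 ≤
      2 * (N.divisors.card * N * ∑ v, f v ^ 2) ^ 2 := by
  classical
  have ht : (0 : ℝ) < N.totient := by exact_mod_cast Nat.totient_pos.2 (NeZero.pos N)
  have htN : (N.totient : ℝ) ≤ N := by exact_mod_cast Nat.totient_le N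
  have h1 : ∑ p : SL(2, ZMod N) × (ZMod N)ˣ, autoCorr f (slScale p) ^ 2 =
      N.totient * ∑ g : SL(2, ZMod N), autoCorr f (Matrix.SpecialLinearGroup.toGL g) ^ 2 := by
    simp only [autoCorr_slScale hf]
    rw [Fintype.sum_prod_type, Finset.mul_sum]
    simp [ZMod.card_units_eq_totient]
  have h2 : ∑ p : SL(2, ZMod N) × (ZMod N)ˣ, autoCorr f (slScale p) ^ 2 ≤
      (2 * N.divisors.card : ℕ) * ∑ g, autoCorr f g ^ 2 := by
    rw [← Finset.sum_fiberwise Finset.univ slScale, Finset.mul_sum]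
    refine Finset.sum_le_sum fun g _ => ?_
    rw [Finset.sum_congr rfl (g := fun _ => autoCorr f g ^ 2) (fun p hp => by
      rw [(Finset.mem_filter.1 hp).2]), Finset.sum_const, nsmul_eq_mul]
    exact mul_le_mul_of_nonneg_right (by exact_mod_cast card_slScale_fibre_le g) (sq_nonneg _)
  have h3 := sum_autoCorr_sq_le hf hnew
  refine le_of_mul_le_mul_left ?_ ht
  rw [← h1]
  refine h2.trans ((mul_le_mul_of_nonneg_left h3 (Nat.cast_nonneg _)).trans ?_)
  push_cast
  set n2 := ∑ v, f v ^ 2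
  set τ : ℝ := (N.divisors.card : ℝ)
  calc 2 * τ * (τ * (N * (N.totient * n2) ^ 2))
      = N.totient * (2 * (τ ^ 2 * n2 ^ 2 * N)) * N.totient := by ring
    _ ≤ N.totient * (2 * (τ ^ 2 * n2 ^ 2 * N)) * N := by gcongr
    _ = _ := by ring

end Correlations

section EigenvalueBound

/-- The action of `SL(2, ℤ)` on vectors modulo `N`. -/
def modEquiv (N : ℕ) (γ : SL(2, ℤ)) : (Fin 2 → ZMod N) ≃ (Fin 2 → ZMod N) :=
  glEquiv (Matrix.SpecialLinearGroup.toGL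
    (Matrix.SpecialLinearGroup.map (Int.castRingHom (ZMod N)) γ))

theorem modEquiv_mul (N : ℕ) (γ γ' : SL(2, ℤ)) (v : Fin 2 → ZMod N) :
    modEquiv N (γ * γ') v = modEquiv N γ (modEquiv N γ' v) := by
  rw [modEquiv, map_mul, map_mul, glEquiv_mul, modEquiv, modEquiv]

theorem modEquiv_one (N : ℕ) (v : Fin 2 → ZMod N) : modEquiv N 1 v = v := by
  rw [modEquiv, map_one, map_one, glEquiv_apply, Units.val_one, Matrix.one_mulVec]

theorem modEquiv_smul {N : ℕ} (γ : SL(2, ℤ)) (z : ZMod N) (v : Fin 2 → ZMod N) :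
    modEquiv N γ (z • v) = z • modEquiv N γ v := glEquiv_smul _ _ _

theorem isPrim_modEquiv {N : ℕ} {γ : SL(2, ℤ)} {v : Fin 2 → ZMod N} :
    IsPrim (modEquiv N γ v) ↔ IsPrim v := isPrim_glEquiv

theorem modEquiv_apply {N : ℕ} (γ : SL(2, ℤ)) (v : Fin 2 → ZMod N) (i : Fin 2) :
    modEquiv N γ v i = (γ i 0 : ZMod N) * v 0 + (γ i 1 : ZMod N) * v 1 := by
  have : modEquiv N γ v i = ∑ j, ((γ i j : ℤ) : ZMod N) * v j := rfl
  rw [this, Fin.sum_univ_two]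

/-- The symmetric set of steps used to produce a spectral gap. -/
noncomputable def stepBall : Finset SL(2, ℤ) := ball (2 ^ 479)

theorem inv_mem_stepBall (g : SL(2, ℤ)) : g⁻¹ ∈ stepBall ↔ g ∈ stepBall := inv_mem_ball

/-- The sum of the translates of a function by the steps. -/
noncomputable def stepSum {N : ℕ} (f : (Fin 2 → ZMod N) → ℝ) (v : Fin 2 → ZMod N) : ℝ :=
  ∑ h ∈ stepBall, f (modEquiv N h v)

theorem walkSum_eigen {N : ℕ} {f : (Fin 2 → ZMod N) → ℝ} {μ : ℝ}
    (h : ∀ v, stepSum f v = μ * f v) (m : ℕ) (v : Fin 2 → ZMod N) :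
    walkSum stepBall m (fun γ => f (modEquiv N γ v)) = μ ^ m * f v := by
  induction m with
  | zero => simp [walkSum, modEquiv_one]
  | succ m ih =>
    have h1 : ∀ γ, ∑ k ∈ stepBall, f (modEquiv N (k * γ) v) = f (modEquiv N γ v) * μ := by
      intro γ
      simp only [modEquiv_mul]
      rw [mul_comm]
      exact h _
    rw [walkSum, ← walkSum_sum]
    simp only [h1]
    rw [walkSum_mul, ih, pow_succ]
    ring

theorem walkSum_autoCorr_eigen {N : ℕ} [NeZero N] {f : (Fin 2 → ZMod N) → ℝ} {μ : ℝ}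
    (h : ∀ v, stepSum f v = μ * f v) (m : ℕ) :
    walkSum stepBall m (fun γ => autoCorr f (Matrix.SpecialLinearGroup.toGL
      (Matrix.SpecialLinearGroup.map (Int.castRingHom (ZMod N)) γ))) = μ ^ m * ∑ v, f v ^ 2 := by
  simp only [autoCorr]
  rw [walkSum_sum, Finset.mul_sum]
  refine Finset.sum_congr rfl fun v _ => ?_
  rw [walkSum_mul, sq, ← mul_assoc, ← walkSum_eigen h m v]
  rfl

theorem map_eq_one_iff_dvd {N : ℕ} {γ : SL(2, ℤ)}
    (h : Matrix.SpecialLinearGroup.map (Int.castRingHom (ZMod N)) γ = 1) :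
    (N : ℤ) ∣ γ 0 0 - 1 ∧ (N : ℤ) ∣ γ 0 1 ∧ (N : ℤ) ∣ γ 1 0 ∧ (N : ℤ) ∣ γ 1 1 - 1 := by
  have h1 : ∀ i j, ((γ i j : ℤ) : ZMod N) = (1 : Matrix (Fin 2) (Fin 2) (ZMod N)) i j := by
    intro i j
    exact congrArg (fun g : SL(2, ZMod N) => (g : Matrix (Fin 2) (Fin 2) (ZMod N)) i j) h
  have h00 := h1 0 0
  have h01 := h1 0 1
  have h10 := h1 1 0
  have h11 := h1 1 1
  rw [Matrix.one_apply_eq] at h00 h11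
  rw [Matrix.one_apply_ne (by decide)] at h01 h10
  simp only [← ZMod.intCast_zmod_eq_zero_iff_dvd]
  push_cast
  exact ⟨by rw [h00, sub_self], h01, h10, by rw [h11, sub_self]⟩

theorem pow_eigen_le {N : ℕ} (hN : 2 < N) [NeZero N] {f : (Fin 2 → ZMod N) → ℝ} (hf : IsProjFun f)
    (hnew : IsNewFun f) (hf0 : 0 < ∑ v, f v ^ 2) {μ : ℝ}
    (h : ∀ v, stepSum f v = μ * f v) (m : ℕ) {X : ℕ} (hX : X = (2 ^ 480) ^ (m + m)) (hNX : N ≤ X)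
    {D : ℝ} (hD1 : 1 ≤ D) (hD : ∀ n ≠ 0, n ≤ 2 * X ^ 2 → (n.divisors.card : ℝ) ≤ D) :
    μ ^ (m + m) ≤ 2 * (N.divisors.card * N) ^ 2 * ((576600 * 2 ^ 479) ^ (m + m) *
      (D * (48 * X / N ^ 3 + 14 * (1 + Real.log X)))) := by
  classical
  set n2 := ∑ v, f v ^ 2
  have h1 := sq_walkSum_comp_le (Matrix.SpecialLinearGroup.map (Int.castRingHom (ZMod N)))
    inv_mem_stepBall m fun g => autoCorr f (Matrix.SpecialLinearGroup.toGL g)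
  rw [walkSum_autoCorr_eigen h] at h1
  have hnn : ∀ γ : SL(2, ℤ), (0 : ℝ) ≤
      if Matrix.SpecialLinearGroup.map (Int.castRingHom (ZMod N)) γ = 1 then 1 else 0 := by
    intro γ
    split_ifs <;> norm_num
  have h2 := walkSum_ball_le 479 (m + m) hnn
  rw [show (600 * (2 * ((479 : ℕ) : ℝ) + 3)) = 576600 by norm_num] at h2
  have h3 : ∑ γ ∈ ball ((2 ^ (479 + 1)) ^ (m + m)),
      (if Matrix.SpecialLinearGroup.map (Int.castRingHom (ZMod N)) γ = 1 then (1 : ℝ) else 0) *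
        (1 / matNorm γ) ≤ ∑ γ ∈ congrBall N X, 1 / matNorm γ := by
    simp only [ite_mul, one_mul, zero_mul]
    rw [← Finset.sum_filter]
    refine Finset.sum_le_sum_of_subset_of_nonneg ?_ fun γ _ _ => ?_
    · intro γ hγ
      rw [Finset.mem_filter, mem_ball] at hγ
      rw [mem_congrBall]
      refine ⟨?_, map_eq_one_iff_dvd hγ.2⟩
      rw [hX, Nat.cast_pow, Nat.cast_pow, Nat.cast_ofNat]
      exact hγ.1
    · exact one_div_nonneg.2 (matNorm_pos γ).le
  have h4 := h3.trans (sum_congrBall_le hN hNX hD1 hD)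
  have h5 := h2.trans (mul_le_mul_of_nonneg_left h4 (by positivity))
  have h6 := sum_sl_autoCorr_sq_le hf hnew
  have h7 : (μ ^ m * n2) ^ 2 ≤ 2 * (N.divisors.card * N * n2) ^ 2 * ((576600 * 2 ^ 479) ^ (m + m) *
      (D * (48 * X / N ^ 3 + 14 * (1 + Real.log X)))) := by
    refine h1.trans (mul_le_mul h6 h5 ?_ (by positivity))
    have := walkSum_mono stepBall (m + m) hnn
    have h0 : walkSum stepBall (m + m) (fun _ => (0 : ℝ)) = 0 := by
      have := walkSum_mul stepBall (m + m) (fun _ => (0 : ℝ)) 0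
      simpa using this
    rw [h0] at this
    exact this
  refine le_of_mul_le_mul_right ?_ (pow_pos hf0 2)
  calc μ ^ (m + m) * n2 ^ 2 = (μ ^ m * n2) ^ 2 := by rw [pow_add]; ring
    _ ≤ _ := h7
    _ = _ := by ring

theorem le_card_stepBall : (576600 * 2 ^ 479 : ℝ) * 2 ^ 456 ≤ stepBall.card := by
  have h := sq_div_four_le_card_ball (2 ^ 479)
  rw [Nat.cast_pow, Nat.cast_ofNat] at h
  refine le_trans ?_ h
  calc (576600 * 2 ^ 479 : ℝ) * 2 ^ 456 ≤ (2 ^ 21 * 2 ^ 479) * 2 ^ 456 := by gcongr; norm_num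
    _ = 2 ^ 956 := by rw [← pow_add, ← pow_add]
    _ = (2 ^ 479) ^ 2 / 4 := by
      rw [← pow_mul, eq_div_iff (by norm_num), show (4 : ℝ) = 2 ^ 2 by norm_num, ← pow_add]

/-- Large eigenvalues do not occur on new functions of large level. -/
theorem exists_eigen_le_half : ∃ M₀ : ℕ, ∀ N, M₀ ≤ N → ∀ [NeZero N] (f : (Fin 2 → ZMod N) → ℝ),
    IsProjFun f → IsNewFun f → 0 < ∑ v, f v ^ 2 → ∀ μ : ℝ,
    (∀ v, stepSum f v = μ * f v) → μ ≤ stepBall.card / 2 := by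
  obtain ⟨C, hC, hdiv⟩ := card_divisors_pow_le
  have hC1 : (1 : ℝ) ≤ C := by exact_mod_cast hC
  obtain ⟨L, hL⟩ : ∃ L : ℝ, L = 2 ^ 288 := ⟨_, rfl⟩
  have hL0 : 0 < L := hL ▸ by positivity
  set K : ℝ := 4 * C ^ 3 * (48 * L + 14 * 961) with hK
  have hK1 : 1 ≤ K := by
    have : (1 : ℝ) ≤ C ^ 3 := one_le_pow₀ hC1
    rw [hK]
    nlinarith [mul_nonneg (zero_le_one.trans this) hL0.le]
  obtain ⟨M₁, hM₁⟩ := exists_nat_gt (K ^ 3)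
  refine ⟨M₁ + 3, fun N hN _ f hf hnew hf0 μ hμ => ?_⟩
  by_contra! hlt
  set m := Nat.clog (2 ^ 288) N with hm
  obtain ⟨w, hw⟩ : ∃ w : ℝ, w = 2 ^ m := ⟨_, rfl⟩
  have hw1 : 1 ≤ w := hw ▸ one_le_pow₀ (by norm_num)
  have hw0 : 0 < w := by linarith
  have hNw' : N ≤ (2 ^ 288) ^ m := Nat.le_pow_clog (Nat.one_lt_two_pow (by norm_num)) N
  have hNw : (N : ℝ) ≤ w ^ 288 := by
    have : (N : ℝ) ≤ (2 ^ 288) ^ m := by exact_mod_cast hNw'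
    rwa [hw, ← pow_mul, mul_comm, pow_mul]
  have hNw2 : w ^ 288 ≤ L * N := by
    have h1 : (2 ^ 288) ^ (m - 1) < N :=
      Nat.pow_pred_clog_lt_self (Nat.one_lt_two_pow (by norm_num)) (by omega)
    have hm1 : 1 ≤ m := Nat.clog_pos (Nat.one_lt_two_pow (by norm_num)) (by omega)
    have h2 : ((2 ^ 288) ^ (m - 1) : ℝ) ≤ N := by exact_mod_cast h1.le
    calc w ^ 288 = (2 ^ 288) * (2 ^ 288) ^ (m - 1) := by
          rw [← pow_succ', Nat.sub_add_cancel hm1, hw, ← pow_mul, ← pow_mul, mul_comm]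
      _ ≤ L * N := by rw [hL]; exact mul_le_mul_of_nonneg_left h2 (by positivity)
  obtain ⟨X, hX⟩ : ∃ X : ℕ, X = (2 ^ 480) ^ (m + m) := ⟨_, rfl⟩
  have hXw : (X : ℝ) = w ^ 960 := by
    rw [hX, hw, Nat.cast_pow, Nat.cast_pow, Nat.cast_ofNat, ← pow_mul, ← pow_mul]
    congr 1
    ring
  have hN0 : (0 : ℝ) < N := by exact_mod_cast NeZero.pos N
  have hNX : N ≤ X := by
    have : (N : ℝ) ≤ X := hXw ▸ hNw.trans (pow_le_pow_right₀ hw1 (by norm_num))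
    exact_mod_cast this
  have hpow : ∀ (x y : ℝ), 0 ≤ y → x ^ 20 ≤ y ^ 20 → x ≤ y := fun x y hy h =>
    le_of_pow_le_pow_left₀ (by norm_num) hy h
  have hD : ∀ n ≠ 0, n ≤ 2 * X ^ 2 → (n.divisors.card : ℝ) ≤ 2 * C * w ^ 96 := by
    intro n hn hn2
    refine hpow _ _ (by positivity) ?_
    have h1 : (n.divisors.card : ℝ) ^ 20 ≤ C * n := by exact_mod_cast hdiv n hn
    have h2 : (n : ℝ) ≤ 2 * X ^ 2 := by exact_mod_cast hn2
    calc (n.divisors.card : ℝ) ^ 20 ≤ C * (2 * X ^ 2) := h1.trans (by gcongr)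
      _ = (2 * C) * w ^ 1920 := by rw [hXw]; ring
      _ ≤ (2 * C) ^ 20 * w ^ 1920 := by
          gcongr
          exact le_self_pow₀ (by linarith) (by norm_num)
      _ = _ := by ring
  have hτ : (N.divisors.card : ℝ) ≤ C * w ^ 15 := by
    refine hpow _ _ (by positivity) ?_
    have h1 : (N.divisors.card : ℝ) ^ 20 ≤ C * N := by exact_mod_cast hdiv N (NeZero.ne N)
    calc (N.divisors.card : ℝ) ^ 20 ≤ C * w ^ 288 := h1.trans (by gcongr)
      _ ≤ C ^ 20 * w ^ 300 := by
          gcongr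
          · exact le_self_pow₀ hC1 (by norm_num)
          · norm_num
      _ = _ := by ring
  have hlog : 1 + Real.log X ≤ 961 * w := by
    rw [hXw, Real.log_pow]
    have := Real.log_le_self hw0.le
    push_cast
    linarith
  have key := pow_eigen_le (by omega) hf hnew hf0 hμ m hX hNX
    (by nlinarith [one_le_pow₀ hw1 (n := 96)]) hD
  set ρ : ℝ := 576600 * 2 ^ 479 with hρ
  have hρ0 : 0 < ρ := by positivity
  have hw912 : ((2 : ℝ) ^ 456) ^ (m + m) = w ^ 912 := by
    rw [hw, ← pow_mul, ← pow_mul]; congr 1; ring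
  have hlow : ρ ^ (m + m) * w ^ 912 ≤ μ ^ (m + m) * w ^ 2 := by
    rw [← hw912, ← mul_pow, show w ^ 2 = 2 ^ (m + m) by rw [hw, ← pow_mul]; congr 1; ring,
      ← mul_pow]
    refine pow_le_pow_left₀ (by positivity) (le_card_stepBall.trans ?_) _
    linarith
  have hE : w ^ 912 ≤ 2 * (N.divisors.card * N) ^ 2 * (2 * C * w ^ 96 *
      (48 * X / N ^ 3 + 14 * (1 + Real.log X))) * w ^ 2 := by
    refine le_of_mul_le_mul_left ?_ (pow_pos hρ0 (m + m))
    refine hlow.trans ((mul_le_mul_of_nonneg_right key (by positivity)).trans (le_of_eq ?_))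
    ring
  have hE2 : w ^ 912 ≤ K * w ^ 800 := by
    refine hE.trans ?_
    have e1 : (N : ℝ) ^ 2 * (48 * X / N ^ 3) ≤ 48 * L * w ^ 672 := by
      have : (N : ℝ) ^ 2 * (48 * X / N ^ 3) = 48 * X / N := by field_simp
      rw [this, div_le_iff₀ hN0, hXw]
      calc 48 * w ^ 960 = 48 * w ^ 672 * w ^ 288 := by ring
        _ ≤ 48 * w ^ 672 * (L * N) := by gcongr
        _ = _ := by ring
    have e2 : (N : ℝ) ^ 2 * (14 * (1 + Real.log X)) ≤ 14 * 961 * w ^ 672 := by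
      calc (N : ℝ) ^ 2 * (14 * (1 + Real.log X)) ≤ (w ^ 288) ^ 2 * (14 * (961 * w)) := by gcongr
        _ = 14 * 961 * w ^ 577 := by ring
        _ ≤ _ := by gcongr; norm_num
    calc 2 * (N.divisors.card * N) ^ 2 * (2 * C * w ^ 96 *
          (48 * X / N ^ 3 + 14 * (1 + Real.log X))) * w ^ 2
        = 4 * C * (N.divisors.card : ℝ) ^ 2 * w ^ 98 * ((N : ℝ) ^ 2 * (48 * X / N ^ 3) +
          (N : ℝ) ^ 2 * (14 * (1 + Real.log X))) := by ring
      _ ≤ 4 * C * (C * w ^ 15) ^ 2 * w ^ 98 * (48 * L * w ^ 672 + 14 * 961 * w ^ 672) := by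
          gcongr
      _ = K * w ^ 800 := by rw [hK]; ring
  have hE3 : w ^ 112 ≤ K := by
    refine le_of_mul_le_mul_right ?_ (pow_pos hw0 800)
    rwa [← pow_add]
  have : (N : ℝ) ≤ K ^ 3 := by
    calc (N : ℝ) ≤ w ^ 288 := hNw
      _ ≤ w ^ 336 := pow_le_pow_right₀ hw1 (by norm_num)
      _ = (w ^ 112) ^ 3 := by ring
      _ ≤ K ^ 3 := by gcongr
  have h2 : (M₁ : ℝ) ≤ N := by exact_mod_cast (by omega : M₁ ≤ N)
  linarith

end EigenvalueBound

section Descent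

variable {N : ℕ} {f : (Fin 2 → ZMod N) → ℝ}

theorem isProjFun_modEquiv (hf : IsProjFun f) (γ : SL(2, ℤ)) :
    IsProjFun fun v => f (modEquiv N γ v) where
  eq_zero v hv := hf.eq_zero _ fun h => hv (isPrim_modEquiv.1 h)
  smul z v := by rw [modEquiv_smul, hf.smul]

theorem isProjFun_stepSum (hf : IsProjFun f) : IsProjFun (stepSum f) where
  eq_zero v hv := Finset.sum_eq_zero fun γ _ => (isProjFun_modEquiv hf γ).eq_zero v hv
  smul z v := Finset.sum_congr rfl fun γ _ => (isProjFun_modEquiv hf γ).smul z v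

theorem vred_modEquiv {M : ℕ} (h : M ∣ N) (γ : SL(2, ℤ)) (v : Fin 2 → ZMod N) :
    vred h (modEquiv N γ v) = modEquiv M γ (vred h v) := by
  ext i
  rw [modEquiv_apply, vred, modEquiv_apply, map_add, map_mul, map_mul, map_intCast, map_intCast]
  rfl

theorem vred_smul {M : ℕ} (h : M ∣ N) (z : ZMod N) (v : Fin 2 → ZMod N) :
    vred h (z • v) = ZMod.castHom h (ZMod M) z • vred h v := by
  ext i
  exact map_mul _ _ _

theorem vred_vred {M L : ℕ} (h : M ∣ N) (h' : L ∣ M) (v : Fin 2 → ZMod N) :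
    vred h' (vred h v) = vred (h'.trans h) v := by
  ext i
  exact congrArg (fun φ : ZMod N →+* ZMod L => φ (v i)) (Subsingleton.elim
    ((ZMod.castHom h' (ZMod L)).comp (ZMod.castHom h (ZMod M))) _)

variable [NeZero N]

theorem IsPrim.exists_modEquiv_eq_smul {v : Fin 2 → ZMod N} (hv : IsPrim v) :
    ∃ (γ : SL(2, ℤ)) (z : (ZMod N)ˣ), modEquiv N γ v = (z : ZMod N) • ![1, 0] := by
  obtain ⟨z', hz'⟩ := ZMod.exists_unit_mul_gcd (v 1)
  set d := (v 1).val.gcd N with hd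
  have hcop : IsCoprime (v 0) (d : ZMod N) := by
    obtain ⟨s, t, h⟩ := hv
    exact ⟨s, t * z', by linear_combination h - t * hz'⟩
  obtain ⟨z, y, hy⟩ := ZMod.exists_unit_add_mul (Nat.gcd_dvd_right _ _ : d ∣ N) hcop
  obtain ⟨k, hk⟩ := ZMod.intCast_surjective (-(y * ((z'⁻¹ : (ZMod N)ˣ) : ZMod N)))
  obtain ⟨l, hl⟩ := ZMod.intCast_surjective (-(v 1 * ((z⁻¹ : (ZMod N)ˣ) : ZMod N)))
  have h0 : ∀ w, modEquiv N (slMk 1 k 0 1 (by ring)) w = ![w 0 + k * w 1, w 1] := by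
    intro w
    ext i
    rw [modEquiv_apply]
    fin_cases i <;> simp [slMk]
  have h1 : ∀ w, modEquiv N (slMk 1 0 l 1 (by ring)) w = ![w 0, l * w 0 + w 1] := by
    intro w
    ext i
    rw [modEquiv_apply]
    fin_cases i <;> simp [slMk]
  have e0 : v 0 + k * v 1 = z := by
    rw [hk]
    linear_combination hy - y * ((z'⁻¹ : (ZMod N)ˣ) : ZMod N) * hz' - y * d * z'.inv_mul
  refine ⟨slMk 1 0 l 1 (by ring) * slMk 1 k 0 1 (by ring), z, ?_⟩
  rw [modEquiv_mul, h0, h1]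
  ext i
  fin_cases i
  · simpa using e0
  · simp only [Fin.mk_one, Matrix.cons_val_one, Matrix.cons_val_zero, Pi.smul_apply,
      Matrix.cons_val_fin_one, smul_eq_mul, mul_zero]
    rw [e0, hl]
    linear_combination -v 1 * z.inv_mul

theorem sum_stepSum (f : (Fin 2 → ZMod N) → ℝ) :
    ∑ v, stepSum f v = stepBall.card * ∑ v, f v := by
  simp only [stepSum]
  rw [Finset.sum_comm, Finset.sum_congr rfl fun γ _ => (modEquiv N γ).sum_comp f]
  simp

theorem pushforward_modEquiv {M : ℕ} (h : M ∣ N) (γ : SL(2, ℤ)) (v : Fin 2 → ZMod M) :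
    pushforward h (fun w => f (modEquiv N γ w)) v = pushforward h f (modEquiv M γ v) := by
  refine Fintype.sum_equiv (modEquiv N γ) _ _ fun w => ?_
  simp only [vred_modEquiv, EmbeddingLike.apply_eq_iff_eq]

theorem pushforward_stepSum {M : ℕ} (h : M ∣ N) (v : Fin 2 → ZMod M) :
    pushforward h (stepSum f) v = stepSum (pushforward h f) v := by
  simp only [stepSum, ← pushforward_modEquiv]
  simp only [pushforward]
  rw [Finset.sum_comm]
  refine Finset.sum_congr rfl fun w _ => ?_
  split_ifs
  · rfl
  · simp

theorem isProjFun_pushforward (hf : IsProjFun f) {M : ℕ} [NeZero M] (h : M ∣ N) :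
    IsProjFun (pushforward h f) where
  eq_zero v hv := by
    refine Finset.sum_eq_zero fun w _ => ?_
    rw [ite_eq_right_iff]
    rintro rfl
    exact hf.eq_zero w fun hw => hv (hw.map _)
  smul z v := by
    obtain ⟨z', rfl⟩ := ZMod.unitsMap_surjective h z
    have hz : ((ZMod.unitsMap h z' : (ZMod M)ˣ) : ZMod M) = ZMod.castHom h (ZMod M) z' := rfl
    have hinj : ∀ u u' : Fin 2 → ZMod M, (ZMod.unitsMap h z' : ZMod M) • u =
        (ZMod.unitsMap h z' : ZMod M) • u' ↔ u = u' := fun u u' =>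
      (MulAction.injective (ZMod.unitsMap h z')).eq_iff
    refine (Fintype.sum_equiv (MulAction.toPerm z') _ _ fun w => ?_).symm
    rw [MulAction.toPerm_apply, Units.smul_def, vred_smul, ← hz, hf.smul]
    simp only [hinj]

theorem pushforward_pushforward {M L : ℕ} [NeZero M] (h : M ∣ N) (h' : L ∣ M)
    (v : Fin 2 → ZMod L) :
    pushforward h' (pushforward h f) v = pushforward (h'.trans h) f v := by
  simp only [pushforward, ← vred_vred h h']
  have hu : ∀ u, (if vred h' u = v then ∑ w, if vred h w = u then f w else 0 else 0) =
      ∑ w, if vred h w = u then (if vred h' (vred h w) = v then f w else 0) else 0 := by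
    intro u
    split_ifs with hv
    · refine Finset.sum_congr rfl fun w _ => ?_
      by_cases hw : vred h w = u <;> simp [hw, hv]
    · refine (Finset.sum_eq_zero fun w _ => ?_).symm
      by_cases hw : vred h w = u <;> simp [hw, hv]
  rw [Finset.sum_congr rfl fun u _ => hu u, Finset.sum_comm]
  simp

theorem pushforward_self (v : Fin 2 → ZMod N) : pushforward dvd_rfl f v = f v := by
  simp [pushforward, vred_self]

/-- An eigenfunction of mean zero comes from a new eigenfunction of some level at least two. -/
theorem exists_isNewFun (hf : IsProjFun f) (h0 : ∑ v, f v = 0) (hne : f ≠ 0) {μ : ℝ}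
    (hμ : ∀ v, stepSum f v = μ * f v) :
    ∃ (M : ℕ) (_ : NeZero M) (g : (Fin 2 → ZMod M) → ℝ), IsProjFun g ∧ IsNewFun g ∧
      ∑ v, g v = 0 ∧ g ≠ 0 ∧ ∀ v, stepSum g v = μ * g v := by
  classical
  have hex : ∃ M, ∃ h : M ∣ N, pushforward h f ≠ 0 :=
    ⟨N, dvd_rfl, fun h => hne (by ext v; rw [← pushforward_self (f := f) v, h])⟩
  obtain ⟨h, hM⟩ := Nat.find_spec hex
  have hmin := fun {L} => Nat.find_min hex (m := L)
  set M := Nat.find hex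
  have : NeZero M := ⟨fun h0 => NeZero.ne N (Nat.eq_zero_of_zero_dvd (h0 ▸ h))⟩
  refine ⟨M, this, pushforward h f, isProjFun_pushforward hf h, ?_, ?_, hM, ?_⟩
  · intro L hL hlt v
    rw [pushforward_pushforward]
    have := hmin hlt
    push Not at this
    rw [this (hL.trans h)]
    rfl
  · simp only [pushforward]
    rw [Finset.sum_comm]
    simpa using h0
  · intro v
    rw [← pushforward_stepSum]
    simp only [pushforward, hμ, Finset.mul_sum, mul_ite, mul_zero]

/-- An eigenvalue of a nonzero function of mean zero is not the trivial one. -/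
theorem eigen_lt_card (hf : IsProjFun f) (h0 : ∑ v, f v = 0) (hne : f ≠ 0) {μ : ℝ}
    (hμ : ∀ v, stepSum f v = μ * f v) : μ < stepBall.card := by
  by_contra! hle
  obtain ⟨v, -, hv⟩ := Finset.exists_max_image Finset.univ f Finset.univ_nonempty
  have hpos : 0 < f v := by
    by_contra! hneg
    exact hne ((Fintype.sum_eq_zero_iff_of_nonpos fun w => (hv w (Finset.mem_univ _)).trans hneg).1
      h0)
  have hstep : ∀ w, f w = f v → ∀ h ∈ stepBall, f (modEquiv N h w) = f v := by
    intro w hw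
    have h1 : ∑ h ∈ stepBall, (f v - f (modEquiv N h w)) ≤ 0 := by
      have := hμ w
      rw [stepSum, hw] at this
      rw [Finset.sum_sub_distrib, this, Finset.sum_const, nsmul_eq_mul]
      nlinarith
    have h2 : ∀ h ∈ stepBall, 0 ≤ f v - f (modEquiv N h w) := fun h _ =>
      sub_nonneg.2 (hv _ (Finset.mem_univ _))
    have h3 := (Finset.sum_eq_zero_iff_of_nonneg h2).1 (le_antisymm h1 (Finset.sum_nonneg h2))
    intro h hh
    linarith [h3 h hh]
  have hall : ∀ γ : SL(2, ℤ), ∀ w, f w = f v → f (modEquiv N γ w) = f v := by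
    intro γ
    have hγ : γ ∈ Subgroup.closure {ModularGroup.S, ModularGroup.T} := by
      rw [_root_.SpecialLinearGroup.SL2Z_generators]; trivial
    have hmem : ∀ x ∈ ({ModularGroup.S, ModularGroup.T} : Set SL(2, ℤ)), x ∈ stepBall := by
      have hb : ∀ x : SL(2, ℤ), matNorm x ≤ 1 → x ∈ stepBall := fun x hx =>
        mem_ball.2 (hx.trans (one_le_pow₀ (by norm_num)))
      rintro x (rfl | rfl)
      · refine hb _ (matNorm_le_iff.2 fun i j => ?_)
        fin_cases i <;> fin_cases j <;> simp [ModularGroup.coe_S]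
      · refine hb _ (matNorm_le_iff.2 fun i j => ?_)
        fin_cases i <;> fin_cases j <;> simp [ModularGroup.coe_T]
    induction hγ using Subgroup.closure_induction'' with
    | mem x hx => exact fun w hw => hstep w hw x (hmem x hx)
    | inv_mem x hx => exact fun w hw => hstep w hw _ ((inv_mem_stepBall x).2 (hmem x hx))
    | one => intro w hw; rwa [modEquiv_one]
    | mul x y _ _ hx hy =>
      intro w hw
      rw [modEquiv_mul]
      exact hx _ (hy w hw)
  have hvp : IsPrim v := by
    by_contra h
    exact hpos.ne' (hf.eq_zero v h)
  obtain ⟨γ, z, hγ⟩ := hvp.exists_modEquiv_eq_smul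
  have he : f ![1, 0] = f v := by
    rw [← hf.smul z, ← hγ]
    exact hall γ v rfl
  have hnn : ∀ w, 0 ≤ f w := by
    intro w
    by_cases hw : IsPrim w
    · obtain ⟨γ', z', hγ'⟩ := hw.exists_modEquiv_eq_smul
      have : f (modEquiv N γ'⁻¹ ((z' : ZMod N) • ![1, 0])) = f v :=
        hall _ _ (by rw [hf.smul, he])
      rw [← hγ', ← modEquiv_mul, inv_mul_cancel, modEquiv_one] at this
      rw [this]
      exact hpos.le
    · rw [hf.eq_zero w hw]
  exact hpos.ne' (congrFun ((Fintype.sum_eq_zero_iff_of_nonneg hnn).1 h0) v)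

end Descent

section SpectralGap

/-- The operator `stepSum` on Euclidean space. -/
noncomputable def stepLin (N : ℕ) :
    EuclideanSpace ℝ (Fin 2 → ZMod N) →ₗ[ℝ] EuclideanSpace ℝ (Fin 2 → ZMod N) where
  toFun f := WithLp.toLp 2 (stepSum f)
  map_add' f g := by
    ext v
    simp [stepSum, Finset.sum_add_distrib]
  map_smul' c f := by
    ext v
    simp [stepSum, Finset.mul_sum]

theorem stepLin_apply {N : ℕ} (f : EuclideanSpace ℝ (Fin 2 → ZMod N)) (v : Fin 2 → ZMod N) :
    stepLin N f v = stepSum f v := rfl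

variable {N : ℕ} [NeZero N]

/-- The projective functions of mean zero. -/
def meanZero (N : ℕ) [NeZero N] : Submodule ℝ (EuclideanSpace ℝ (Fin 2 → ZMod N)) where
  carrier := {f | IsProjFun f ∧ ∑ v, f v = 0}
  add_mem' {f g} hf hg := by
    refine ⟨⟨fun v hv => ?_, fun z v => ?_⟩, ?_⟩
    · simp [hf.1.eq_zero v hv, hg.1.eq_zero v hv]
    · simp [hf.1.smul z v, hg.1.smul z v]
    · simp [Finset.sum_add_distrib, hf.2, hg.2]
  zero_mem' := ⟨⟨fun v hv => rfl, fun z v => rfl⟩, by simp⟩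
  smul_mem' c f hf := by
    refine ⟨⟨fun v hv => ?_, fun z v => ?_⟩, ?_⟩
    · simp [hf.1.eq_zero v hv]
    · simp [hf.1.smul z v]
    · simp [← Finset.mul_sum, hf.2]

theorem stepLin_mem_meanZero {f : EuclideanSpace ℝ (Fin 2 → ZMod N)} (hf : f ∈ meanZero N) :
    stepLin N f ∈ meanZero N :=
  ⟨isProjFun_stepSum hf.1, by simp only [stepLin_apply, sum_stepSum, hf.2, mul_zero]⟩

theorem sum_stepSum_mul (f g : (Fin 2 → ZMod N) → ℝ) :
    ∑ v, stepSum f v * g v = ∑ v, f v * stepSum g v := by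
  simp only [stepSum, Finset.sum_mul, Finset.mul_sum]
  rw [Finset.sum_comm, Finset.sum_comm (s := Finset.univ)]
  refine Finset.sum_nbij' (·⁻¹) (·⁻¹) (fun γ h => (inv_mem_stepBall γ).2 h)
    (fun γ h => (inv_mem_stepBall γ).2 h) (fun γ _ => inv_inv γ) (fun γ _ => inv_inv γ)
    fun γ _ => Fintype.sum_equiv (modEquiv N γ) _ _ fun v => ?_
  rw [← modEquiv_mul, inv_mul_cancel, modEquiv_one]

theorem stepLin_isSymmetric : (stepLin N).IsSymmetric := by
  intro f g
  simp only [PiLp.inner_apply, stepLin_apply, RCLike.inner_apply, conj_trivial]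
  simpa only [mul_comm] using sum_stepSum_mul f g

theorem LinearMap.IsSymmetric.inner_le_of_eigenvalue_le {E : Type*} [NormedAddCommGroup E]
    [InnerProductSpace ℝ E] [FiniteDimensional ℝ E] {T : E →ₗ[ℝ] E} (hT : T.IsSymmetric) {β : ℝ}
    (hβ : ∀ μ, Module.End.HasEigenvalue T μ → μ ≤ β) (x : E) :
    inner ℝ (T x) x ≤ β * ‖x‖ ^ 2 := by
  set b := hT.eigenvectorBasis rfl
  rw [← b.sum_inner_mul_inner, ← b.sum_sq_norm_inner_right, Finset.mul_sum]
  refine Finset.sum_le_sum fun i _ => ?_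
  rw [hT, hT.apply_eigenvectorBasis, inner_smul_right, ← real_inner_comm, mul_assoc,
    Real.norm_eq_abs, sq_abs, ← sq]
  exact mul_le_mul_of_nonneg_right (hβ _ (hT.hasEigenvalue_eigenvalues rfl i)) (sq_nonneg _)

theorem exists_eigenvalue_bound : ∃ β : ℝ, β < stepBall.card ∧
    ∀ N, ∀ [NeZero N] (f : (Fin 2 → ZMod N) → ℝ), IsProjFun f → ∑ v, f v = 0 → f ≠ 0 →
      ∀ μ : ℝ, (∀ v, stepSum f v = μ * f v) → μ ≤ β := by
  obtain ⟨M₀, hM₀⟩ := exists_eigen_le_half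
  set E : ℕ → Set ℝ := fun M => {μ | ∃ (_ : NeZero M) (f : (Fin 2 → ZMod M) → ℝ), IsProjFun f ∧
    ∑ v, f v = 0 ∧ f ≠ 0 ∧ ∀ v, stepSum f v = μ * f v}
  have hfin : ∀ M, (E M).Finite := by
    intro M
    by_cases hM : M = 0
    · refine Set.finite_empty.subset ?_
      rintro μ ⟨h, -⟩
      exact h.out hM
    have : NeZero M := ⟨hM⟩
    refine (Module.End.finite_hasEigenvalue (stepLin M)).subset ?_
    rintro μ ⟨-, f, -, -, hne, hμ⟩
    refine Module.End.hasEigenvalue_of_hasEigenvector (x := WithLp.toLp 2 f) ⟨?_, ?_⟩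
    · rw [Module.End.mem_eigenspace_iff]
      ext v
      exact hμ v
    · simpa using hne
  have hpos : 0 < (stepBall.card : ℝ) := lt_of_lt_of_le (by positivity) le_card_stepBall
  obtain ⟨β, hβ, hmax⟩ := Set.exists_max_image
    (insert ((stepBall.card : ℝ) / 2) (⋃ M ∈ Finset.range M₀, E M)) id
    ((Set.Finite.biUnion (Finset.finite_toSet _) fun M _ => hfin M).insert _) ⟨_, Or.inl rfl⟩
  refine ⟨β, ?_, fun N _ f hf h0 hne μ hμ => ?_⟩
  · obtain rfl | h := hβ
    · exact half_lt_self hpos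
    · obtain ⟨M, -, h⟩ := Set.mem_iUnion₂.1 h
      obtain ⟨_, f, hf, h0, hne, hμ⟩ := h
      exact eigen_lt_card hf h0 hne hμ
  · obtain ⟨M, _, g, hg, hnew, hg0, hgne, hgμ⟩ := exists_isNewFun hf h0 hne hμ
    by_cases hM : M < M₀
    · exact hmax μ (Or.inr (Set.mem_iUnion₂.2 ⟨M, Finset.mem_range.2 hM, _, g, hg, hg0, hgne, hgμ⟩))
    · refine le_trans ?_ (hmax _ (Or.inl rfl))
      refine hM₀ M (not_lt.1 hM) g hg hnew ?_ μ hgμ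
      refine lt_of_le_of_ne (Finset.sum_nonneg fun v _ => sq_nonneg _) fun h => hgne ?_
      ext v
      simpa using (Finset.sum_eq_zero_iff_of_nonneg fun v _ => sq_nonneg (g v)).1 h.symm v
        (Finset.mem_univ v)

/-- The operator `stepSum` has a spectral gap on functions of mean zero, uniformly in the level. -/
theorem exists_sum_stepSum_mul_le : ∃ β : ℝ, β < stepBall.card ∧
    ∀ N, ∀ [NeZero N] (f : (Fin 2 → ZMod N) → ℝ), IsProjFun f → ∑ v, f v = 0 →
      ∑ v, stepSum f v * f v ≤ β * ∑ v, f v ^ 2 := by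
  obtain ⟨β, hβ, h⟩ := exists_eigenvalue_bound
  refine ⟨β, hβ, fun N _ f hf h0 => ?_⟩
  have hmaps : ∀ f ∈ meanZero N, stepLin N f ∈ meanZero N := fun f hf => stepLin_mem_meanZero hf
  have hsymm := (stepLin_isSymmetric (N := N)).restrict_invariant hmaps
  have := hsymm.inner_le_of_eigenvalue_le (β := β) (fun μ hμ => ?_) ⟨WithLp.toLp 2 f, hf, h0⟩
  · rw [Submodule.coe_inner, Submodule.coe_norm, EuclideanSpace.norm_sq_eq] at this
    simp only [PiLp.inner_apply, RCLike.inner_apply, conj_trivial, Real.norm_eq_abs, sq_abs,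
      LinearMap.coe_restrict_apply, stepLin_apply] at this
    simpa only [mul_comm] using this
  · obtain ⟨g, hg, hne⟩ := hμ.exists_hasEigenvector
    rw [Module.End.mem_eigenspace_iff] at hg
    refine h N g.1 g.2.1 g.2.2 (fun h0 => hne ?_) μ fun v => ?_
    · ext v
      exact congrFun h0 v
    · exact congrFun (congrArg (fun f : meanZero N => (f.1 : (Fin 2 → ZMod N) → ℝ)) hg) v

end SpectralGap

section Deviation

variable {N : ℕ} [NeZero N]

/-- The squared distance between a function and its translate. -/
def dev (f : (Fin 2 → ZMod N) → ℝ) (γ : SL(2, ℤ)) : ℝ :=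
  ∑ v, (f (modEquiv N γ v) - f v) ^ 2

theorem dev_nonneg (f : (Fin 2 → ZMod N) → ℝ) (γ : SL(2, ℤ)) : 0 ≤ dev f γ :=
  Finset.sum_nonneg fun _ _ => sq_nonneg _

theorem dev_mul_le (f : (Fin 2 → ZMod N) → ℝ) (γ γ' : SL(2, ℤ)) :
    dev f (γ * γ') ≤ 2 * dev f γ + 2 * dev f γ' := by
  have h : dev f γ = ∑ v, (f (modEquiv N (γ * γ') v) - f (modEquiv N γ' v)) ^ 2 := by
    refine (Fintype.sum_equiv (modEquiv N γ') _ _ fun v => ?_).symm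
    rw [modEquiv_mul]
  rw [h]
  simp only [dev, Finset.mul_sum, ← Finset.sum_add_distrib]
  refine Finset.sum_le_sum fun v _ => ?_
  nlinarith [sq_nonneg (f (modEquiv N (γ * γ') v) - 2 * f (modEquiv N γ' v) + f v)]

theorem dev_inv (f : (Fin 2 → ZMod N) → ℝ) (γ : SL(2, ℤ)) : dev f γ⁻¹ = dev f γ := by
  refine Fintype.sum_equiv (modEquiv N γ⁻¹) _ _ fun v => ?_
  rw [← modEquiv_mul, mul_inv_cancel, modEquiv_one, ← neg_sq, neg_sub]

/-- The matrix `[[-1, 4], [-1, 3]]`, which generates `SL(2, ℤ)` together with `T`. -/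
def genU : SL(2, ℤ) := slMk (-1) 4 (-1) 3 (by ring)

theorem closure_T_genU : Subgroup.closure {ModularGroup.T, genU} = ⊤ := by
  rw [← top_le_iff, ← _root_.SpecialLinearGroup.SL2Z_generators, Subgroup.closure_le]
  have hT : ModularGroup.T ∈ Subgroup.closure {ModularGroup.T, genU} :=
    Subgroup.subset_closure (Or.inl rfl)
  have hU : genU ∈ Subgroup.closure {ModularGroup.T, genU} :=
    Subgroup.subset_closure (Or.inr rfl)
  have h : ModularGroup.T = genU * ModularGroup.T * ModularGroup.T * ModularGroup.T *
      ModularGroup.S := by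
    decide
  rintro x (rfl | rfl)
  · rw [SetLike.mem_coe, ← Subgroup.mul_mem_cancel_left _
      (mul_mem (mul_mem (mul_mem hU hT) hT) hT), ← h]
    exact hT
  · exact hT

theorem exists_dev_le (γ : SL(2, ℤ)) : ∃ K : ℝ, 0 ≤ K ∧ ∀ N, ∀ [NeZero N]
    (f : (Fin 2 → ZMod N) → ℝ), dev f γ ≤ K * (dev f ModularGroup.T + dev f genU) := by
  have hγ : γ ∈ Subgroup.closure {ModularGroup.T, genU} := by
    rw [closure_T_genU]
    trivial
  induction hγ using Subgroup.closure_induction with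
  | mem x hx =>
    refine ⟨1, zero_le_one, fun N _ f => ?_⟩
    rw [one_mul]
    obtain rfl | rfl := hx
    · exact le_add_of_nonneg_right (dev_nonneg _ _)
    · exact le_add_of_nonneg_left (dev_nonneg _ _)
  | one => exact ⟨0, le_rfl, fun N _ f => by simp [dev, modEquiv_one]⟩
  | mul x y _ _ hx hy =>
    obtain ⟨K, hK, hx⟩ := hx
    obtain ⟨L, hL, hy⟩ := hy
    refine ⟨2 * K + 2 * L, by positivity, fun N _ f => ?_⟩
    linarith [dev_mul_le f x y, hx N f, hy N f]
  | inv x _ hx =>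
    obtain ⟨K, hK, hx⟩ := hx
    exact ⟨K, hK, fun N _ f => by rw [dev_inv]; exact hx N f⟩

theorem sum_dev (f : (Fin 2 → ZMod N) → ℝ) :
    ∑ γ ∈ stepBall, dev f γ =
      2 * stepBall.card * ∑ v, f v ^ 2 - 2 * ∑ v, stepSum f v * f v := by
  have h : ∀ γ, dev f γ = 2 * ∑ v, f v ^ 2 - 2 * ∑ v, f (modEquiv N γ v) * f v := by
    intro γ
    have h1 : ∑ v, f (modEquiv N γ v) ^ 2 = ∑ v, f v ^ 2 :=
      (modEquiv N γ).sum_comp fun v => f v ^ 2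
    simp only [dev, sub_sq, Finset.sum_add_distrib, Finset.sum_sub_distrib, h1, mul_assoc,
      ← Finset.mul_sum]
    ring
  simp only [h, Finset.sum_sub_distrib, ← Finset.mul_sum, stepSum, Finset.sum_mul]
  rw [Finset.sum_const, nsmul_eq_mul, Finset.sum_comm (s := stepBall)]
  ring

/-- Two elements already have a uniform spectral gap. -/
theorem exists_le_dev : ∃ c : ℝ, 0 < c ∧ ∀ N, ∀ [NeZero N] (f : (Fin 2 → ZMod N) → ℝ),
    IsProjFun f → ∑ v, f v = 0 →
      c * ∑ v, f v ^ 2 ≤ dev f ModularGroup.T + dev f genU := by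
  obtain ⟨β, hβ, h⟩ := exists_sum_stepSum_mul_le
  choose K hK hdev using exists_dev_le
  have hS : 0 ≤ ∑ γ ∈ stepBall, K γ := Finset.sum_nonneg fun γ _ => hK γ
  refine ⟨2 * (stepBall.card - β) / (1 + ∑ γ ∈ stepBall, K γ), div_pos (by linarith)
    (by linarith), fun N _ f hf h0 => ?_⟩
  rw [div_mul_eq_mul_div, div_le_iff₀ (by linarith)]
  have h1 := Finset.sum_le_sum fun γ (_ : γ ∈ stepBall) => hdev γ N f
  rw [sum_dev, ← Finset.sum_mul] at h1
  nlinarith [h N f hf h0, dev_nonneg f ModularGroup.T, dev_nonneg f genU]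

end Deviation

section RandomWords

/-- The matrix `A ^ k * D` as an element of `SL(2, ℤ)`. -/
def letter (k : ℕ) : SL(2, ℤ) := ModularGroup.T ^ k * slMk 1 0 1 1 (by ring)

theorem coe_letter (k : ℕ) :
    (letter k : Matrix (Fin 2) (Fin 2) ℤ) = matA ^ k * matD := by
  rw [letter, Matrix.SpecialLinearGroup.coe_mul, Matrix.SpecialLinearGroup.coe_pow]
  rfl

/-- The product of the letters of a word. -/
def wordProd (l : List ℕ) : SL(2, ℤ) := (l.map letter).prod

theorem coe_wordProd (l : List ℕ) : (wordProd l : Matrix (Fin 2) (Fin 2) ℤ) =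
    (l.map fun k => matA ^ k * matD).prod := by
  induction l with
  | nil => rfl
  | cons k l ih =>
    rw [wordProd, List.map_cons, List.prod_cons, Matrix.SpecialLinearGroup.coe_mul,
      List.map_cons, List.prod_cons, ← ih, coe_letter]
    rfl

theorem matA_pow_mul_matD_mulVec (k : ℕ) (x y : ℤ) :
    (matA ^ k * matD) *ᵥ ![x, y] = ![x + k * (x + y), x + y] := by
  have h : matA ^ k = !![1, (k : ℤ); 0, 1] := by
    induction k with
    | zero => ext i j; fin_cases i <;> fin_cases j <;> rfl
    | succ k ih => rw [pow_succ, ih, matA]; ext i j; fin_cases i <;> fin_cases j <;> simp [add_comm]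
  rw [h, matD]
  ext i
  fin_cases i <;> simp [Matrix.mulVec, dotProduct, Fin.sum_univ_two]
  ring

theorem exists_wordProd_mulVec (l : List ℕ) : ∃ q p : ℕ, 0 < q ∧ (l ≠ [] → 0 < p) ∧
    q.gcd p = 1 ∧ (wordProd l : Matrix (Fin 2) (Fin 2) ℤ) *ᵥ ![1, 0] = ![(q : ℤ), (p : ℤ)] := by
  rw [coe_wordProd]
  induction l with
  | nil => exact ⟨1, 0, one_pos, fun h => absurd rfl h, rfl, by simp⟩
  | cons k l ih =>
    obtain ⟨q, p, hq, -, hgcd, h⟩ := ih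
    refine ⟨q + k * (q + p), q + p, by positivity, fun _ => by positivity, ?_, ?_⟩
    · rw [Nat.gcd_add_mul_right_left, Nat.gcd_self_add_right, hgcd]
    · rw [List.map_cons, List.prod_cons, ← Matrix.mulVec_mulVec, h, matA_pow_mul_matD_mulVec]
      push_cast
      rfl

theorem modEquiv_e (N : ℕ) (γ : SL(2, ℤ)) {x y : ℤ}
    (h : (γ : Matrix (Fin 2) (Fin 2) ℤ) *ᵥ ![1, 0] = ![x, y]) :
    modEquiv N γ ![1, 0] = ![(x : ZMod N), (y : ZMod N)] := by
  ext i
  have := congrFun h i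
  rw [modEquiv_apply]
  fin_cases i <;> simp_all [Matrix.mulVec, dotProduct, Fin.sum_univ_two]

variable {N : ℕ}

/-- The average of a function over the translates by the two letters. -/
noncomputable def avgStep (f : (Fin 2 → ZMod N) → ℝ) (v : Fin 2 → ZMod N) : ℝ :=
  (f (modEquiv N (letter 1) v) + f (modEquiv N (letter 2) v)) / 2

theorem isProjFun_avgStep {f : (Fin 2 → ZMod N) → ℝ} (hf : IsProjFun f) :
    IsProjFun (avgStep f) where
  eq_zero v hv := by
    simp only [avgStep, (isProjFun_modEquiv hf _).eq_zero v hv, add_zero, zero_div]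
  smul z v := by simp only [avgStep, (isProjFun_modEquiv hf _).smul z v]

theorem avgStep_iterate_eq {n : ℕ} {f : (Fin 2 → ZMod N) → ℝ} {v : Fin 2 → ZMod N} {m : ℝ}
    (h : ∀ l : List ℕ, l.length = n → (∀ k ∈ l, k = 1 ∨ k = 2) →
      f (modEquiv N (wordProd l) v) = m) :
    avgStep^[n] f v = m := by
  induction n generalizing f with
  | zero =>
    have := h [] rfl (by simp)
    rwa [wordProd, List.map_nil, List.prod_nil, modEquiv_one] at this
  | succ n ih =>
    rw [Function.iterate_succ_apply]
    refine ih fun l hl hk => ?_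
    have hcons : ∀ k, k = 1 ∨ k = 2 →
        f (modEquiv N (letter k) (modEquiv N (wordProd l) v)) = m := by
      intro k hk'
      rw [← modEquiv_mul]
      refine h (k :: l) (by simp [hl]) fun j hj => ?_
      obtain rfl | hj := List.mem_cons.1 hj
      · exact hk'
      · exact hk j hj
    rw [avgStep, hcons 1 (Or.inl rfl), hcons 2 (Or.inr rfl), add_self_div_two]

variable [NeZero N]

theorem sum_avgStep (f : (Fin 2 → ZMod N) → ℝ) : ∑ v, avgStep f v = ∑ v, f v := by
  simp only [avgStep]
  rw [← Finset.sum_div, Finset.sum_add_distrib, (modEquiv N (letter 1)).sum_comp f,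
    (modEquiv N (letter 2)).sum_comp f, add_self_div_two]

theorem sum_avgStep_avgStep_sq_le (f : (Fin 2 → ZMod N) → ℝ) :
    ∑ v, avgStep (avgStep f) v ^ 2 ≤
      ∑ v, f v ^ 2 - (dev f ModularGroup.T + dev f genU) / 16 := by
  have hT : letter 2 * letter 1 = ModularGroup.T * (letter 1 * letter 1) := by decide
  have hU : letter 1 * letter 2 = genU * (letter 1 * letter 1) := by decide
  have hdev : ∀ γ γ' : SL(2, ℤ), dev f γ =
      ∑ v, (f (modEquiv N (γ * γ') v) - f (modEquiv N γ' v)) ^ 2 := by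
    intro γ γ'
    refine (Fintype.sum_equiv (modEquiv N γ') _ _ fun v => ?_).symm
    rw [modEquiv_mul]
  have hsum : ∀ γ, ∑ v, f v ^ 2 = ∑ v, f (modEquiv N γ v) ^ 2 := fun γ =>
    ((modEquiv N γ).sum_comp fun v => f v ^ 2).symm
  have key : ∑ v, f v ^ 2 = ∑ v, (f (modEquiv N (letter 1 * letter 1) v) ^ 2 +
      f (modEquiv N (letter 2 * letter 1) v) ^ 2 + f (modEquiv N (letter 1 * letter 2) v) ^ 2 +
      f (modEquiv N (letter 2 * letter 2) v) ^ 2) / 4 := by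
    rw [← Finset.sum_div]
    simp only [Finset.sum_add_distrib, ← hsum]
    ring
  rw [key, hdev ModularGroup.T (letter 1 * letter 1), hdev genU (letter 1 * letter 1), ← hT, ← hU,
    ← Finset.sum_add_distrib, Finset.sum_div, ← Finset.sum_sub_distrib]
  refine Finset.sum_le_sum fun v _ => ?_
  simp only [avgStep, ← modEquiv_mul]
  generalize f (modEquiv N (letter 1 * letter 1) v) = x
  generalize f (modEquiv N (letter 2 * letter 1) v) = y
  generalize f (modEquiv N (letter 1 * letter 2) v) = z
  generalize f (modEquiv N (letter 2 * letter 2) v) = w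
  nlinarith [sq_nonneg (x - w), sq_nonneg (y - z), sq_nonneg (y - w), sq_nonneg (z - w)]

theorem exists_contraction : ∃ ρ : ℝ, 0 < ρ ∧ ρ < 1 ∧ ∀ N, ∀ [NeZero N]
    (f : (Fin 2 → ZMod N) → ℝ), IsProjFun f → ∑ v, f v = 0 → ∀ k,
      ∑ v, avgStep^[2 * k] f v ^ 2 ≤ ρ ^ k * ∑ v, f v ^ 2 := by
  obtain ⟨c, hc, h⟩ := exists_le_dev
  refine ⟨max (1 - c / 16) (1 / 2), lt_max_of_lt_right (by norm_num),
    max_lt (by linarith) (by norm_num), fun N _ f hf h0 k => ?_⟩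
  induction k generalizing f with
  | zero => simp
  | succ k ih =>
    have h1 : ∑ v, avgStep (avgStep f) v ^ 2 ≤ max (1 - c / 16) (1 / 2) * ∑ v, f v ^ 2 := by
      refine le_trans ?_ (mul_le_mul_of_nonneg_right (le_max_left _ _)
        (Finset.sum_nonneg fun v _ => sq_nonneg (f v)))
      linarith [sum_avgStep_avgStep_sq_le f, h N f hf h0]
    rw [mul_add, mul_one, Function.iterate_add_apply, pow_succ, mul_assoc]
    refine (ih _ (isProjFun_avgStep (isProjFun_avgStep hf)) ?_).trans
      (mul_le_mul_of_nonneg_left h1 (by positivity))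
    exact (sum_avgStep _).trans ((sum_avgStep f).trans h0)

/-- Words of logarithmic length move `![1, 0]` to every projective point. -/
theorem exists_word {ρ : ℝ} (hρ : 0 < ρ) {k : ℕ} (hk : ρ ^ k * (N : ℝ) ^ 6 < 1)
    (hcon : ∀ f : (Fin 2 → ZMod N) → ℝ, IsProjFun f → ∑ v, f v = 0 →
      ∑ v, avgStep^[2 * k] f v ^ 2 ≤ ρ ^ k * ∑ v, f v ^ 2)
    {w : Fin 2 → ZMod N} (hw : IsPrim w) :
    ∃ l : List ℕ, l.length = 2 * k ∧ (∀ j ∈ l, j = 1 ∨ j = 2) ∧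
      ∃ z : (ZMod N)ˣ, modEquiv N (wordProd l) ![1, 0] = (z : ZMod N) • w := by
  classical
  by_contra! hno
  set P : Finset (Fin 2 → ZMod N) := Finset.univ.filter IsPrim with hP
  set O : Finset (Fin 2 → ZMod N) :=
    Finset.univ.filter fun v => ∃ z : (ZMod N)ˣ, v = (z : ZMod N) • w with hO
  have hOP : O ⊆ P := by
    intro v hv
    obtain ⟨z, rfl⟩ := (Finset.mem_filter.1 hv).2
    exact Finset.mem_filter.2 ⟨Finset.mem_univ _, hw.smul z⟩
  have hO1 : (1 : ℝ) ≤ O.card := by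
    have hwO : w ∈ O := Finset.mem_filter.2 ⟨Finset.mem_univ _, 1, by simp⟩
    exact_mod_cast Finset.card_pos.2 ⟨w, hwO⟩
  have hOP' : (O.card : ℝ) ≤ P.card := by exact_mod_cast Finset.card_le_card hOP
  have hV : (Finset.univ : Finset (Fin 2 → ZMod N)).card = N ^ 2 := by
    simp [Finset.card_univ, ZMod.card]
  have hPN : (P.card : ℝ) ≤ (N : ℝ) ^ 2 := by
    exact_mod_cast (Finset.card_le_univ P).trans_eq hV
  have hP0 : (0 : ℝ) < P.card := by linarith
  set m : ℝ := O.card / P.card with hm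
  have hm1 : m ≤ 1 := (div_le_one hP0).2 hOP'
  have hm0 : 1 / (N : ℝ) ^ 2 ≤ m := by
    rw [hm]
    gcongr
  have hN : (0 : ℝ) < N := by exact_mod_cast Nat.pos_of_ne_zero (NeZero.ne N)
  have hm_pos : 0 < m := lt_of_lt_of_le (by positivity) hm0
  set f : (Fin 2 → ZMod N) → ℝ := fun v => (if v ∈ O then 1 else 0) - if v ∈ P then m else 0
  have hf : IsProjFun f := by
    refine ⟨fun v hv => ?_, fun z v => ?_⟩
    · have h1 : v ∉ P := fun h => hv (Finset.mem_filter.1 h).2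
      have h2 : v ∉ O := fun h => h1 (hOP h)
      simp only [f, h1, h2, if_false, sub_zero]
    · have h1 : (z : ZMod N) • v ∈ P ↔ v ∈ P := by
        simp only [hP, Finset.mem_filter, Finset.mem_univ, true_and]
        refine ⟨fun h => ?_, fun h => h.smul z⟩
        simpa [smul_smul] using h.smul z⁻¹
      have h2 : (z : ZMod N) • v ∈ O ↔ v ∈ O := by
        simp only [hO, Finset.mem_filter, Finset.mem_univ, true_and]
        constructor
        · rintro ⟨y, hy⟩
          exact ⟨z⁻¹ * y, by rw [Units.val_mul, mul_smul, ← hy, smul_smul]; simp⟩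
        · rintro ⟨y, rfl⟩
          exact ⟨z * y, by rw [Units.val_mul, mul_smul]⟩
      simp only [f, h1, h2]
  have h0 : ∑ v, f v = 0 := by
    simp only [f, Finset.sum_sub_distrib, Finset.sum_ite_mem, Finset.univ_inter, Finset.sum_const,
      nsmul_eq_mul, mul_one, hm]
    field_simp
    ring
  have hsq : ∑ v, f v ^ 2 ≤ (N : ℝ) ^ 2 := by
    have : ∀ v ∈ Finset.univ, f v ^ 2 ≤ 1 := by
      intro v _
      rw [sq_le_one_iff_abs_le_one, abs_le]
      simp only [f]
      split_ifs <;> constructor <;> linarith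
    simpa [hV, ZMod.card] using Finset.sum_le_card_nsmul _ _ _ this
  have hval : avgStep^[2 * k] f ![1, 0] = -m := by
    refine avgStep_iterate_eq fun l hl hlk => ?_
    have h1 : modEquiv N (wordProd l) ![1, 0] ∉ O := fun h => by
      obtain ⟨z, hz⟩ := (Finset.mem_filter.1 h).2
      exact hno l hl hlk z hz
    have h2 : modEquiv N (wordProd l) ![1, 0] ∈ P :=
      Finset.mem_filter.2 ⟨Finset.mem_univ _, isPrim_modEquiv.2 isPrim_e⟩
    simp only [f, h1, h2, if_true, if_false, zero_sub]
  have h1 := Finset.single_le_sum (f := fun v => avgStep^[2 * k] f v ^ 2)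
    (fun v _ => sq_nonneg _) (Finset.mem_univ ![1, 0])
  simp only [hval, neg_sq] at h1
  have h2 : 1 / (N : ℝ) ^ 4 ≤ m ^ 2 := by
    refine le_trans (le_of_eq ?_) (pow_le_pow_left₀ (by positivity) hm0 2)
    field_simp
  have h3 := (h2.trans h1).trans ((hcon f hf h0).trans
    (mul_le_mul_of_nonneg_left hsq (by positivity)))
  rw [div_le_iff₀ (by positivity)] at h3
  nlinarith

end RandomWords

/-- Modular Zaremba: there is `C > 0` such that for every large enough `N` and every
`0 ≤ u < N` there are `ℓ ≤ C·log N`, exponents `a₁, …, a_ℓ ∈ {1,2}` and coprime positive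
integers `q, p` with `(q,p)ᵀ = A^{a₁} D ⋯ A^{a_ℓ} D (1,0)ᵀ`, `q` a unit mod `N`, and
`p ≡ u·q (mod N)`, i.e. `u ≡ [a₁,1,…,a_ℓ,1] (mod N)`. -/
theorem modular_zaremba :
    ∃ C : ℝ, 0 < C ∧ ∃ N₀ : ℕ, ∀ N : ℕ, N₀ ≤ N → ∀ u : ℕ, u < N →
      ∃ ℓ : ℕ, (ℓ : ℝ) ≤ C * Real.log N ∧
        ∃ a : Fin ℓ → ℕ, (∀ j, a j = 1 ∨ a j = 2) ∧
          ∃ q p : ℕ, 0 < q ∧ 0 < p ∧ Nat.gcd q p = 1 ∧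
            (List.ofFn fun j => matA ^ (a j) * matD).prod *ᵥ ![1, 0] =
              ![(q : ℤ), (p : ℤ)] ∧
            IsUnit (q : ZMod N) ∧ (p : ZMod N) = (u : ZMod N) * (q : ZMod N) := by
  obtain ⟨ρ, hρ, hρ1, hcon⟩ := exists_contraction
  have hL : 0 < -Real.log ρ := neg_pos.2 (Real.log_neg hρ hρ1)
  refine ⟨12 / -Real.log ρ + 4, by positivity, 2, fun N hN u _ => ?_⟩
  have : NeZero N := ⟨by omega⟩
  have hN0 : (0 : ℝ) < N := by positivity
  have hlog : 1 / 2 ≤ Real.log N :=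
    le_trans (by linarith [Real.log_two_gt_d9]) (Real.log_le_log two_pos (by exact_mod_cast hN))
  set k := ⌊6 * Real.log N / -Real.log ρ⌋₊ + 1 with hk
  have hk1 : 6 * Real.log N / -Real.log ρ < k := by
    rw [hk]
    push_cast
    exact Nat.lt_floor_add_one _
  have hk2 : (k : ℝ) ≤ 6 * Real.log N / -Real.log ρ + 1 := by
    rw [hk]
    push_cast
    gcongr
    exact Nat.floor_le (by positivity)
  have hsmall : ρ ^ k * (N : ℝ) ^ 6 < 1 := by
    rw [← Real.log_neg_iff (by positivity), Real.log_mul (by positivity) (by positivity),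
      Real.log_pow, Real.log_pow]
    rw [div_lt_iff₀ hL] at hk1
    push_cast
    linarith
  have hw : IsPrim (![1, (u : ZMod N)] : Fin 2 → ZMod N) := ⟨1, 0, by simp⟩
  obtain ⟨l, hl, hl12, z, hz⟩ := exists_word hρ hsmall (fun f hf h0 => hcon N f hf h0 k) hw
  obtain ⟨q, p, hq, hp, hgcd, h⟩ := exists_wordProd_mulVec l
  rw [modEquiv_e N _ h] at hz
  have hqz : (q : ZMod N) = z := by simpa using congrFun hz 0
  have hpz : (p : ZMod N) = z * u := by simpa using congrFun hz 1
  refine ⟨l.length, ?_, l.get, fun j => hl12 _ (l.get_mem j), q, p, hq, hp ?_, hgcd, ?_, ?_, ?_⟩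
  · rw [hl, add_mul, div_mul_eq_mul_div]
    push_cast
    have : 12 * Real.log N / -Real.log ρ = 2 * (6 * Real.log N / -Real.log ρ) := by ring
    linarith
  · rintro rfl
    simp [hk] at hl
  · rw [← h, coe_wordProd, ← List.ofFn_getElem_eq_map]
    rfl
  · rw [hqz]
    exact z.isUnit
  · rw [hqz, hpz, mul_comm]
end

section
/- Let 𝓜 be the set of 2×2 integer matrices consisting of A^a·C for integers a ≥ 0 together with B^a·C for integers a ≥ 1. If M₁, M₂ ∈ 𝓜 and there exist integers x, y, x', y' with x > 0, y ≥ 0, x' > 0, y' ≥ 0 such that M₁·(x, y)ᵀ = M₂·(x', y')ᵀ, then M₁ = M₂. -/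
open Matrix

/-- The matrix `B = [[2,0],[1,2]]` over the integers. -/
def matB : Matrix (Fin 2) (Fin 2) ℤ := !![2, 0; 1, 2]

/-- The matrix `C = [[2,1],[1,1]]` over the integers. -/
def matC : Matrix (Fin 2) (Fin 2) ℤ := !![2, 1; 1, 1]

/-- The set `𝓜` of matrices of the form `Aᵃ C` for `a ≥ 0` or `Bᵃ C` for `a ≥ 1`. -/
def mSet : Set (Matrix (Fin 2) (Fin 2) ℤ) :=
  {M | (∃ a : ℕ, M = matA ^ a * matC) ∨ (∃ a : ℕ, 1 ≤ a ∧ M = matB ^ a * matC)}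

/-- Vectors in the image under `Aᵃ C` of the cone `x > 0`, `y ≥ 0` have slope `v₀ / v₁` in
`(a + 1, a + 2]`. -/
theorem matA_pow_mul_matC_mulVec_bounds (a : ℕ) {x y : ℤ} (hx : 0 < x) (hy : 0 ≤ y) :
    0 < ((matA ^ a * matC) *ᵥ ![x, y]) 1 ∧
      (a + 1) * ((matA ^ a * matC) *ᵥ ![x, y]) 1 < ((matA ^ a * matC) *ᵥ ![x, y]) 0 ∧
      ((matA ^ a * matC) *ᵥ ![x, y]) 0 ≤ (a + 2) * ((matA ^ a * matC) *ᵥ ![x, y]) 1 := by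
  induction a with
  | zero =>
    simp [matC, mulVec, dotProduct, Fin.sum_univ_two]
    grind
  | succ a ih =>
    rw [pow_succ', Matrix.mul_assoc, ← mulVec_mulVec]
    generalize (matA ^ a * matC) *ᵥ ![x, y] = v at ih ⊢
    simp [matA, mulVec, dotProduct, Fin.sum_univ_two]
    grind

/-- Vectors in the image under `Bᵃ C` of the cone `x > 0`, `y ≥ 0` have inverse slope `v₁ / v₀` in
`[(a + 1) / 2, (a + 2) / 2)`. -/
theorem matB_pow_mul_matC_mulVec_bounds (a : ℕ) {x y : ℤ} (hx : 0 < x) (hy : 0 ≤ y) :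
    0 < ((matB ^ a * matC) *ᵥ ![x, y]) 0 ∧
      (a + 1) * ((matB ^ a * matC) *ᵥ ![x, y]) 0 ≤ 2 * ((matB ^ a * matC) *ᵥ ![x, y]) 1 ∧
      2 * ((matB ^ a * matC) *ᵥ ![x, y]) 1 < (a + 2) * ((matB ^ a * matC) *ᵥ ![x, y]) 0 := by
  induction a with
  | zero =>
    simp [matC, mulVec, dotProduct, Fin.sum_univ_two]
    grind
  | succ a ih =>
    rw [pow_succ', Matrix.mul_assoc, ← mulVec_mulVec]
    generalize (matB ^ a * matC) *ᵥ ![x, y] = v at ih ⊢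
    simp [matB, mulVec, dotProduct, Fin.sum_univ_two]
    grind

/-- The image of the cone `x > 0`, `y ≥ 0` under `Aᵃ C` lies strictly below the diagonal, and its
image under `Bᵇ C` with `b ≥ 1` does not. -/
theorem matA_pow_mul_matC_mulVec_ne_matB_pow_mul_matC_mulVec (a : ℕ) {b : ℕ} (hb : 1 ≤ b)
    {x y x' y' : ℤ} (hx : 0 < x) (hy : 0 ≤ y) (hx' : 0 < x') (hy' : 0 ≤ y') :
    (matA ^ a * matC) *ᵥ ![x, y] ≠ (matB ^ b * matC) *ᵥ ![x', y'] := by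
  intro h
  obtain ⟨hpos, hlow, -⟩ := matA_pow_mul_matC_mulVec_bounds a hx hy
  obtain ⟨hpos', hlow', -⟩ := matB_pow_mul_matC_mulVec_bounds b hx' hy'
  rw [← h] at hpos' hlow'
  have hb' : (1 : ℤ) ≤ b := by exact_mod_cast hb
  nlinarith [mul_nonneg (Int.natCast_nonneg a) hpos.le,
    mul_le_mul_of_nonneg_right hb' hpos'.le]

/-- Half-open intervals `(m, m + 1]` and `(n, n + 1]` with integer endpoints that share a point
coincide, in homogeneous coordinates. -/
theorem eq_of_mul_lt_of_le_add_one_mul {m n s t : ℤ} (ht : 0 < t) (hm : m * t < s)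
    (hm' : s ≤ (m + 1) * t) (hn : n * t < s) (hn' : s ≤ (n + 1) * t) : m = n := by
  have h₁ := lt_of_mul_lt_mul_right (hm.trans_le hn') ht.le
  have h₂ := lt_of_mul_lt_mul_right (hn.trans_le hm') ht.le
  omega

/-- Half-open intervals `[m, m + 1)` and `[n, n + 1)` with integer endpoints that share a point
coincide, in homogeneous coordinates. -/
theorem eq_of_mul_le_of_lt_add_one_mul {m n s t : ℤ} (ht : 0 < t) (hm : m * t ≤ s)
    (hm' : s < (m + 1) * t) (hn : n * t ≤ s) (hn' : s < (n + 1) * t) : m = n := by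
  have h₁ := lt_of_mul_lt_mul_right (hm.trans_lt hn') ht.le
  have h₂ := lt_of_mul_lt_mul_right (hn.trans_lt hm') ht.le
  omega

/-- If `M₁, M₂ ∈ 𝓜` agree on some vectors `(x,y)ᵀ, (x',y')ᵀ` with `x, x' > 0` and
`y, y' ≥ 0`, i.e. `M₁ (x,y)ᵀ = M₂ (x',y')ᵀ`, then `M₁ = M₂`. -/
theorem mSet_distinguishable (M₁ M₂ : Matrix (Fin 2) (Fin 2) ℤ)
    (h₁ : M₁ ∈ mSet) (h₂ : M₂ ∈ mSet) (x y x' y' : ℤ)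
    (hx : 0 < x) (hy : 0 ≤ y) (hx' : 0 < x') (hy' : 0 ≤ y')
    (h : M₁ *ᵥ ![x, y] = M₂ *ᵥ ![x', y']) : M₁ = M₂ := by
  rcases h₁ with ⟨a, rfl⟩ | ⟨a, ha, rfl⟩ <;> rcases h₂ with ⟨b, rfl⟩ | ⟨b, hb, rfl⟩
  · obtain ⟨hpos, hlow, hupp⟩ := matA_pow_mul_matC_mulVec_bounds a hx hy
    obtain ⟨-, hlow', hupp'⟩ := matA_pow_mul_matC_mulVec_bounds b hx' hy'
    rw [← h] at hlow' hupp'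
    have hab : (a + 1 : ℤ) = b + 1 :=
      eq_of_mul_lt_of_le_add_one_mul hpos hlow (by linarith) hlow' (by linarith)
    obtain rfl : a = b := by omega
    rfl
  · exact absurd h (matA_pow_mul_matC_mulVec_ne_matB_pow_mul_matC_mulVec a hb hx hy hx' hy')
  · exact absurd h.symm (matA_pow_mul_matC_mulVec_ne_matB_pow_mul_matC_mulVec b ha hx' hy' hx hy)
  · obtain ⟨hpos, hlow, hupp⟩ := matB_pow_mul_matC_mulVec_bounds a hx hy
    obtain ⟨-, hlow', hupp'⟩ := matB_pow_mul_matC_mulVec_bounds b hx' hy'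
    rw [← h] at hlow' hupp'
    have hab : (a + 1 : ℤ) = b + 1 :=
      eq_of_mul_le_of_lt_add_one_mul hpos hlow (by linarith) hlow' (by linarith)
    obtain rfl : a = b := by omega
    rfl
end
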